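/- arXiv:1904.06545 — 2 statements merged into one kernel-verified Lean document; each statement's English description precedes it below -/
import Mathlib

section
/- Let n ≥ 5 and let p > 3 be a prime. For the alternating group A_n, there exist irreducible complex characters α and β of A_n, both of degree greater than 1 and both of degree not divisible by p, such that: β(1) does not divide α(1); α extends to Aut(A_n); and β is invariant under every automorphism of A_n of p-power order. -/
open CategoryTheory

section General

/-- The permutation representation on functions. -/
def fnRep (G I : Type) [Group G] [MulAction G I] : Representation ℂ G (I → ℂ) where
  toFun g := LinearMap.funLeft ℂ ℂ (fun i => g⁻¹ • i)
  map_one' := by ext; simp [LinearMap.funLeft]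
  map_mul' a b := by ext; simp [LinearMap.funLeft, mul_smul]

theorem fnRep_apply {G I : Type} [Group G] [MulAction G I] (g : G) (f : I → ℂ) (i : I) :
    fnRep G I g f i = f (g⁻¹ • i) := rfl

/-- Stability of a subspace. -/
def Stab {G V : Type} [Group G] [AddCommGroup V] [Module ℂ V] (ρ : Representation ℂ G V)
    (U : Submodule ℂ V) : Prop := ∀ g : G, ∀ u ∈ U, ρ g u ∈ U

/-- The subrepresentation on a stable subspace. -/
def subRep {G V : Type} [Group G] [AddCommGroup V] [Module ℂ V] (ρ : Representation ℂ G V)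
    (U : Submodule ℂ V) (h : Stab ρ U) : Representation ℂ G U where
  toFun g := (ρ g).restrict (h g)
  map_one' := by ext; simp
  map_mul' x y := by ext; simp

/-- Irreducible stable subspace. -/
def Irr {G V : Type} [Group G] [AddCommGroup V] [Module ℂ V] (ρ : Representation ℂ G V)
    (U : Submodule ℂ V) : Prop :=
  U ≠ ⊥ ∧ ∀ U' ≤ U, Stab ρ U' → U' = ⊥ ∨ U' = U

theorem simple_of_irr {G V : Type} [Group G] [Fintype G] [AddCommGroup V] [Module ℂ V]
    [FiniteDimensional ℂ V] (ρ : Representation ℂ G V)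
    (U : Submodule ℂ V) (h : Stab ρ U) (hi : Irr ρ U) :
    Simple (FDRep.of (subRep ρ U h)) := by
  have hirr : Representation.IsIrreducible (subRep ρ U h) := by
    have hnt : Nontrivial U := (Submodule.nontrivial_iff_ne_bot).2 hi.1
    have : Nontrivial (Subrepresentation (subRep ρ U h)) := by
      refine ⟨⊥, ⊤, fun hbt => ?_⟩
      obtain ⟨x, hx⟩ := exists_ne (0 : U)
      have : x ∈ (⊤ : Subrepresentation (subRep ρ U h)).toSubmodule := Submodule.mem_top
      rw [← hbt] at this
      exact hx ((Submodule.mem_bot ℂ).1 this)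
    refine ⟨fun S => ?_⟩
    have h1 : Stab ρ (S.toSubmodule.map U.subtype) := by
      rintro g _ ⟨u, hu, rfl⟩
      exact ⟨_, S.apply_mem_toSubmodule g hu, rfl⟩
    rcases hi.2 _ (Submodule.map_subtype_le U S.toSubmodule) h1 with h2 | h2
    · left
      apply Subrepresentation.toSubmodule_injective
      change S.toSubmodule = ⊥
      rw [Submodule.eq_bot_iff]
      intro x hx
      have : U.subtype x ∈ S.toSubmodule.map U.subtype := ⟨x, hx, rfl⟩
      rw [h2, Submodule.mem_bot] at this
      exact Subtype.ext this
    · right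
      apply Subrepresentation.toSubmodule_injective
      change S.toSubmodule = ⊤
      rw [Submodule.eq_top_iff']
      intro x
      have : (x : V) ∈ S.toSubmodule.map U.subtype := by rw [h2]; exact x.2
      obtain ⟨y, hy, hyx⟩ := this
      have : y = x := Subtype.ext hyx
      exact this ▸ hy
  rw [FDRep.simple_iff_char_is_norm_one]
  have : Invertible (Nat.card G : ℂ) := invertibleOfNonzero (by simp)
  have key := Representation.char_orthonormal (subRep ρ U h) (subRep ρ U h)
  rw [if_pos ⟨Representation.Equiv.refl _⟩] at key
  have h0 : (Nat.card G : ℂ) ≠ 0 := by simp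
  have := (inv_mul_eq_one₀ h0).1 (by exact_mod_cast key)
  rw [this]
  rfl

theorem finrank_of {G V : Type} [Group G] [AddCommGroup V] [Module ℂ V]
    [FiniteDimensional ℂ V] (ρ : Representation ℂ G V)
    (U : Submodule ℂ V) (h : Stab ρ U) :
    Module.finrank ℂ (FDRep.of (subRep ρ U h)) = Module.finrank ℂ U := rfl

theorem irr_crit {G I : Type} [Group G] [Fintype I] [MulAction G I]
    (W : Submodule ℂ (I → ℂ)) (hW : Stab (fnRep G I) W) (hW0 : W ≠ ⊥)
    (κ : (I → ℂ) →ₗ[ℂ] (I → ℂ)) (o : I)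
    (hk : ∀ U : Submodule ℂ (I → ℂ), Stab (fnRep G I) U → ∀ u ∈ U, κ u ∈ U)
    (h1 : ∀ f ∈ W, κ f o = 0 → κ f = 0)
    (h2 : ∀ f ∈ W, (∀ g : G, κ (fnRep G I g f) o = 0) → f = 0) :
    Irr (fnRep G I) W := by
  refine ⟨hW0, fun U hU hs => ?_⟩
  by_contra! hcon
  obtain ⟨hb, ht⟩ := hcon
  -- orthogonal complement
  let U' : Submodule ℂ (I → ℂ) :=
    { carrier := {f | f ∈ W ∧ ∀ u ∈ U, ∑ i, f i * (starRingEnd ℂ) (u i) = 0}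
      add_mem' := by
        rintro a b ⟨ha, ha'⟩ ⟨hb, hb'⟩
        refine ⟨W.add_mem ha hb, fun u hu => ?_⟩
        simp [add_mul, Finset.sum_add_distrib, ha' u hu, hb' u hu]
      zero_mem' := ⟨W.zero_mem, by simp⟩
      smul_mem' := by
        rintro c a ⟨ha, ha'⟩
        refine ⟨W.smul_mem c ha, fun u hu => ?_⟩
        simp [mul_assoc, ← Finset.mul_sum, ha' u hu] }
  have hs' : Stab (fnRep G I) U' := by
    rintro g f ⟨hf, hf'⟩
    refine ⟨hW g f hf, fun u hu => ?_⟩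
    rw [← hf' _ (hs g⁻¹ u hu)]
    refine Fintype.sum_equiv (MulAction.toPerm g⁻¹) _ _ fun i => ?_
    simp [fnRep_apply]
  have hdis : ∀ f, f ∈ U → f ∈ U' → f = 0 := by
    rintro f hf ⟨-, hf'⟩
    have := hf' f hf
    have h3 : ∑ i, Complex.normSq (f i) = 0 := by
      have : ((∑ i, Complex.normSq (f i) : ℝ) : ℂ) = 0 := by
        push_cast
        simpa [Complex.mul_conj] using this
      exact_mod_cast this
    rw [Finset.sum_eq_zero_iff_of_nonneg (fun i _ => Complex.normSq_nonneg _)] at h3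
    funext i
    exact Complex.normSq_eq_zero.1 (h3 i (Finset.mem_univ i))
  have hb' : U' ≠ ⊥ := by
    intro hbot
    apply ht
    apply le_antisymm hU
    intro f hf
    -- orthogonal projection via Euclidean space
    let e : EuclideanSpace ℂ I ≃ₗ[ℂ] (I → ℂ) := WithLp.linearEquiv 2 ℂ (I → ℂ)
    let K : Submodule ℂ (EuclideanSpace ℂ I) := U.comap e.toLinearMap
    obtain ⟨y, hy, z, hz, hyz⟩ := K.exists_add_mem_mem_orthogonal (e.symm f)
    have hz' : e z ∈ U' := by
      refine ⟨?_, fun u hu => ?_⟩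
      · have : e z = f - e y := by
          have := congrArg e hyz
          simp at this
          rw [this]; simp
        rw [this]
        exact W.sub_mem hf (hU hy)
      · have := (Submodule.mem_orthogonal K z).1 hz (e.symm u) (by simpa [K] using hu)
        simpa [PiLp.inner_apply, e] using this
    rw [hbot, Submodule.mem_bot] at hz'
    have : f = e y := by
      have := congrArg e hyz
      simpa [hz'] using this
    rw [this]
    exact hy
  have hex : ∀ X : Submodule ℂ (I → ℂ), X ≤ W → Stab (fnRep G I) X → X ≠ ⊥ →
      ∃ x ∈ X, κ x o ≠ 0 := by
    intro X hX hXs hX0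
    by_contra! hc
    apply hX0
    rw [Submodule.eq_bot_iff]
    intro x hx
    exact h2 x (hX hx) fun g => hc _ (hXs g x hx)
  have hU'W : U' ≤ W := fun f hf => hf.1
  obtain ⟨u, hu, hu0⟩ := hex U hU hs hb
  obtain ⟨v, hv, hv0⟩ := hex U' hU'W hs' hb'
  have h3 := h1 (κ v o • u - κ u o • v)
    (W.sub_mem (W.smul_mem _ (hU hu)) (W.smul_mem _ (hU'W hv))) (by simp [mul_comm])
  rw [map_sub, map_smul, map_smul, sub_eq_zero] at h3
  have h4 := hdis (κ v o • κ u) (U.smul_mem _ (hk U hs u hu))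
    (h3 ▸ U'.smul_mem _ (hk U' hs' v hv))
  have := congrFun h4 o
  simp [hu0, hv0] at this

theorem descent {G V : Type} [Group G] [AddCommGroup V] [Module ℂ V]
    [FiniteDimensional ℂ V] (ρ : Representation ℂ G V) (N : Subgroup G) [N.Normal]
    (t : G) (ht : ∀ g, g ∈ N ∨ ∃ m ∈ N, g = t * m)
    (W : Submodule ℂ V) (hs : Stab ρ W) (hW : Irr ρ W) :
    ∃ U : Submodule ℂ V, Stab (ρ.comp N.subtype) U ∧ Irr (ρ.comp N.subtype) U ∧
      (Module.finrank ℂ U = Module.finrank ℂ W ∨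
        2 * Module.finrank ℂ U = Module.finrank ℂ W) := by
  classical
  let P : ℕ → Prop := fun d => ∃ U : Submodule ℂ V, U ≤ W ∧ U ≠ ⊥ ∧ Stab (ρ.comp N.subtype) U ∧
    Module.finrank ℂ U = d
  have hP : ∃ d, P d := ⟨_, W, le_rfl, hW.1, fun g u hu => hs g u hu, rfl⟩
  obtain ⟨U, hUW, hU0, hUs, hUd⟩ := Nat.find_spec hP
  have hmin : ∀ U' : Submodule ℂ V, U' ≤ U → Stab (ρ.comp N.subtype) U' → U' = ⊥ ∨ U' = U := by
    intro U' hU' hs'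
    by_contra! hc
    have hlt : Module.finrank ℂ U' < Nat.find hP := by
      rw [← hUd]
      exact Submodule.finrank_lt_finrank_of_lt (lt_of_le_of_ne hU' hc.2)
    exact Nat.find_min hP hlt ⟨U', hU'.trans hUW, hc.1, hs', rfl⟩
  refine ⟨U, hUs, ⟨hU0, hmin⟩, ?_⟩
  have hcomp : ∀ a b : G, ∀ v, ρ (a * b) v = ρ a (ρ b v) := fun a b v => by simp
  have hN : ∀ m ∈ N, ∀ u ∈ U, ρ m u ∈ U := fun m hm u hu => hUs ⟨m, hm⟩ u hu
  let T : Submodule ℂ V := U.map (ρ t)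
  have hinj : Function.Injective (ρ t) := by
    intro x y hxy
    have := congrArg (ρ t⁻¹) hxy
    simpa [← hcomp] using this
  have hTN : ∀ m ∈ N, ∀ u ∈ T, ρ m u ∈ T := by
    rintro m hm _ ⟨u, hu, rfl⟩
    refine ⟨ρ (t⁻¹ * m * t) u, hN _ ?_ u hu, ?_⟩
    · simpa using (inferInstance : N.Normal).conj_mem m hm t⁻¹
    · rw [← hcomp, ← hcomp]; congr 2; group
  have hTd : Module.finrank ℂ T = Module.finrank ℂ U :=
    (LinearEquiv.finrank_eq (Submodule.equivMapOfInjective _ hinj U)).symm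
  have ht2 : t * t ∈ N := by
    rcases ht (t * t) with h | ⟨m, hm, h⟩
    · exact h
    · have : t = m := mul_left_cancel h
      rw [← this] at hm
      exact N.mul_mem hm hm
  have htT : ∀ u ∈ T, ρ t u ∈ U := by
    rintro _ ⟨u, hu, rfl⟩
    rw [← hcomp]
    exact hN _ ht2 u hu
  have hsum : U ⊔ T = W := by
    refine (hW.2 (U ⊔ T) ?_ ?_).resolve_left ?_
    · refine sup_le hUW ?_
      rintro _ ⟨u, hu, rfl⟩
      exact hs t u (hUW hu)
    · intro g x hx
      have hNs : ∀ m ∈ N, ∀ x ∈ U ⊔ T, ρ m x ∈ U ⊔ T := by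
        intro m hm x hx
        obtain ⟨a, ha, b, hb, rfl⟩ := Submodule.mem_sup.1 hx
        rw [map_add]
        exact Submodule.add_mem_sup (hN m hm a ha) (hTN m hm b hb)
      rcases ht g with h | ⟨m, hm, rfl⟩
      · exact hNs g h x hx
      · rw [hcomp]
        obtain ⟨a, ha, b, hb, hab⟩ := Submodule.mem_sup.1 (hNs m hm x hx)
        rw [← hab, map_add, add_comm]
        exact Submodule.add_mem_sup (htT b hb) ⟨a, ha, rfl⟩
    · intro h
      exact hU0 (le_bot_iff.1 (h ▸ le_sup_left))
  have hinf := hmin (U ⊓ T) inf_le_left fun g x hx => ⟨hUs g x hx.1, hTN g g.2 x hx.2⟩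
  have hdim := Submodule.finrank_sup_add_finrank_inf_eq U T
  rw [hsum, hTd] at hdim
  rcases hinf with h | h
  · right
    rw [h] at hdim
    simp at hdim
    omega
  · left
    rw [h] at hdim
    omega

end General

section Dims

theorem rank_lemma {I J : Type} [Fintype I] [Fintype J] [DecidableEq I] [DecidableEq J]
    (M : Matrix J I ℂ) :
    Module.finrank ℂ (LinearMap.ker M.mulVecLin) + Fintype.card J =
      Fintype.card I + Module.finrank ℂ (LinearMap.ker M.transpose.mulVecLin) := by
  have h1 := LinearMap.finrank_range_add_finrank_ker M.mulVecLin
  have h2 := LinearMap.finrank_range_add_finrank_ker M.transpose.mulVecLin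
  have h3 : M.transpose.rank = M.rank := Matrix.rank_transpose M
  simp only [Matrix.rank] at h3
  simp only [Module.finrank_fintype_fun_eq_card] at h1 h2
  omega

/-- Functions with zero sum. -/
def sumZero (I : Type) [Fintype I] : Submodule ℂ (I → ℂ) :=
  LinearMap.ker (∑ i, LinearMap.proj i : (I → ℂ) →ₗ[ℂ] ℂ)

theorem mem_sumZero {I : Type} [Fintype I] (f : I → ℂ) : f ∈ sumZero I ↔ ∑ i, f i = 0 := by
  simp [sumZero, LinearMap.sum_apply]

theorem finrank_sumZero (I : Type) [Fintype I] [Nonempty I] :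
    Module.finrank ℂ (sumZero I) + 1 = Fintype.card I := by
  classical
  have h := LinearMap.finrank_range_add_finrank_ker (∑ i, LinearMap.proj i : (I → ℂ) →ₗ[ℂ] ℂ)
  have hr : LinearMap.range (∑ i, LinearMap.proj i : (I → ℂ) →ₗ[ℂ] ℂ) = ⊤ := by
    rw [LinearMap.range_eq_top]
    intro c
    refine ⟨Pi.single (Classical.arbitrary I) c, ?_⟩
    simp [LinearMap.sum_apply]
  rw [hr] at h
  simp at h
  unfold sumZero
  omega

theorem sumZero_stab (G I : Type) [Group G] [MulAction G I] [Fintype I] :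
    Stab (fnRep G I) (sumZero I) := by
  intro g f hf
  rw [mem_sumZero] at *
  rw [← hf]
  exact Fintype.sum_equiv (MulAction.toPerm g⁻¹) _ _ fun i => rfl

theorem irr_crit_stab {G I : Type} [Group G] [Fintype G] [MulAction G I] [Fintype I]
    (W : Submodule ℂ (I → ℂ)) (hW : Stab (fnRep G I) W) (hW0 : W ≠ ⊥) (o : I)
    (h1 : ∀ F ∈ W, (∀ g : G, g • o = o → ∀ x, F (g • x) = F x) → F o = 0 → F = 0)
    (h2 : ∀ F ∈ W, (∀ g : G, F (g • o) = 0) → F = 0) :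
    Irr (fnRep G I) W := by
  classical
  have hav : ∀ f : I → ℂ, (∑ g : MulAction.stabilizer G o, fnRep G I g) f o =
      (Fintype.card (MulAction.stabilizer G o) : ℂ) * f o := by
    intro f
    rw [LinearMap.sum_apply, Finset.sum_apply]
    rw [Finset.sum_congr rfl (g := fun _ => f o)]
    · simp
    · intro g _
      have : (g : G)⁻¹ • o = o := inv_smul_eq_iff.2 g.2.symm
      rw [fnRep_apply, this]
  have hc : (Fintype.card (MulAction.stabilizer G o) : ℂ) ≠ 0 := by
    exact_mod_cast Fintype.card_ne_zero
  refine irr_crit _ hW hW0 (∑ g : MulAction.stabilizer G o, fnRep G I g) o ?_ ?_ ?_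
  · intro U hU u hu
    rw [LinearMap.sum_apply]
    exact U.sum_mem fun g _ => hU g u hu
  · intro f hf h0
    set F := (∑ g : MulAction.stabilizer G o, fnRep G I g) f with hF
    refine h1 F ?_ ?_ h0
    · rw [hF, LinearMap.sum_apply]
      exact W.sum_mem fun g _ => hW g f hf
    · intro g hg x
      rw [hF, LinearMap.sum_apply, Finset.sum_apply, Finset.sum_apply]
      let g' : MulAction.stabilizer G o := ⟨g, hg⟩
      refine Fintype.sum_equiv (Equiv.mulLeft g'⁻¹) _ _ fun h => ?_
      simp [fnRep_apply, g', mul_smul]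
  · intro f hf h
    refine h2 f hf fun g => ?_
    have := h g⁻¹
    rw [hav, fnRep_apply] at this
    simpa using (mul_eq_zero.1 this).resolve_left hc

theorem sumZero_irr (G I : Type) [Group G] [Fintype G] [MulAction G I] [Fintype I]
    (hI : 2 ≤ Fintype.card I)
    (h2 : ∀ o x y : I, x ≠ o → y ≠ o → ∃ g : G, g • o = o ∧ g • x = y)
    (h1 : ∀ x y : I, ∃ g : G, g • x = y) :
    Irr (fnRep G I) (sumZero I) := by
  classical
  have hne : Nonempty I := Fintype.card_pos_iff.1 (by omega)
  have o : I := Classical.arbitrary I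
  refine irr_crit_stab _ (sumZero_stab G I) ?_ o ?_ ?_
  · intro h
    have := finrank_sumZero I
    rw [h] at this
    simp at this
    omega
  · intro F hFs hinv h0
    have hconst : ∀ x y, x ≠ o → y ≠ o → F x = F y := by
      intro x y hx hy
      obtain ⟨g, hg, hgx⟩ := h2 o x y hx hy
      rw [← hgx, hinv g hg]
    funext x
    by_cases hx : x = o
    · rw [hx, h0]; rfl
    rw [mem_sumZero, ← Finset.add_sum_erase _ _ (Finset.mem_univ o), h0, zero_add,
      Finset.sum_congr rfl (g := fun _ => F x)
        (fun y hy => hconst y x (Finset.ne_of_mem_erase hy) hx)] at hFs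
    simp [Finset.card_erase_of_mem] at hFs
    rcases hFs with h | h
    · exfalso
      omega
    · exact h
  · intro f hf h
    funext x
    obtain ⟨g, hg⟩ := h1 o x
    rw [← hg]
    exact h g

end Dims

section Helpers

theorem finrank_of_proj {I : Type} [Fintype I] [DecidableEq I] (W : Submodule ℂ (I → ℂ))
    (P : (I → ℂ) →ₗ[ℂ] (I → ℂ)) (h1 : ∀ f, P f ∈ W) (h2 : ∀ f ∈ W, P f = f) :
    (Module.finrank ℂ W : ℂ) = ∑ i, P (Pi.single i 1) i := by
  have hp : LinearMap.IsProj W P := ⟨h1, h2⟩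
  rw [← hp.trace, LinearMap.trace_eq_matrix_trace ℂ (Pi.basisFun ℂ I)]
  simp [Matrix.trace, LinearMap.toMatrix_apply]

theorem finrank_range_ann {I J : Type} [Fintype I] [Fintype J] [DecidableEq I] [DecidableEq J]
    (L : (I → ℂ) →ₗ[ℂ] (J → ℂ)) (A : Submodule ℂ (J → ℂ))
    (hA : ∀ c, c ∈ A ↔ ∀ i, ∑ j, L (Pi.single i 1) j * c j = 0) :
    Module.finrank ℂ (LinearMap.range L) + Module.finrank ℂ A = Fintype.card J := by
  have h := LinearMap.finrank_range_add_finrank_ker (LinearMap.toMatrix' L).transpose.mulVecLin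
  have h3 : (LinearMap.toMatrix' L).transpose.rank = (LinearMap.toMatrix' L).rank :=
    Matrix.rank_transpose _
  have h4 : LinearMap.ker (LinearMap.toMatrix' L).transpose.mulVecLin = A := by
    ext c
    rw [hA, LinearMap.mem_ker, funext_iff]
    simp only [Matrix.mulVecLin_apply, Matrix.mulVec, dotProduct, Matrix.transpose_apply,
      LinearMap.toMatrix'_apply, Pi.zero_apply]
  have h5 : (LinearMap.toMatrix' L).mulVecLin = L := by
    rw [← Matrix.toLin'_apply', Matrix.toLin'_toMatrix']
  unfold Matrix.rank at h3
  rw [h4, h3, h5] at h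
  simpa using h

variable {n : ℕ}

theorem split1 (f : Fin n → ℂ) (a : Fin n) :
    ∑ j, f j = f a + ∑ j ∈ ({a} : Finset (Fin n))ᶜ, f j := by
  rw [← Finset.sum_add_sum_compl ({a} : Finset (Fin n))]
  simp

theorem split2 (f : Fin n → ℂ) {a b : Fin n} (h : a ≠ b) :
    ∑ j, f j = f a + f b + ∑ j ∈ ({a, b} : Finset (Fin n))ᶜ, f j := by
  rw [← Finset.sum_add_sum_compl ({a, b} : Finset (Fin n)), Finset.sum_pair h]

theorem split3 (f : Fin n → ℂ) {a b c : Fin n} (h : a ≠ b) (h2 : a ≠ c) (h3 : b ≠ c) :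
    ∑ j, f j = f a + f b + f c + ∑ j ∈ ({a, b, c} : Finset (Fin n))ᶜ, f j := by
  rw [← Finset.sum_add_sum_compl ({a, b, c} : Finset (Fin n)),
    Finset.sum_insert (by simp [h, h2]), Finset.sum_pair h3]
  ring

theorem split4 (f : Fin n → ℂ) {a b c d : Fin n} (h : a ≠ b) (h2 : a ≠ c) (h3 : b ≠ c)
    (h4 : a ≠ d) (h5 : b ≠ d) (h6 : c ≠ d) :
    ∑ j, f j = f a + f b + f c + f d + ∑ j ∈ ({a, b, c, d} : Finset (Fin n))ᶜ, f j := by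
  rw [← Finset.sum_add_sum_compl ({a, b, c, d} : Finset (Fin n)),
    Finset.sum_insert (by simp [h, h2, h4]), Finset.sum_insert (by simp [h3, h5]),
    Finset.sum_pair h6]
  ring

theorem card1 (a : Fin n) : ((({a} : Finset (Fin n))ᶜ.card : ℕ) : ℂ) = n - 1 := by
  have := Finset.card_add_card_compl ({a} : Finset (Fin n))
  rw [Fintype.card_fin, Finset.card_singleton] at this
  have h : ((1 + ({a} : Finset (Fin n))ᶜ.card : ℕ) : ℂ) = n := by exact_mod_cast this
  rw [← h]; push_cast; ring

theorem card2 {a b : Fin n} (h : a ≠ b) :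
    ((({a, b} : Finset (Fin n))ᶜ.card : ℕ) : ℂ) = n - 2 := by
  have := Finset.card_add_card_compl ({a, b} : Finset (Fin n))
  rw [Fintype.card_fin, Finset.card_pair h] at this
  have h : ((2 + ({a, b} : Finset (Fin n))ᶜ.card : ℕ) : ℂ) = n := by exact_mod_cast this
  rw [← h]; push_cast; ring

theorem card3 {a b c : Fin n} (h : a ≠ b) (h2 : a ≠ c) (h3 : b ≠ c) :
    ((({a, b, c} : Finset (Fin n))ᶜ.card : ℕ) : ℂ) = n - 3 := by
  have := Finset.card_add_card_compl ({a, b, c} : Finset (Fin n))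
  rw [Fintype.card_fin, Finset.card_eq_three.2 ⟨a, b, c, h, h2, h3, rfl⟩] at this
  have h : ((3 + ({a, b, c} : Finset (Fin n))ᶜ.card : ℕ) : ℂ) = n := by exact_mod_cast this
  rw [← h]; push_cast; ring

theorem card4 {a b c d : Fin n} (h : a ≠ b) (h2 : a ≠ c) (h3 : b ≠ c)
    (h4 : a ≠ d) (h5 : b ≠ d) (h6 : c ≠ d) :
    ((({a, b, c, d} : Finset (Fin n))ᶜ.card : ℕ) : ℂ) = n - 4 := by
  have := Finset.card_add_card_compl ({a, b, c, d} : Finset (Fin n))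
  rw [Fintype.card_fin, Finset.card_insert_of_notMem (by simp [h, h2, h4]),
    Finset.card_eq_three.2 ⟨b, c, d, h3, h5, h6, rfl⟩] at this
  have h : ((4 + ({a, b, c, d} : Finset (Fin n))ᶜ.card : ℕ) : ℂ) = n := by exact_mod_cast this
  rw [← h]; push_cast; ring

theorem cast_ne {n k : ℕ} (h : n ≠ k) : (n : ℂ) - k ≠ 0 := by
  rw [sub_ne_zero]; exact_mod_cast h

theorem alt_trans {k : ℕ} (hk : k + 2 ≤ n) (x y : Fin k → Fin n)
    (hx : Function.Injective x) (hy : Function.Injective y) :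
    ∃ g : alternatingGroup (Fin n), ∀ i, g • x i = y i := by
  have h := alternatingGroup.isMultiplyPretransitive (Fin n)
  rw [Nat.card_fin] at h
  have h' : MulAction.IsMultiplyPretransitive (alternatingGroup (Fin n)) (Fin n) k :=
    MulAction.isMultiplyPretransitive_of_le (show k ≤ n - 2 by omega) (by simp)
  obtain ⟨g, hg⟩ := h'.exists_smul_eq ⟨x, hx⟩ ⟨y, hy⟩
  exact ⟨g, fun i => congrArg (fun e : Fin k ↪ Fin n => e i) hg⟩

theorem perm_trans {k : ℕ} (x y : Fin k → Fin n)
    (hx : Function.Injective x) (hy : Function.Injective y) :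
    ∃ g : Equiv.Perm (Fin n), ∀ i, g (x i) = y i := by
  obtain ⟨g, hg⟩ := Equiv.Perm.exists_extending_pair x y hx hy
  exact ⟨g, fun i => hg i⟩

end Helpers

section PartB
variable {n : ℕ}

/-- Symmetric (e = 1) or antisymmetric (e = -1) functions on pairs, zero on the diagonal. -/
def symX (n : ℕ) (e : ℂ) : Submodule ℂ (Fin n × Fin n → ℂ) where
  carrier := {f | (∀ i, f (i, i) = 0) ∧ ∀ i j, f (i, j) = e * f (j, i)}
  add_mem' := by
    rintro f g ⟨h1, h2⟩ ⟨h3, h4⟩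
    refine ⟨fun i => by simp [h1, h3], fun i j => ?_⟩
    simp only [Pi.add_apply]; rw [h2, h4]; ring
  zero_mem' := by simp
  smul_mem' := by
    rintro c f ⟨h1, h2⟩
    refine ⟨fun i => by simp [h1], fun i j => ?_⟩
    simp only [Pi.smul_apply, smul_eq_mul]; rw [h2]; ring

/-- Row sums. -/
def rowSum (n : ℕ) : (Fin n × Fin n → ℂ) →ₗ[ℂ] (Fin n → ℂ) where
  toFun f i := ∑ j, f (i, j)
  map_add' f g := by ext i; simp [Finset.sum_add_distrib]
  map_smul' c f := by ext i; simp [Finset.mul_sum]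

/-- The module of type (n-2,2) or (n-2,1,1). -/
def WB (n : ℕ) (e : ℂ) : Submodule ℂ (Fin n × Fin n → ℂ) := symX n e ⊓ LinearMap.ker (rowSum n)

theorem mem_WB (e : ℂ) (f : Fin n × Fin n → ℂ) : f ∈ WB n e ↔
    ((∀ i, f (i, i) = 0) ∧ ∀ i j, f (i, j) = e * f (j, i)) ∧ ∀ i, ∑ j, f (i, j) = 0 := by
  simp only [WB, Submodule.mem_inf, LinearMap.mem_ker, funext_iff]
  rfl

theorem sum_offdiag (n : ℕ) (t : ℂ) :
    ∑ i : Fin n × Fin n, (if i.1 = i.2 then 0 else t) = n * (n - 1) * t := by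
  rw [Fintype.sum_prod_type]
  have : ∀ i : Fin n, ∑ j, (if i = j then (0 : ℂ) else t) = (n - 1) * t := by
    intro i
    rw [split1 _ i, Finset.sum_congr rfl (g := fun _ => t)]
    · simp only [Finset.sum_const, nsmul_eq_mul, card1]; simp
    · intro j hj
      rw [if_neg]; simp at hj; exact fun h => hj h.symm
  simp only [this]
  simp; ring

theorem finrank_symX (n : ℕ) (e : ℂ) (he : e * e = 1) :
    (Module.finrank ℂ (symX n e) : ℂ) = n * (n - 1) / 2 := by
  let P : (Fin n × Fin n → ℂ) →ₗ[ℂ] (Fin n × Fin n → ℂ) :=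
    { toFun := fun f p => if p.1 = p.2 then 0 else (f (p.1, p.2) + e * f (p.2, p.1)) / 2
      map_add' := fun f g => by
        ext p; simp only [Pi.add_apply]; split_ifs <;> ring
      map_smul' := fun c f => by
        ext p; simp only [Pi.smul_apply, smul_eq_mul, RingHom.id_apply]; split_ifs <;> ring }
  rw [finrank_of_proj (symX n e) P]
  · have h := sum_offdiag n (1 / 2)
    rw [show (n : ℂ) * (n - 1) / 2 = n * (n - 1) * (1 / 2) by ring, ← h]
    refine Finset.sum_congr rfl fun i _ => ?_
    obtain ⟨a, b⟩ := i
    by_cases h : a = b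
    · simp [P, h]
    · have h' : b ≠ a := Ne.symm h
      simp [P, h, Pi.single_apply, h']
  · intro f
    refine ⟨fun i => by simp [P], fun i j => ?_⟩
    by_cases h : i = j
    · simp [P, h]
    · simp only [P, LinearMap.coe_mk, AddHom.coe_mk, if_neg h, if_neg (Ne.symm h)]
      linear_combination (- f (i, j) / 2) * he
  · rintro f ⟨h1, h2⟩
    ext ⟨i, j⟩
    by_cases h : i = j
    · simp [P, h, h1]
    · simp only [P, LinearMap.coe_mk, AddHom.coe_mk, if_neg h]
      rw [← h2]; ring

end PartB

section PartB2
variable {n : ℕ}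

theorem finrank_inf_ker {V V' : Type} [AddCommGroup V] [Module ℂ V] [AddCommGroup V']
    [Module ℂ V'] [FiniteDimensional ℂ V] (p : Submodule ℂ V) (g : V →ₗ[ℂ] V') :
    Module.finrank ℂ (p.map g) + Module.finrank ℂ (p ⊓ LinearMap.ker g : Submodule ℂ V) =
      Module.finrank ℂ p := by
  have h := LinearMap.finrank_range_add_finrank_ker (g.domRestrict p)
  rw [LinearMap.range_domRestrict] at h
  rw [← h]
  congr 1
  have : (LinearMap.ker (g.domRestrict p)).map p.subtype = p ⊓ LinearMap.ker g := by
    ext x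
    simp [Submodule.mem_map, LinearMap.mem_ker, and_comm]
  rw [← this, Submodule.finrank_map_subtype_eq]

theorem inj2 {a b : Fin n} (h : a ≠ b) : Function.Injective ![a, b] := by
  intro i j hij
  fin_cases i <;> fin_cases j <;> simp_all [Ne.symm h]

theorem inj3 {a b c : Fin n} (h : a ≠ b) (h2 : a ≠ c) (h3 : b ≠ c) :
    Function.Injective ![a, b, c] := by
  have := h.symm
  have := h2.symm
  have := h3.symm
  intro i j hij
  fin_cases i <;> fin_cases j <;> simp_all

theorem inj4 {a b c d : Fin n} (h : a ≠ b) (h2 : a ≠ c) (h3 : b ≠ c)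
    (h4 : a ≠ d) (h5 : b ≠ d) (h6 : c ≠ d) : Function.Injective ![a, b, c, d] := by
  have := h.symm
  have := h2.symm
  have := h3.symm
  have := h4.symm
  have := h5.symm
  have := h6.symm
  intro i j hij
  fin_cases i <;> fin_cases j <;> simp_all

theorem inj5 {a b c d e : Fin n} (h : a ≠ b) (h2 : a ≠ c) (h3 : b ≠ c)
    (h4 : a ≠ d) (h5 : b ≠ d) (h6 : c ≠ d) (h7 : a ≠ e) (h8 : b ≠ e) (h9 : c ≠ e)
    (h10 : d ≠ e) : Function.Injective ![a, b, c, d, e] := by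
  have := h.symm
  have := h2.symm
  have := h3.symm
  have := h4.symm
  have := h5.symm
  have := h6.symm
  have := h7.symm
  have := h8.symm
  have := h9.symm
  have := h10.symm
  intro i j hij
  fin_cases i <;> fin_cases j <;> simp_all

theorem WB_stab (G : Type) [Group G] [MulAction G (Fin n)] (e : ℂ) :
    Stab (fnRep G (Fin n × Fin n)) (WB n e) := by
  intro g f hf
  rw [mem_WB] at *
  obtain ⟨⟨h1, h2⟩, h3⟩ := hf
  refine ⟨⟨fun i => h1 _, fun i j => h2 _ _⟩, fun i => ?_⟩
  rw [← h3 (g⁻¹ • i)]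
  exact Fintype.sum_equiv (MulAction.toPerm g⁻¹) _ _ fun i => rfl

theorem finrank_WB_one (hn : 3 ≤ n) :
    (Module.finrank ℂ (WB n 1) : ℂ) = n * (n - 3) / 2 := by
  have h := finrank_inf_ker (symX n 1) (rowSum n)
  have h2 := finrank_symX n 1 (by norm_num)
  have hn1 : (n : ℂ) - 1 ≠ 0 := by exact_mod_cast cast_ne (show n ≠ 1 by omega)
  have hn2 : (n : ℂ) - 2 ≠ 0 := by exact_mod_cast cast_ne (show n ≠ 2 by omega)
  have h3 : (symX n 1).map (rowSum n) = ⊤ := by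
    rw [Submodule.eq_top_iff']
    intro r
    obtain ⟨T, hT⟩ : ∃ T, T = ∑ i, r i := ⟨_, rfl⟩
    refine ⟨fun p => if p.1 = p.2 then 0 else
      (r p.1 + r p.2) / (n - 2) - T / ((n - 1) * (n - 2)), ⟨by simp, ?_⟩, ?_⟩
    · intro i j
      by_cases h : i = j
      · simp [h]
      · simp only [if_neg h, if_neg (Ne.symm h)]; ring
    · ext i
      simp only [rowSum, LinearMap.coe_mk, AddHom.coe_mk]
      rw [split1 _ i, Finset.sum_congr rfl (g := fun j => (r i + r j) / (n - 2) - T / ((n - 1) * (n - 2)))]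
      · rw [Finset.sum_sub_distrib, ← Finset.sum_div, Finset.sum_add_distrib]
        simp only [Finset.sum_const, nsmul_eq_mul, card1]
        have := split1 r i
        rw [hT, this]
        simp
        field_simp
        ring
      · intro j hj
        rw [if_neg]; simp at hj; exact fun h => hj h.symm
  rw [h3, finrank_top, Module.finrank_fin_fun] at h
  have h4 : ((n + Module.finrank ℂ (WB n 1) : ℕ) : ℂ) = n * (n - 1) / 2 := by
    rw [← h2, ← h]; rfl
  push_cast at h4
  linear_combination h4

theorem finrank_WB_neg (hn : 3 ≤ n) :
    (Module.finrank ℂ (WB n (-1)) : ℂ) = (n - 1) * (n - 2) / 2 := by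
  have h := finrank_inf_ker (symX n (-1)) (rowSum n)
  have h2 := finrank_symX n (-1) (by norm_num)
  have hn0 : (n : ℂ) ≠ 0 := by exact_mod_cast (show n ≠ 0 by omega)
  have h3 : (symX n (-1)).map (rowSum n) = sumZero (Fin n) := by
    ext r
    rw [mem_sumZero]
    constructor
    · rintro ⟨f, ⟨hf1, hf2⟩, rfl⟩
      simp only [rowSum, LinearMap.coe_mk, AddHom.coe_mk]
      have : ∑ i, ∑ j, f (i, j) = - ∑ i, ∑ j, f (i, j) := by
        conv_lhs => rw [Finset.sum_comm]
        simp only [← Finset.sum_neg_distrib]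
        refine Finset.sum_congr rfl fun i _ => Finset.sum_congr rfl fun j _ => ?_
        rw [hf2]; ring
      linear_combination this / 2
    · intro hr
      refine ⟨fun p => (r p.1 - r p.2) / n, ⟨by simp, fun i j => by ring⟩, ?_⟩
      ext i
      simp only [rowSum, LinearMap.coe_mk, AddHom.coe_mk]
      rw [← Finset.sum_div, Finset.sum_sub_distrib, hr]
      simp
      field_simp
  have : Nonempty (Fin n) := ⟨⟨0, by omega⟩⟩
  have h5 := finrank_sumZero (Fin n)
  rw [Fintype.card_fin] at h5
  rw [h3] at h
  have h4 : ((Module.finrank ℂ (sumZero (Fin n)) + Module.finrank ℂ (WB n (-1)) : ℕ) : ℂ) = n * (n - 1) / 2 := by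
    rw [← h2, ← h]; rfl
  have h6 : ((Module.finrank ℂ (sumZero (Fin n)) + 1 : ℕ) : ℂ) = n := by rw [h5]
  push_cast at h4 h6
  linear_combination h4 - h6

theorem WB_one_irr (hn : 6 ≤ n) :
    Irr (fnRep (alternatingGroup (Fin n)) (Fin n × Fin n)) (WB n 1) := by
  have hn2 : (n : ℂ) - 2 ≠ 0 := by exact_mod_cast cast_ne (show n ≠ 2 by omega)
  have hn3 : (n : ℂ) - 3 ≠ 0 := by exact_mod_cast cast_ne (show n ≠ 3 by omega)
  have hn0 : (n : ℂ) ≠ 0 := by exact_mod_cast (show n ≠ 0 by omega)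
  let a : Fin n := ⟨0, by omega⟩
  let b : Fin n := ⟨1, by omega⟩
  have hab : a ≠ b := by simp [a, b]
  refine irr_crit_stab _ (WB_stab _ 1) ?_ (a, b) ?_ ?_
  · intro h
    have := finrank_WB_one (show 3 ≤ n by omega)
    rw [h, finrank_bot] at this
    have h2 : (n : ℂ) * (n - 3) / 2 ≠ 0 :=
      div_ne_zero (mul_ne_zero hn0 hn3) two_ne_zero
    exact h2 (by rw [← this]; simp)
  · intro F hF hinv h0
    rw [mem_WB] at hF
    obtain ⟨⟨h1, h2⟩, h3⟩ := hF
    simp only [one_mul] at h2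
    have key : ∀ u : Fin n, (u = a ∨ u = b) → ∀ x, x ≠ a → x ≠ b → F (u, x) = 0 := by
      intro u hu x hxa hxb
      have hc : ∀ y ∈ ({a, b} : Finset (Fin n))ᶜ, F (u, y) = F (u, x) := by
        intro y hy
        simp at hy
        obtain ⟨g, hg⟩ := alt_trans (k := 3) (by omega) ![a, b, x] ![a, b, y]
          (inj3 hab hxa.symm hxb.symm) (inj3 hab (Ne.symm hy.1) (Ne.symm hy.2))
        have e0 := hg 0
        have e1 := hg 1
        have e2 := hg 2
        simp at e0 e1 e2
        have := hinv g (by simp [Prod.smul_mk, e0, e1]) (u, x)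
        rw [← this, Prod.smul_mk, e2]
        rcases hu with rfl | rfl
        · rw [e0]
        · rw [e1]
      have := h3 u
      rw [split2 _ hab, Finset.sum_congr rfl hc] at this
      simp only [Finset.sum_const, nsmul_eq_mul, card2 hab] at this
      have hz : F (u, a) = 0 ∧ F (u, b) = 0 := by
        rcases hu with rfl | rfl
        · exact ⟨h1 _, h0⟩
        · exact ⟨by rw [h2]; exact h0, h1 _⟩
      rw [hz.1, hz.2] at this
      simpa [hn2] using this
    have key2 : ∀ x y, x ≠ y → x ≠ a → x ≠ b → y ≠ a → y ≠ b → F (x, y) = 0 := by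
      intro x y hxy hxa hxb hya hyb
      have hc : ∀ z ∈ ({a, b, x} : Finset (Fin n))ᶜ, F (x, z) = F (x, y) := by
        intro z hz
        simp at hz
        obtain ⟨g, hg⟩ := alt_trans (k := 4) (by omega) ![a, b, x, y] ![a, b, x, z]
          (inj4 hab hxa.symm hxb.symm hya.symm hyb.symm hxy)
          (inj4 hab hxa.symm hxb.symm (Ne.symm hz.1) (Ne.symm hz.2.1) (Ne.symm hz.2.2))
        have e0 := hg 0
        have e1 := hg 1
        have e2 := hg 2
        have e3 := hg 3
        simp at e0 e1 e2 e3
        have := hinv g (by simp [Prod.smul_mk, e0, e1]) (x, y)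
        rw [← this, Prod.smul_mk, e2, e3]
      have := h3 x
      rw [split3 _ hab hxa.symm hxb.symm, Finset.sum_congr rfl hc] at this
      simp only [Finset.sum_const, nsmul_eq_mul, card3 hab hxa.symm hxb.symm] at this
      rw [h1, h2 x a, h2 x b, key a (Or.inl rfl) x hxa hxb, key b (Or.inr rfl) x hxa hxb] at this
      simpa [hn3] using this
    ext ⟨x, y⟩
    change F (x, y) = 0
    by_cases hxy : x = y
    · rw [hxy, h1]
    by_cases hxa : x = a
    · by_cases hyb : y = b
      · rw [hxa, hyb, h0]
      · exact key x (Or.inl hxa) y (by rw [← hxa]; exact Ne.symm hxy) hyb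
    by_cases hxb : x = b
    · by_cases hya : y = a
      · rw [hxb, hya, h2, h0]
      · exact key x (Or.inr hxb) y hya (by rw [← hxb]; exact Ne.symm hxy)
    by_cases hya : y = a
    · rw [h2]; exact key y (Or.inl hya) x hxa hxb
    by_cases hyb : y = b
    · rw [h2]; exact key y (Or.inr hyb) x hxa hxb
    exact key2 x y hxy hxa hxb hya hyb
  · intro F hF hinv
    rw [mem_WB] at hF
    ext ⟨x, y⟩
    by_cases hxy : x = y
    · rw [hxy, hF.1.1]; rfl
    obtain ⟨g, hg⟩ := alt_trans (k := 2) (by omega) ![a, b] ![x, y] (inj2 hab) (inj2 hxy)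
    have e0 := hg 0
    have e1 := hg 1
    simp at e0 e1
    have := hinv g
    rw [Prod.smul_mk, e0, e1] at this
    exact this

end PartB2

section PartC
variable {n : ℕ}

/-- Antisymmetrizer for the group generated by two braided involutions. -/
noncomputable def kap {G I : Type} [Group G] [MulAction G I] (s t : G) : Module.End ℂ (I → ℂ) :=
  1 - fnRep G I s - fnRep G I t - fnRep G I s * fnRep G I t * fnRep G I s
    + fnRep G I s * fnRep G I t + fnRep G I t * fnRep G I s

theorem kap_s {G I : Type} [Group G] [MulAction G I] (s t : G) (hs : s * s = 1) :
    fnRep G I s * kap s t = - (kap s t : Module.End ℂ (I → ℂ)) := by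
  have hS : fnRep G I s * fnRep G I s = 1 := by rw [← map_mul, hs, map_one]
  simp only [kap, mul_add, mul_sub, mul_one, ← mul_assoc, hS, one_mul]
  abel

theorem kap_t {G I : Type} [Group G] [MulAction G I] (s t : G) (hs : s * s = 1) (ht : t * t = 1)
    (hst : s * t * s = t * s * t) :
    fnRep G I t * kap s t = - (kap s t : Module.End ℂ (I → ℂ)) := by
  have hS : fnRep G I s * fnRep G I s = 1 := by rw [← map_mul, hs, map_one]
  have hT : fnRep G I t * fnRep G I t = 1 := by rw [← map_mul, ht, map_one]
  have hST : fnRep G I t * fnRep G I s * fnRep G I t = fnRep G I s * fnRep G I t * fnRep G I s := by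
    simp only [← map_mul, hst]
  simp only [kap, mul_add, mul_sub, mul_one, ← mul_assoc, hT, one_mul, hST]
  rw [mul_assoc (fnRep G I s * fnRep G I t), hS, mul_one]
  abel

theorem kap_mem {G I : Type} [Group G] [MulAction G I] (s t : G) (U : Submodule ℂ (I → ℂ))
    (hU : Stab (fnRep G I) U) (u : I → ℂ) (hu : u ∈ U) :
    (kap s t : Module.End ℂ (I → ℂ)) u ∈ U := by
  have h : (kap s t : Module.End ℂ (I → ℂ)) u = u - fnRep G I s u - fnRep G I t u
     - fnRep G I s (fnRep G I t (fnRep G I s u))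
    + fnRep G I s (fnRep G I t u) + fnRep G I t (fnRep G I s u) := rfl
  rw [h]
  have hs := hU s
  have ht := hU t
  exact U.add_mem (U.add_mem (U.sub_mem (U.sub_mem (U.sub_mem hu (hs _ hu)) (ht _ hu))
    (hs _ (ht _ (hs _ hu)))) (hs _ (ht _ hu))) (ht _ (hs _ hu))

theorem kap_eval {G I : Type} [Group G] [MulAction G I] (s t : G) (hs : s * s = 1) (ht : t * t = 1)
    (u : I → ℂ) (x : I) :
    (kap s t : Module.End ℂ (I → ℂ)) u x = u x - u (s • x) - u (t • x)
     - u (s • t • s • x) + u (t • s • x) + u (s • t • x) := by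
  have hs' : s⁻¹ = s := inv_eq_of_mul_eq_one_left hs
  have ht' : t⁻¹ = t := inv_eq_of_mul_eq_one_left ht
  have h : (kap s t : Module.End ℂ (I → ℂ)) u x = u x - u (s⁻¹ • x) - u (t⁻¹ • x)
     - u (s⁻¹ • t⁻¹ • s⁻¹ • x) + u (t⁻¹ • s⁻¹ • x) + u (s⁻¹ • t⁻¹ • x) := rfl
  rw [h, hs', ht']

theorem anti_of {G I : Type} [Group G] [MulAction G I] (s : G) (hs : s * s = 1)
    (K : Module.End ℂ (I → ℂ)) (h : fnRep G I s * K = - K) (u : I → ℂ) (x : I) :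
    K u (s • x) = - K u x := by
  have hs' : s⁻¹ = s := inv_eq_of_mul_eq_one_left hs
  have := congrFun (congrArg (fun L : Module.End ℂ (I → ℂ) => L u) h) x
  simp only [Module.End.mul_apply, fnRep_apply, hs'] at this
  simpa using this

theorem swap_braid {a b c : Fin n} (h : a ≠ b) (h2 : a ≠ c) (h3 : b ≠ c) :
    Equiv.swap a b * Equiv.swap a c * Equiv.swap a b =
      Equiv.swap a c * Equiv.swap a b * Equiv.swap a c := by
  have e1 := Equiv.swap_mul_swap_mul_swap h2.symm h3.symm
  have e2 := Equiv.swap_mul_swap_mul_swap h.symm h3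
  rw [Equiv.swap_comm c a] at e1
  rw [Equiv.swap_comm b a] at e2
  rw [e1, e2, Equiv.swap_comm]

theorem anti_fix {I : Type} [MulAction (Equiv.Perm (Fin n)) I] (F : I → ℂ) (a b : Fin n)
    (h : ∀ x, F (Equiv.swap a b • x) = - F x) (x : I) (hx : Equiv.swap a b • x = x) : F x = 0 := by
  have := h x
  rw [hx] at this
  linear_combination this / 2

theorem kap_swaps {I : Type} [MulAction (Equiv.Perm (Fin n)) I] {a b c : Fin n}
    (h : a ≠ b) (h2 : a ≠ c) (h3 : b ≠ c) :
    let K : Module.End ℂ (I → ℂ) := kap (Equiv.swap a b) (Equiv.swap a c)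
    fnRep _ I (Equiv.swap a b) * K = - K ∧ fnRep _ I (Equiv.swap a c) * K = - K ∧
    fnRep _ I (Equiv.swap b c) * K = - K := by
  intro K
  have k1 : fnRep _ I (Equiv.swap a b) * K = - K := kap_s _ _ (Equiv.swap_mul_self _ _)
  have k2 : fnRep _ I (Equiv.swap a c) * K = - K :=
    kap_t _ _ (Equiv.swap_mul_self _ _) (Equiv.swap_mul_self _ _) (swap_braid h h2 h3)
  refine ⟨k1, k2, ?_⟩
  have : Equiv.swap b c = Equiv.swap a b * Equiv.swap a c * Equiv.swap a b := by
    have e1 := Equiv.swap_mul_swap_mul_swap h2.symm h3.symm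
    rw [Equiv.swap_comm c a] at e1
    exact e1.symm
  have hneg : ∀ L : Module.End ℂ (I → ℂ), L * -K = -(L * K) := by
    intro L; ext; simp
  rw [this, map_mul, map_mul, mul_assoc, k1, mul_assoc]
  erw [hneg]
  rw [k2, neg_neg, k1]

theorem WB_neg_irr (hn : 5 ≤ n) :
    Irr (fnRep (Equiv.Perm (Fin n)) (Fin n × Fin n)) (WB n (-1)) := by
  have hn2 : (n : ℂ) - 2 ≠ 0 := by exact_mod_cast cast_ne (show n ≠ 2 by omega)
  have hn1 : (n : ℂ) - 1 ≠ 0 := by exact_mod_cast cast_ne (show n ≠ 1 by omega)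
  have hn0 : (n : ℂ) ≠ 0 := by exact_mod_cast (show n ≠ 0 by omega)
  let a : Fin n := ⟨0, by omega⟩
  let b : Fin n := ⟨1, by omega⟩
  let c : Fin n := ⟨2, by omega⟩
  have hab : a ≠ b := by simp [a, b]
  have hac : a ≠ c := by simp [a, c]
  have hbc : b ≠ c := by simp [b, c]
  clear_value a b c
  refine irr_crit _ (WB_stab _ _) ?_ (kap (Equiv.swap a b) (Equiv.swap a c)) (a, b)
    (kap_mem _ _) ?_ ?_
  · intro h
    have := finrank_WB_neg (show 3 ≤ n by omega)
    rw [h, finrank_bot] at this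
    have h2 : ((n : ℂ) - 1) * (n - 2) / 2 ≠ 0 :=
      div_ne_zero (mul_ne_zero hn1 hn2) two_ne_zero
    exact h2 (by rw [← this]; simp)
  · intro f hf h0
    have hF := kap_mem (Equiv.swap a b) (Equiv.swap a c) _ (WB_stab _ (-1)) f hf
    obtain ⟨k1, k2, k3⟩ := kap_swaps (I := Fin n × Fin n) hab hac hbc
    have A1 := anti_of _ (Equiv.swap_mul_self _ _) _ k1 f
    have A2 := anti_of _ (Equiv.swap_mul_self _ _) _ k2 f
    have A3 := anti_of _ (Equiv.swap_mul_self _ _) _ k3 f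
    generalize (kap (Equiv.swap a b) (Equiv.swap a c) : Module.End ℂ (Fin n × Fin n → ℂ)) f = F at *
    rw [mem_WB] at hF
    obtain ⟨⟨h1, h2⟩, h3⟩ := hF
    have z1 : F (a, c) = 0 := by
      have := A3 (a, b)
      rw [h0, Prod.smul_mk] at this
      simpa [Equiv.swap_apply_of_ne_of_ne hab hac] using this
    have z2 : F (b, c) = 0 := by
      have := A1 (a, c)
      rw [z1, Prod.smul_mk] at this
      simpa [Equiv.swap_apply_of_ne_of_ne hac.symm hbc.symm] using this
    ext ⟨x, y⟩
    change F (x, y) = 0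
    have fx : ∀ u v : Fin n, (∀ x, F (Equiv.swap u v • x) = - F x) → x ≠ u → x ≠ v → y ≠ u → y ≠ v →
        F (x, y) = 0 := by
      intro u v A e1 e2 e3 e4
      refine anti_fix F u v A _ ?_
      simp [Prod.smul_mk, Equiv.swap_apply_of_ne_of_ne, *]
    have r1 := fx a b A1
    have r2 := fx a c A2
    have r3 := fx b c A3
    have s1 := h2 b a
    have s2 := h2 c a
    have s3 := h2 c b
    rw [h0] at s1
    rw [z1] at s2
    rw [z2] at s3
    have t := h1 x
    grind
  · intro f hf hg
    rw [mem_WB] at hf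
    obtain ⟨⟨h1, h2⟩, h3⟩ := hf
    have cyc : ∀ x y z : Fin n, x ≠ y → x ≠ z → y ≠ z → f (x, y) + f (y, z) + f (z, x) = 0 := by
      intro x y z hxy hxz hyz
      obtain ⟨g, hg'⟩ := perm_trans ![x, y, z] ![a, b, c] (inj3 hxy hxz hyz) (inj3 hab hac hbc)
      have e0 := hg' 0
      have e1 := hg' 1
      have e2 := hg' 2
      simp at e0 e1 e2
      have i0 : g⁻¹ a = x := by rw [← e0]; simp
      have i1 : g⁻¹ b = y := by rw [← e1]; simp
      have i2 : g⁻¹ c = z := by rw [← e2]; simp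
      have := hg g
      rw [kap_eval _ _ (Equiv.swap_mul_self _ _) (Equiv.swap_mul_self _ _)] at this
      simp only [fnRep_apply, Prod.smul_mk, Equiv.Perm.smul_def, Equiv.swap_apply_left,
        Equiv.swap_apply_right, Equiv.swap_apply_of_ne_of_ne hab.symm hbc,
        Equiv.swap_apply_of_ne_of_ne hac.symm hbc.symm, i0, i1, i2] at this
      rw [h2 y x, h2 z y, h2 x z] at this
      linear_combination this / 2
    ext ⟨x, y⟩
    change f (x, y) = 0
    by_cases hxy : x = y
    · rw [hxy, h1]
    have e1 := h3 y
    have e2 := h3 x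
    rw [split2 _ hxy] at e1 e2
    have e3 : ∑ z ∈ ({x, y} : Finset (Fin n))ᶜ, (f (x, y) + f (y, z) - f (x, z)) = 0 := by
      refine Finset.sum_eq_zero fun z hz => ?_
      simp at hz
      have := cyc x y z hxy (Ne.symm hz.1) (Ne.symm hz.2)
      rw [h2 z x] at this
      linear_combination this
    rw [Finset.sum_sub_distrib, Finset.sum_add_distrib, Finset.sum_const, nsmul_eq_mul,
      card2 hxy] at e3
    have : (n : ℂ) * f (x, y) = 0 := by
      have := h2 y x
      have := h1 x
      have := h1 y
      grind
    simpa [hn0] using this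

end PartC

section PartD
variable {n : ℕ}

/-- Pairwise distinct. -/
def Dis3 (x : Fin n × Fin n × Fin n) : Prop := x.1 ≠ x.2.1 ∧ x.1 ≠ x.2.2 ∧ x.2.1 ≠ x.2.2

instance (x : Fin n × Fin n × Fin n) : Decidable (Dis3 x) := by unfold Dis3; infer_instance

theorem dis3_iff (i j k : Fin n) : Dis3 (i, j, k) ↔ (i ≠ j ∧ i ≠ k ∧ j ≠ k) := Iff.rfl

/-- Functions of mixed symmetry. -/
def ND (n : ℕ) : Submodule ℂ (Fin n × Fin n × Fin n → ℂ) where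
  carrier := {f | (∀ x, ¬ Dis3 x → f x = 0) ∧ (∀ i j k, f (i, j, k) = f (j, i, k)) ∧
    ∀ i j k, f (i, j, k) + f (j, k, i) + f (k, i, j) = 0}
  add_mem' := by
    rintro f g ⟨h1, h2, h3⟩ ⟨h4, h5, h6⟩
    refine ⟨fun x hx => by simp [h1 x hx, h4 x hx], fun i j k => ?_, fun i j k => ?_⟩
    · simp only [Pi.add_apply]; rw [h2, h5]
    · simp only [Pi.add_apply]
      linear_combination h3 i j k + h6 i j k
  zero_mem' := by simp
  smul_mem' := by
    rintro c f ⟨h1, h2, h3⟩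
    refine ⟨fun x hx => by simp [h1 x hx], fun i j k => ?_, fun i j k => ?_⟩
    · simp only [Pi.smul_apply]; rw [h2]
    · simp only [Pi.smul_apply, smul_eq_mul]
      linear_combination c * h3 i j k

/-- Projection onto `ND`. -/
noncomputable def PD (n : ℕ) : (Fin n × Fin n × Fin n → ℂ) →ₗ[ℂ] (Fin n × Fin n × Fin n → ℂ) where
  toFun f x := if Dis3 x then (f (x.1, x.2.1, x.2.2) + f (x.2.1, x.1, x.2.2)) / 3
    - (f (x.2.1, x.2.2, x.1) + f (x.2.2, x.1, x.2.1) + f (x.2.2, x.2.1, x.1)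
      + f (x.1, x.2.2, x.2.1)) / 6 else 0
  map_add' f g := by
    ext x; simp only [Pi.add_apply]; split_ifs <;> ring
  map_smul' c f := by
    ext x; simp only [Pi.smul_apply, smul_eq_mul, RingHom.id_apply]; split_ifs <;> ring

theorem PD_apply (f : Fin n × Fin n × Fin n → ℂ) (i j k : Fin n) : PD n f (i, j, k) =
    if Dis3 (i, j, k) then (f (i, j, k) + f (j, i, k)) / 3
    - (f (j, k, i) + f (k, i, j) + f (k, j, i) + f (i, k, j)) / 6 else 0 := rfl

theorem PD_mem (f : Fin n × Fin n × Fin n → ℂ) : PD n f ∈ ND n := by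
  refine ⟨fun x hx => if_neg hx, fun i j k => ?_, fun i j k => ?_⟩
  · simp only [PD_apply, dis3_iff]
    by_cases h : i ≠ j ∧ i ≠ k ∧ j ≠ k
    · rw [if_pos h, if_pos (by grind)]; ring
    · rw [if_neg h, if_neg (by grind)]
  · simp only [PD_apply, dis3_iff]
    by_cases h : i ≠ j ∧ i ≠ k ∧ j ≠ k
    · rw [if_pos h, if_pos (by grind), if_pos (by grind)]; ring
    · rw [if_neg h, if_neg (by grind), if_neg (by grind)]; ring

theorem PD_id (f : Fin n × Fin n × Fin n → ℂ) (hf : f ∈ ND n) : PD n f = f := by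
  obtain ⟨h1, h2, h3⟩ := hf
  ext ⟨i, j, k⟩
  rw [PD_apply]
  by_cases h : Dis3 (i, j, k)
  · rw [if_pos h]
    have := h2 i j k
    have := h2 j k i
    have := h2 k i j
    have := h3 i j k
    grind
  · rw [if_neg h, h1 _ h]

theorem sum_dis3 (t : ℂ) (hn : 2 ≤ n) :
    ∑ x : Fin n × Fin n × Fin n, (if Dis3 x then t else 0) = n * (n - 1) * (n - 2) * t := by
  rw [Fintype.sum_prod_type]
  simp only [Fintype.sum_prod_type]
  have h : ∀ i j : Fin n, ∑ k, (if Dis3 (i, j, k) then t else 0) =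
      if i = j then 0 else (n - 2) * t := by
    intro i j
    by_cases h : i = j
    · simp [dis3_iff, h]
    · rw [if_neg h, split2 _ h, Finset.sum_congr rfl (g := fun _ => t)]
      · simp only [Finset.sum_const, nsmul_eq_mul, card2 h]; simp [dis3_iff]
      · intro k hk
        simp at hk
        rw [if_pos]
        exact ⟨h, Ne.symm hk.1, Ne.symm hk.2⟩
  simp only [h]
  have := sum_offdiag n ((n - 2) * t)
  rw [Fintype.sum_prod_type] at this
  rw [this]; ring

theorem finrank_ND (hn : 2 ≤ n) : (Module.finrank ℂ (ND n) : ℂ) = n * (n - 1) * (n - 2) / 3 := by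
  rw [finrank_of_proj (ND n) (PD n) PD_mem PD_id]
  have h := sum_dis3 (n := n) (1 / 3) hn
  rw [show (n : ℂ) * (n - 1) * (n - 2) / 3 = n * (n - 1) * (n - 2) * (1 / 3) by ring, ← h]
  refine Finset.sum_congr rfl fun x _ => ?_
  obtain ⟨i, j, k⟩ := x
  rw [PD_apply]
  by_cases h : Dis3 (i, j, k)
  · rw [if_pos h, if_pos h]
    obtain ⟨h1, h2, h3⟩ := h
    simp only at h1 h2 h3
    have := h1.symm
    have := h2.symm
    have := h3.symm
    simp [Pi.single_apply, *]
  · rw [if_neg h, if_neg h]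

/-- Contraction. -/
def hD (n : ℕ) : (Fin n × Fin n × Fin n → ℂ) →ₗ[ℂ] (Fin n × Fin n → ℂ) where
  toFun f p := ∑ j, f (p.1, j, p.2)
  map_add' f g := by ext i; simp [Finset.sum_add_distrib]
  map_smul' c f := by ext i; simp [Finset.mul_sum]

/-- The module of type (n-3,2,1). -/
def WD (n : ℕ) : Submodule ℂ (Fin n × Fin n × Fin n → ℂ) := ND n ⊓ LinearMap.ker (hD n)

theorem mem_WD (f : Fin n × Fin n × Fin n → ℂ) : f ∈ WD n ↔
    ((∀ x, ¬ Dis3 x → f x = 0) ∧ (∀ i j k, f (i, j, k) = f (j, i, k)) ∧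
    ∀ i j k, f (i, j, k) + f (j, k, i) + f (k, i, j) = 0) ∧ ∀ i k, ∑ j, f (i, j, k) = 0 := by
  refine ⟨fun h => ⟨h.1, fun i k => congrFun (LinearMap.mem_ker.1 h.2) (i, k)⟩,
    fun h => ⟨h.1, LinearMap.mem_ker.2 ?_⟩⟩
  ext ⟨i, k⟩
  exact h.2 i k

theorem PD_adj (f e : Fin n × Fin n × Fin n → ℂ) :
    ∑ x, PD n f x * e x = ∑ x, f x * PD n e x := by
  have h1 : ∀ (σ τ : Fin n × Fin n × Fin n → Fin n × Fin n × Fin n) (_ : ∀ x, σ (τ x) = x)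
      (_ : ∀ x, τ (σ x) = x) (_ : ∀ x, Dis3 (τ x) ↔ Dis3 x),
      ∑ x, (if Dis3 x then f (σ x) * e x else 0) = ∑ x, (if Dis3 x then f x * e (τ x) else 0) := by
    intro σ τ h1 h2 h3
    refine Fintype.sum_equiv ⟨σ, τ, h2, h1⟩ _ _ fun x => ?_
    have h4 : Dis3 (σ x) ↔ Dis3 x := by rw [← h3, h2]
    simp only [Equiv.coe_fn_mk, h4, h2]
  have a1 := h1 id id (fun _ => rfl) (fun _ => rfl) (fun _ => Iff.rfl)
  have a2 := h1 (fun x => (x.2.1, x.1, x.2.2)) (fun x => (x.2.1, x.1, x.2.2)) (fun _ => rfl)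
    (fun _ => rfl) (fun x => by simp only [Dis3]; grind)
  have a3 := h1 (fun x => (x.2.1, x.2.2, x.1)) (fun x => (x.2.2, x.1, x.2.1)) (fun _ => rfl)
    (fun _ => rfl) (fun x => by simp only [Dis3]; grind)
  have a4 := h1 (fun x => (x.2.2, x.1, x.2.1)) (fun x => (x.2.1, x.2.2, x.1)) (fun _ => rfl)
    (fun _ => rfl) (fun x => by simp only [Dis3]; grind)
  have a5 := h1 (fun x => (x.2.2, x.2.1, x.1)) (fun x => (x.2.2, x.2.1, x.1)) (fun _ => rfl)
    (fun _ => rfl) (fun x => by simp only [Dis3]; grind)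
  have a6 := h1 (fun x => (x.1, x.2.2, x.2.1)) (fun x => (x.1, x.2.2, x.2.1)) (fun _ => rfl)
    (fun _ => rfl) (fun x => by simp only [Dis3]; grind)
  have e1 : ∀ x, PD n f x * e x = (if Dis3 x then f (id x) * e x else 0) / 3
      + (if Dis3 x then f (x.2.1, x.1, x.2.2) * e x else 0) / 3
      - (if Dis3 x then f (x.2.1, x.2.2, x.1) * e x else 0) / 6
      - (if Dis3 x then f (x.2.2, x.1, x.2.1) * e x else 0) / 6
      - (if Dis3 x then f (x.2.2, x.2.1, x.1) * e x else 0) / 6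
      - (if Dis3 x then f (x.1, x.2.2, x.2.1) * e x else 0) / 6 := by
    rintro ⟨i, j, k⟩
    rw [PD_apply]
    by_cases h : Dis3 (i, j, k)
    · simp only [if_pos h, id]; ring
    · simp only [if_neg h]; ring
  have e2 : ∀ x, f x * PD n e x = (if Dis3 x then f x * e (id x) else 0) / 3
      + (if Dis3 x then f x * e (x.2.1, x.1, x.2.2) else 0) / 3
      - (if Dis3 x then f x * e (x.2.2, x.1, x.2.1) else 0) / 6
      - (if Dis3 x then f x * e (x.2.1, x.2.2, x.1) else 0) / 6
      - (if Dis3 x then f x * e (x.2.2, x.2.1, x.1) else 0) / 6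
      - (if Dis3 x then f x * e (x.1, x.2.2, x.2.1) else 0) / 6 := by
    rintro ⟨i, j, k⟩
    rw [PD_apply]
    by_cases h : Dis3 (i, j, k)
    · simp only [if_pos h, id]; ring
    · simp only [if_neg h]; ring
  rw [Finset.sum_congr rfl fun x _ => e1 x, Finset.sum_congr rfl fun x _ => e2 x]
  simp only [Finset.sum_sub_distrib, Finset.sum_add_distrib, ← Finset.sum_div]
  rw [a1, a2, a3, a4, a5, a6]

/-- Parametrization of the annihilator. -/
def phiD (n : ℕ) : ((Fin n → ℂ) × (Fin n → ℂ)) →ₗ[ℂ] (Fin n × Fin n → ℂ) where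
  toFun q p := if p.1 = p.2 then q.2 p.1 else 2 * q.1 p.1 + q.1 p.2
  map_add' f g := by
    ext p; simp only [Pi.add_apply, Prod.fst_add, Prod.snd_add]; split_ifs <;> ring
  map_smul' c f := by
    ext p
    simp only [Pi.smul_apply, smul_eq_mul, RingHom.id_apply, Prod.smul_fst, Prod.smul_snd]
    split_ifs <;> ring

theorem finrank_range_phiD (hn : 2 ≤ n) : Module.finrank ℂ (LinearMap.range (phiD n)) = 2 * n := by
  rw [LinearMap.finrank_range_of_inj]
  · simp; ring
  · rw [injective_iff_map_eq_zero]
    rintro ⟨y, z⟩ h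
    have h' : ∀ i j, phiD n (y, z) (i, j) = 0 := fun i j => by rw [h]; rfl
    simp only [phiD, LinearMap.coe_mk, AddHom.coe_mk] at h'
    ext i
    · have : Nontrivial (Fin n) := Fin.nontrivial_iff_two_le.2 hn
      obtain ⟨j, hj⟩ := exists_ne i
      have e1 := h' i j
      have e2 := h' j i
      rw [if_neg hj.symm] at e1
      rw [if_neg hj] at e2
      change y i = 0
      linear_combination (2 * e1 - e2) / 3
    · have := h' i i
      simpa using this

theorem ann_four (c : Fin n × Fin n → ℂ)
    (h : ∀ a b d, a ≠ b → a ≠ d → b ≠ d →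
      2 * (c (a, d) + c (b, d)) = c (b, a) + c (d, a) + c (d, b) + c (a, b))
    (hn : 5 ≤ n) (a b d : Fin n) (hab : a ≠ b) (had : a ≠ d) (hbd : b ≠ d) :
    2 * c (a, b) - c (b, a) = 2 * c (a, d) - c (d, a) := by
  obtain ⟨e, he⟩ : ∃ e, e ∉ ({a, b, d} : Finset (Fin n)) := by
    by_contra! hcon
    have := Finset.card_le_card (Finset.subset_iff.2 fun x (_ : x ∈ Finset.univ) => hcon x)
    have h3 := Finset.card_le_three (a := a) (b := b) (c := d)
    simp at this
    omega
  simp at he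
  obtain ⟨h1, h2, h3⟩ := he
  have e1 := h a b d hab had hbd
  have e2 := h a d b had hab hbd.symm
  have e3 := h b d a hbd hab.symm had.symm
  have e4 := h a b e hab (Ne.symm h1) (Ne.symm h2)
  have e5 := h a e b (Ne.symm h1) hab h2
  have e6 := h b e a (Ne.symm h2) hab.symm h1
  have e7 := h a d e had (Ne.symm h1) (Ne.symm h3)
  have e8 := h a e d (Ne.symm h1) had h3
  have e9 := h d e a (Ne.symm h3) had.symm h1
  have e10 := h b d e hbd (Ne.symm h2) (Ne.symm h3)
  have e11 := h b e d (Ne.symm h2) hbd h3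
  have e12 := h d e b (Ne.symm h3) hbd.symm h2
  clear h
  grind

theorem ann_iff (hn : 5 ≤ n) (c : Fin n × Fin n → ℂ) : c ∈ LinearMap.range (phiD n) ↔
    ∀ x, ∑ p, (hD n ∘ₗ PD n) (Pi.single x 1) p * c p = 0 := by
  have h0 : ∀ x, ∑ p, (hD n ∘ₗ PD n) (Pi.single x 1) p * c p = PD n (fun x => c (x.1, x.2.2)) x := by
    intro x
    have h1 : ∑ p, (hD n ∘ₗ PD n) (Pi.single x 1) p * c p =
        ∑ y, PD n (Pi.single x 1) y * (fun x => c (x.1, x.2.2)) y := by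
      rw [Fintype.sum_prod_type]
      simp only [Fintype.sum_prod_type, hD, LinearMap.comp_apply, LinearMap.coe_mk, AddHom.coe_mk,
        Finset.sum_mul]
      refine Finset.sum_congr rfl fun i _ => ?_
      rw [Finset.sum_comm]
    rw [h1, PD_adj]
    simp [Pi.single_apply]
  simp only [h0, Prod.forall, PD_apply]
  constructor
  · rintro ⟨⟨y, z⟩, rfl⟩ i j k
    split_ifs with h
    · obtain ⟨h1, h2, h3⟩ := h
      simp only at h1 h2 h3
      simp only [phiD, LinearMap.coe_mk, AddHom.coe_mk, if_neg h1, if_neg h2, if_neg h3,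
        if_neg h1.symm, if_neg h2.symm, if_neg h3.symm]
      ring
    · rfl
  · intro h
    have h1 : ∀ a b d, a ≠ b → a ≠ d → b ≠ d →
      2 * (c (a, d) + c (b, d)) = c (b, a) + c (d, a) + c (d, b) + c (a, b) := by
      intro a b d h1 h2 h3
      have := h a b d
      rw [if_pos ⟨h1, h2, h3⟩] at this
      linear_combination 6 * this
    have h2 := ann_four c h1 hn
    have : Nontrivial (Fin n) := Fin.nontrivial_iff_two_le.2 (by omega)
    choose m hm using fun i : Fin n => exists_ne i
    have h3 : ∀ i j, i ≠ j → 2 * c (i, m i) - c (m i, i) = 2 * c (i, j) - c (j, i) := by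
      intro i j hij
      by_cases hj : m i = j
      · rw [hj]
      · exact h2 i (m i) j (hm i).symm hij hj
    refine ⟨(fun i => (2 * c (i, m i) - c (m i, i)) / 3, fun i => c (i, i)), ?_⟩
    ext ⟨i, k⟩
    simp only [phiD, LinearMap.coe_mk, AddHom.coe_mk]
    split_ifs with hik
    · rw [hik]
    · rw [h3 i k hik, h3 k i (Ne.symm hik)]; ring

theorem finrank_WD (hn : 5 ≤ n) : (Module.finrank ℂ (WD n) : ℂ) = n * (n - 2) * (n - 4) / 3 := by
  have h := finrank_inf_ker (ND n) (hD n)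
  have h1 := finrank_range_ann (hD n ∘ₗ PD n) (LinearMap.range (phiD n)) (ann_iff hn)
  rw [finrank_range_phiD (by omega)] at h1
  have h2 : LinearMap.range (hD n ∘ₗ PD n) = (ND n).map (hD n) := by
    rw [LinearMap.range_comp]
    congr 1
    ext f
    exact ⟨by rintro ⟨g, rfl⟩; exact PD_mem g, fun hf => ⟨f, PD_id f hf⟩⟩
  rw [h2] at h1
  have h3 := finrank_ND (show 2 ≤ n by omega)
  simp only [Fintype.card_prod, Fintype.card_fin] at h1
  rw [← h] at h3
  have h4 : ((Module.finrank ℂ ((ND n).map (hD n)) + 2 * n : ℕ) : ℂ) = (n * n : ℕ) := by rw [h1]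
  push_cast at h3 h4
  change _ + (Module.finrank ℂ (WD n) : ℂ) = _ at h3
  linear_combination h3 - h4

end PartD

section PartD2
variable {n : ℕ}

theorem WD_stab (G : Type) [Group G] [MulAction G (Fin n)] :
    Stab (fnRep G (Fin n × Fin n × Fin n)) (WD n) := by
  intro g f hf
  rw [mem_WD] at *
  obtain ⟨⟨h1, h2, h3⟩, h4⟩ := hf
  refine ⟨⟨fun x hx => ?_, fun i j k => h2 _ _ _, fun i j k => h3 _ _ _⟩, fun i k => ?_⟩
  · rw [fnRep_apply]
    apply h1
    obtain ⟨i, j, k⟩ := x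
    intro h
    apply hx
    obtain ⟨e1, e2, e3⟩ := h
    exact ⟨fun h => e1 (congrArg (g⁻¹ • ·) h), fun h => e2 (congrArg (g⁻¹ • ·) h),
      fun h => e3 (congrArg (g⁻¹ • ·) h)⟩
  · rw [← h4 (g⁻¹ • i) (g⁻¹ • k)]
    exact Fintype.sum_equiv (MulAction.toPerm g⁻¹) _ _ fun i => rfl

theorem WD_zero (hn : 5 ≤ n) (f : Fin n × Fin n × Fin n → ℂ) (hf : f ∈ WD n)
    (hL : ∀ a b c d e : Fin n, a ≠ b → a ≠ c → b ≠ c → a ≠ d → b ≠ d → c ≠ d →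
      a ≠ e → b ≠ e → c ≠ e → d ≠ e →
      (f (a, d, b) - f (b, d, a)) + (f (b, d, c) - f (c, d, b)) + (f (c, d, a) - f (a, d, c)) =
      (f (a, e, b) - f (b, e, a)) + (f (b, e, c) - f (c, e, b)) + (f (c, e, a) - f (a, e, c))) :
    f = 0 := by
  have hn1 : (n : ℂ) - 1 ≠ 0 := by exact_mod_cast cast_ne (show n ≠ 1 by omega)
  have hn3 : (n : ℂ) - 3 ≠ 0 := by exact_mod_cast cast_ne (show n ≠ 3 by omega)
  rw [mem_WD] at hf
  obtain ⟨⟨h1, h2, h3⟩, h4⟩ := hf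
  have z12 : ∀ i k, f (i, i, k) = 0 := fun i k => h1 _ (fun h => h.1 rfl)
  have z13 : ∀ i k, f (i, k, i) = 0 := fun i k => h1 _ (fun h => h.2.1 rfl)
  have z23 : ∀ i k, f (k, i, i) = 0 := fun i k => h1 _ (fun h => h.2.2 rfl)
  have h5 : ∀ i k, ∑ j, f (j, i, k) = 0 := by
    intro i k; rw [← h4 i k]; exact Finset.sum_congr rfl fun j _ => h2 _ _ _
  have h6 : ∀ i k, ∑ j, f (i, k, j) = 0 := by
    intro i k
    have : ∑ j, (f (i, k, j) + f (k, j, i) + f (j, i, k)) = 0 :=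
      Finset.sum_eq_zero fun j _ => h3 i k j
    rw [Finset.sum_add_distrib, Finset.sum_add_distrib, h4, h5] at this
    simpa using this
  have hQ : ∀ a b c d : Fin n, a ≠ b → a ≠ c → b ≠ c → a ≠ d → b ≠ d → c ≠ d →
      (f (a, d, b) - f (b, d, a)) + (f (b, d, c) - f (c, d, b)) + (f (c, d, a) - f (a, d, c)) = 0 := by
    intro a b c d hab hac hbc had hbd hcd
    have e1 : ∑ e, ((f (a, e, b) - f (b, e, a)) + (f (b, e, c) - f (c, e, b)) +
        (f (c, e, a) - f (a, e, c))) = 0 := by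
      simp only [Finset.sum_add_distrib, Finset.sum_sub_distrib, h4]; simp
    rw [split4 _ hab hac hbc had hbd hcd, Finset.sum_congr rfl (g := fun _ =>
      (f (a, d, b) - f (b, d, a)) + (f (b, d, c) - f (c, d, b)) + (f (c, d, a) - f (a, d, c)))] at e1
    · rw [Finset.sum_const, nsmul_eq_mul, card4 hab hac hbc had hbd hcd] at e1
      simp only [z12, z23] at e1
      rw [h2 b a c, h2 c a b, h2 c b a] at e1
      have e2 : ((n : ℂ) - 3) * ((f (a, d, b) - f (b, d, a)) + (f (b, d, c) - f (c, d, b)) + (f (c, d, a) - f (a, d, c))) = 0 := by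
        linear_combination e1
      simpa [hn3] using e2
    · intro e he
      simp at he
      exact (hL a b c d e hab hac hbc had hbd hcd (Ne.symm he.1) (Ne.symm he.2.1)
        (Ne.symm he.2.2.1) (Ne.symm he.2.2.2)).symm
  have hq : ∀ a b d : Fin n, a ≠ b → a ≠ d → b ≠ d → f (a, d, b) = f (b, d, a) := by
    intro a b d hab had hbd
    have e1 : ∑ c ∈ ({a, b, d} : Finset (Fin n))ᶜ, ((f (a, d, b) - f (b, d, a)) +
      (f (b, d, c) - f (c, d, b)) + (f (c, d, a) - f (a, d, c))) = 0 := by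
      refine Finset.sum_eq_zero fun c hc => ?_
      simp at hc
      exact hQ a b c d hab (Ne.symm hc.1) (Ne.symm hc.2.1) had hbd hc.2.2
    simp only [Finset.sum_add_distrib, Finset.sum_sub_distrib, Finset.sum_const, nsmul_eq_mul,
      card3 hab had hbd] at e1
    have s1 := h6 b d
    have s2 := h5 d b
    have s3 := h5 d a
    have s4 := h6 a d
    rw [split3 _ hab had hbd] at s1 s2 s3 s4
    simp only [z12, z23, z13] at s1 s2 s3 s4
    have e2 : ((n : ℂ) - 1) * (f (a, d, b) - f (b, d, a)) = 0 := by
      linear_combination e1 - s1 + s2 - s3 + s4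
    have e3 : f (a, d, b) - f (b, d, a) = 0 := by simpa [hn1] using e2
    linear_combination e3
  ext ⟨i, j, k⟩
  change f (i, j, k) = 0
  by_cases h : Dis3 (i, j, k)
  · obtain ⟨d1, d2, d3⟩ := h
    simp only at d1 d2 d3
    have := h3 i j k
    have q1 := hq i k j d2 d1 d3.symm
    have q2 := hq j k i d3 d1.symm d2.symm
    have q3 := h2 i j k
    have q4 := h2 k i j
    have q5 := h2 j k i
    grind
  · exact h1 _ h

theorem pair3 {X : Type} (y z a b c : X) (hab : a ≠ b) (hac : a ≠ c) (hbc : b ≠ c) (d3 : y ≠ z)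
    (c1 : y = a ∨ y = b ∨ z = a ∨ z = b) (c2 : y = a ∨ y = c ∨ z = a ∨ z = c)
    (c3 : y = b ∨ y = c ∨ z = b ∨ z = c) :
    (y = a ∧ z = b) ∨ (y = a ∧ z = c) ∨ (y = b ∧ z = a) ∨ (y = b ∧ z = c) ∨ (y = c ∧ z = a) ∨
    (y = c ∧ z = b) := by
  grind

theorem comb5 {X : Type} (x y z a b c d e : X) (hab : a ≠ b) (hac : a ≠ c) (hbc : b ≠ c)
    (had : a ≠ d) (hbd : b ≠ d) (hcd : c ≠ d) (hae : a ≠ e) (hbe : b ≠ e) (hce : c ≠ e)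
    (hde : d ≠ e) (d1 : x ≠ y) (d2 : x ≠ z) (d3 : y ≠ z)
    (w1 : ¬ ((x = a ∧ y = b ∧ z = d) ∨ (x = a ∧ y = d ∧ z = b) ∨
        (x = b ∧ y = a ∧ z = d) ∨ (x = b ∧ y = d ∧ z = a) ∨ (x = d ∧ y = a ∧ z = b) ∨
        (x = d ∧ y = b ∧ z = a)))
    (w2 : ¬ ((x = a ∧ y = c ∧ z = d) ∨ (x = a ∧ y = d ∧ z = c) ∨
        (x = c ∧ y = a ∧ z = d) ∨ (x = c ∧ y = d ∧ z = a) ∨ (x = d ∧ y = a ∧ z = c) ∨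
        (x = d ∧ y = c ∧ z = a)))
    (w3 : ¬ ((x = b ∧ y = c ∧ z = d) ∨ (x = b ∧ y = d ∧ z = c) ∨
        (x = c ∧ y = b ∧ z = d) ∨ (x = c ∧ y = d ∧ z = b) ∨ (x = d ∧ y = b ∧ z = c) ∨
        (x = d ∧ y = c ∧ z = b)))
    (w4 : ¬ ((x = a ∧ y = b ∧ z = e) ∨ (x = a ∧ y = e ∧ z = b) ∨
        (x = b ∧ y = a ∧ z = e) ∨ (x = b ∧ y = e ∧ z = a) ∨ (x = e ∧ y = a ∧ z = b) ∨
        (x = e ∧ y = b ∧ z = a)))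
    (w5 : ¬ ((x = a ∧ y = c ∧ z = e) ∨ (x = a ∧ y = e ∧ z = c) ∨
        (x = c ∧ y = a ∧ z = e) ∨ (x = c ∧ y = e ∧ z = a) ∨ (x = e ∧ y = a ∧ z = c) ∨
        (x = e ∧ y = c ∧ z = a)))
    (w6 : ¬ ((x = b ∧ y = c ∧ z = e) ∨ (x = b ∧ y = e ∧ z = c) ∨
        (x = c ∧ y = b ∧ z = e) ∨ (x = c ∧ y = e ∧ z = b) ∨ (x = e ∧ y = b ∧ z = c) ∨
        (x = e ∧ y = c ∧ z = b)))
    (c1 : ¬ (x ≠ a ∧ x ≠ b ∧ y ≠ a ∧ y ≠ b ∧ z ≠ a ∧ z ≠ b))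
    (c2 : ¬ (x ≠ a ∧ x ≠ c ∧ y ≠ a ∧ y ≠ c ∧ z ≠ a ∧ z ≠ c))
    (c3 : ¬ (x ≠ b ∧ x ≠ c ∧ y ≠ b ∧ y ≠ c ∧ z ≠ b ∧ z ≠ c))
    (c4 : ¬ (x ≠ d ∧ x ≠ e ∧ y ≠ d ∧ y ≠ e ∧ z ≠ d ∧ z ≠ e))
    : False := by
  have hd : (x = d ∨ x = e) ∨ (y = d ∨ y = e) ∨ (z = d ∨ z = e) := by
    by_contra hh
    simp only [not_or] at hh
    exact c4 ⟨hh.1.1, hh.1.2, hh.2.1.1, hh.2.1.2, hh.2.2.1, hh.2.2.2⟩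
  have hda := had.symm
  have hdb := hbd.symm
  have hdc := hcd.symm
  have hea := hae.symm
  have heb := hbe.symm
  have hec := hce.symm
  rcases hd with hd | hd | hd
  · have hv : x ≠ a ∧ x ≠ b ∧ x ≠ c := by
      rcases hd with rfl | rfl
      · exact ⟨hda, hdb, hdc⟩
      · exact ⟨hea, heb, hec⟩
    have g1 : y = a ∨ y = b ∨ z = a ∨ z = b := by
      by_contra hh
      simp only [not_or] at hh
      exact c1 ⟨hv.1, hv.2.1, hh.1, hh.2.1, hh.2.2.1, hh.2.2.2⟩
    have g2 : y = a ∨ y = c ∨ z = a ∨ z = c := by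
      by_contra hh
      simp only [not_or] at hh
      exact c2 ⟨hv.1, hv.2.2, hh.1, hh.2.1, hh.2.2.1, hh.2.2.2⟩
    have g3 : y = b ∨ y = c ∨ z = b ∨ z = c := by
      by_contra hh
      simp only [not_or] at hh
      exact c3 ⟨hv.2.1, hv.2.2, hh.1, hh.2.1, hh.2.2.1, hh.2.2.2⟩
    have := pair3 y z a b c hab hac hbc d3 g1 g2 g3
    clear c1 c2 c3 c4 g1 g2 g3
    rcases this with ⟨rfl, rfl⟩ | ⟨rfl, rfl⟩ | ⟨rfl, rfl⟩ | ⟨rfl, rfl⟩ | ⟨rfl, rfl⟩ | ⟨rfl, rfl⟩ <;>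
      rcases hd with rfl | rfl <;> simp at w1 w2 w3 w4 w5 w6
  · have hv : y ≠ a ∧ y ≠ b ∧ y ≠ c := by
      rcases hd with rfl | rfl
      · exact ⟨hda, hdb, hdc⟩
      · exact ⟨hea, heb, hec⟩
    have g1 : x = a ∨ x = b ∨ z = a ∨ z = b := by
      by_contra hh
      simp only [not_or] at hh
      exact c1 ⟨hh.1, hh.2.1, hv.1, hv.2.1, hh.2.2.1, hh.2.2.2⟩
    have g2 : x = a ∨ x = c ∨ z = a ∨ z = c := by
      by_contra hh
      simp only [not_or] at hh
      exact c2 ⟨hh.1, hh.2.1, hv.1, hv.2.2, hh.2.2.1, hh.2.2.2⟩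
    have g3 : x = b ∨ x = c ∨ z = b ∨ z = c := by
      by_contra hh
      simp only [not_or] at hh
      exact c3 ⟨hh.1, hh.2.1, hv.2.1, hv.2.2, hh.2.2.1, hh.2.2.2⟩
    have := pair3 x z a b c hab hac hbc d2 g1 g2 g3
    clear c1 c2 c3 c4 g1 g2 g3
    rcases this with ⟨rfl, rfl⟩ | ⟨rfl, rfl⟩ | ⟨rfl, rfl⟩ | ⟨rfl, rfl⟩ | ⟨rfl, rfl⟩ | ⟨rfl, rfl⟩ <;>
      rcases hd with rfl | rfl <;> simp at w1 w2 w3 w4 w5 w6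
  · have hv : z ≠ a ∧ z ≠ b ∧ z ≠ c := by
      rcases hd with rfl | rfl
      · exact ⟨hda, hdb, hdc⟩
      · exact ⟨hea, heb, hec⟩
    have g1 : x = a ∨ x = b ∨ y = a ∨ y = b := by
      by_contra hh
      simp only [not_or] at hh
      exact c1 ⟨hh.1, hh.2.1, hh.2.2.1, hh.2.2.2, hv.1, hv.2.1⟩
    have g2 : x = a ∨ x = c ∨ y = a ∨ y = c := by
      by_contra hh
      simp only [not_or] at hh
      exact c2 ⟨hh.1, hh.2.1, hh.2.2.1, hh.2.2.2, hv.1, hv.2.2⟩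
    have g3 : x = b ∨ x = c ∨ y = b ∨ y = c := by
      by_contra hh
      simp only [not_or] at hh
      exact c3 ⟨hh.1, hh.2.1, hh.2.2.1, hh.2.2.2, hv.2.1, hv.2.2⟩
    have := pair3 x y a b c hab hac hbc d1 g1 g2 g3
    clear c1 c2 c3 c4 g1 g2 g3
    rcases this with ⟨rfl, rfl⟩ | ⟨rfl, rfl⟩ | ⟨rfl, rfl⟩ | ⟨rfl, rfl⟩ | ⟨rfl, rfl⟩ | ⟨rfl, rfl⟩ <;>
      rcases hd with rfl | rfl <;> simp at w1 w2 w3 w4 w5 w6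

set_option maxHeartbeats 1000000 in
theorem WD_irr (hn : 5 ≤ n) :
    Irr (fnRep (Equiv.Perm (Fin n)) (Fin n × Fin n × Fin n)) (WD n) := by
  have hn4 : (n : ℂ) - 4 ≠ 0 := by exact_mod_cast cast_ne (show n ≠ 4 by omega)
  have hn2 : (n : ℂ) - 2 ≠ 0 := by exact_mod_cast cast_ne (show n ≠ 2 by omega)
  have hn0 : (n : ℂ) ≠ 0 := by exact_mod_cast (show n ≠ 0 by omega)
  let a : Fin n := ⟨0, by omega⟩
  let b : Fin n := ⟨1, by omega⟩
  let c : Fin n := ⟨2, by omega⟩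
  let d : Fin n := ⟨3, by omega⟩
  let e : Fin n := ⟨4, by omega⟩
  have hab : a ≠ b := by simp [a, b]
  have hac : a ≠ c := by simp [a, c]
  have hbc : b ≠ c := by simp [b, c]
  have had : a ≠ d := by simp [a, d]
  have hbd : b ≠ d := by simp [b, d]
  have hcd : c ≠ d := by simp [c, d]
  have hae : a ≠ e := by simp [a, e]
  have hbe : b ≠ e := by simp [b, e]
  have hce : c ≠ e := by simp [c, e]
  have hde : d ≠ e := by simp [d, e]
  clear_value a b c d e
  let R : Module.End ℂ (Fin n × Fin n × Fin n → ℂ) := fnRep (Equiv.Perm (Fin n)) _ (Equiv.swap d e)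
  let K : Module.End ℂ (Fin n × Fin n × Fin n → ℂ) := kap (Equiv.swap a b) (Equiv.swap a c)
  have hKmem : ∀ U, Stab (fnRep (Equiv.Perm (Fin n)) (Fin n × Fin n × Fin n)) U → ∀ u ∈ U,
      (K * (1 - R)) u ∈ U := fun U hU u hu => kap_mem _ _ U hU _ (U.sub_mem hu (hU _ _ hu))
  refine irr_crit _ (WD_stab _) ?_ (K * (1 - R)) (a, d, b) hKmem ?_ ?_
  · intro h
    have := finrank_WD (show 5 ≤ n by omega)
    rw [h, finrank_bot] at this
    have h2 : (n : ℂ) * (n - 2) * (n - 4) / 3 ≠ 0 :=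
      div_ne_zero (mul_ne_zero (mul_ne_zero hn0 hn2) hn4) three_ne_zero
    exact h2 (by rw [← this]; simp)
  · intro f hf h0
    have hF := hKmem _ (WD_stab _) f hf
    obtain ⟨k1, k2, k3⟩ := kap_swaps (I := Fin n × Fin n × Fin n) hab hac hbc
    have A1 := anti_of _ (Equiv.swap_mul_self _ _) _ k1 ((1 - R) f)
    have A2 := anti_of _ (Equiv.swap_mul_self _ _) _ k2 ((1 - R) f)
    have A3 := anti_of _ (Equiv.swap_mul_self _ _) _ k3 ((1 - R) f)
    have comm : ∀ u v : Fin n, u ≠ d → u ≠ e → v ≠ d → v ≠ e →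
        Equiv.swap d e * Equiv.swap u v = Equiv.swap u v * Equiv.swap d e := by
      intro u v h1 h2 h3 h4
      refine Equiv.Perm.Disjoint.commute ?_
      intro x
      by_cases hx : x = d ∨ x = e
      · right
        apply Equiv.swap_apply_of_ne_of_ne <;> grind
      · left
        apply Equiv.swap_apply_of_ne_of_ne <;> grind
    have cR : R * K = K * R := by
      have r1 : R * fnRep (Equiv.Perm (Fin n)) _ (Equiv.swap a b) = fnRep (Equiv.Perm (Fin n)) _ (Equiv.swap a b) * R := by
        simp only [R, ← map_mul]; rw [comm _ _ had hae hbd hbe]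
      have r2 : R * fnRep (Equiv.Perm (Fin n)) _ (Equiv.swap a c) = fnRep (Equiv.Perm (Fin n)) _ (Equiv.swap a c) * R := by
        simp only [R, ← map_mul]; rw [comm _ _ had hae hcd hce]
      have q1 : Commute R (fnRep (Equiv.Perm (Fin n)) _ (Equiv.swap a b)) := r1
      have q2 : Commute R (fnRep (Equiv.Perm (Fin n)) _ (Equiv.swap a c)) := r2
      have : Commute R K :=
        ((((((Commute.one_right R).sub_right q1).sub_right q2).sub_right
          ((q1.mul_right q2).mul_right q1)).add_right (q1.mul_right q2)).add_right
          (q2.mul_right q1))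
      exact this
    have RR : R * R = 1 := by
      simp only [R, ← map_mul, Equiv.swap_mul_self, map_one]
    have A4 := anti_of (Equiv.swap d e) (Equiv.swap_mul_self _ _) (K * (1 - R)) (by
      change R * (K * (1 - R)) = _
      rw [← mul_assoc, cR, mul_assoc, mul_sub, RR, mul_one]
      exact LinearMap.ext fun u => by simp [mul_sub]) f
    change ∀ x, (K * (1 - R)) f (Equiv.swap a b • x) = - (K * (1 - R)) f x at A1
    change ∀ x, (K * (1 - R)) f (Equiv.swap a c • x) = - (K * (1 - R)) f x at A2
    change ∀ x, (K * (1 - R)) f (Equiv.swap b c • x) = - (K * (1 - R)) f x at A3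
    generalize (K * (1 - R)) f = F at *
    rw [mem_WD] at hF
    obtain ⟨⟨h1, h2, h3⟩, h4⟩ := hF
    clear h3 h4 hKmem
    have sw : ∀ u v w : Fin n, w ≠ u → w ≠ v → Equiv.swap u v w = w :=
      fun u v w => Equiv.swap_apply_of_ne_of_ne
    -- pattern
    let Z : Fin n → Fin n → Fin n → Prop := fun u v w => F (u, w, v) = 0 ∧ F (v, w, u) = 0 ∧
      F (u, v, w) = 0
    have tr : ∀ s t : Fin n, (∀ x, F (Equiv.swap s t • x) = - F x) → ∀ x, F x = 0 →
        F (Equiv.swap s t • x) = 0 := by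
      intro s t h x hx
      rw [h, hx, neg_zero]
    have Zt : ∀ s t : Fin n, (∀ x, F (Equiv.swap s t • x) = - F x) → ∀ u v w, Z u v w →
        Z (Equiv.swap s t u) (Equiv.swap s t v) (Equiv.swap s t w) :=
      fun s t h u v w hz => ⟨tr s t h _ hz.1, tr s t h _ hz.2.1, tr s t h _ hz.2.2⟩
    have Z0 : Z a b d := by
      refine ⟨h0, ?_, ?_⟩
      · have := tr a b A1 _ h0
        simpa [Prod.smul_mk, sw a b d had.symm hbd.symm] using this
      · have := A1 (a, b, d)
        simp only [Prod.smul_mk, Equiv.Perm.smul_def, Equiv.swap_apply_left,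
          Equiv.swap_apply_right, sw a b d had.symm hbd.symm] at this
        rw [h2] at this
        linear_combination this / 2
    have Z1 : Z a c d := by
      have := Zt b c A3 _ _ _ Z0
      rwa [sw b c a hab hac, sw b c d hbd.symm hcd.symm, Equiv.swap_apply_left] at this
    have Z2 : Z b c d := by
      have := Zt a b A1 _ _ _ Z1
      rwa [sw a b c hac.symm hbc.symm, sw a b d had.symm hbd.symm, Equiv.swap_apply_left] at this
    have Ze : ∀ u v, u ≠ d → u ≠ e → v ≠ d → v ≠ e → Z u v d → Z u v e := by
      intro u v q1 q2 q3 q4 hz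
      have := Zt d e A4 _ _ _ hz
      rwa [sw d e u q1 q2, sw d e v q3 q4, Equiv.swap_apply_left] at this
    have Z3 := Ze _ _ had hae hbd hbe Z0
    have Z4 := Ze _ _ had hae hcd hce Z1
    have Z5 := Ze _ _ hbd hbe hcd hce Z2
    ext ⟨x, y, z⟩
    change F (x, y, z) = 0
    by_cases hd : Dis3 (x, y, z)
    swap
    · exact h1 _ hd
    obtain ⟨d1, d2, d3⟩ := hd
    simp only at d1 d2 d3
    have fx : ∀ u v : Fin n, (∀ x, F (Equiv.swap u v • x) = - F x) → x ≠ u → x ≠ v → y ≠ u →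
        y ≠ v → z ≠ u → z ≠ v → F (x, y, z) = 0 := by
      intro u v A e1 e2 e3 e4 e5 e6
      refine anti_fix F u v A _ ?_
      simp [Prod.smul_mk, Equiv.swap_apply_of_ne_of_ne, *]
    have r1 := fx a b A1
    have r2 := fx a c A2
    have r3 := fx b c A3
    have r4 := fx d e A4
    have hall : ∀ u v w, Z u v w → (∀ p q r, ((p = u ∧ q = v ∧ r = w) ∨ (p = u ∧ q = w ∧ r = v) ∨
        (p = v ∧ q = u ∧ r = w) ∨ (p = v ∧ q = w ∧ r = u) ∨ (p = w ∧ q = u ∧ r = v) ∨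
        (p = w ∧ q = v ∧ r = u)) → F (p, q, r) = 0) := by
      rintro u v w ⟨z1, z2, z3⟩ p q r (⟨rfl, rfl, rfl⟩ | ⟨rfl, rfl, rfl⟩ | ⟨rfl, rfl, rfl⟩ |
        ⟨rfl, rfl, rfl⟩ | ⟨rfl, rfl, rfl⟩ | ⟨rfl, rfl, rfl⟩)
      · exact z3
      · exact z1
      · rw [h2]; exact z3
      · exact z2
      · rw [h2]; exact z1
      · rw [h2]; exact z2
    by_contra hne
    have w1 := fun h => hne (hall _ _ _ Z0 x y z h)
    have w2 := fun h => hne (hall _ _ _ Z1 x y z h)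
    have w3 := fun h => hne (hall _ _ _ Z2 x y z h)
    have w4 := fun h => hne (hall _ _ _ Z3 x y z h)
    have w5 := fun h => hne (hall _ _ _ Z4 x y z h)
    have w6 := fun h => hne (hall _ _ _ Z5 x y z h)
    clear Z0 Z1 Z2 Z3 Z4 Z5 Ze Zt hall fx tr sw A1 A2 A3 A4 h1 h2 comm cR RR k1 k2 k3
    have c1 : ¬ (x ≠ a ∧ x ≠ b ∧ y ≠ a ∧ y ≠ b ∧ z ≠ a ∧ z ≠ b) := by
      rintro ⟨q1, q2, q3, q4, q5, q6⟩; exact hne (r1 q1 q2 q3 q4 q5 q6)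
    have c2 : ¬ (x ≠ a ∧ x ≠ c ∧ y ≠ a ∧ y ≠ c ∧ z ≠ a ∧ z ≠ c) := by
      rintro ⟨q1, q2, q3, q4, q5, q6⟩; exact hne (r2 q1 q2 q3 q4 q5 q6)
    have c3 : ¬ (x ≠ b ∧ x ≠ c ∧ y ≠ b ∧ y ≠ c ∧ z ≠ b ∧ z ≠ c) := by
      rintro ⟨q1, q2, q3, q4, q5, q6⟩; exact hne (r3 q1 q2 q3 q4 q5 q6)
    have c4 : ¬ (x ≠ d ∧ x ≠ e ∧ y ≠ d ∧ y ≠ e ∧ z ≠ d ∧ z ≠ e) := by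
      rintro ⟨q1, q2, q3, q4, q5, q6⟩; exact hne (r4 q1 q2 q3 q4 q5 q6)
    exact comb5 x y z a b c d e hab hac hbc had hbd hcd hae hbe hce hde d1 d2 d3 w1 w2 w3 w4 w5 w6
      c1 c2 c3 c4
  · intro f hf hg
    refine WD_zero hn f hf ?_
    intro x y z u v hxy hxz hyz hxu hyu hzu hxv hyv hzv huv
    obtain ⟨g, hg'⟩ := perm_trans ![x, y, z, u, v] ![a, b, c, d, e]
      (inj5 hxy hxz hyz hxu hyu hzu hxv hyv hzv huv)
      (inj5 hab hac hbc had hbd hcd hae hbe hce hde)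
    have e0 := hg' 0
    have e1 := hg' 1
    have e2 := hg' 2
    have e3 := hg' 3
    have e4 := hg' 4
    simp at e0 e1 e2 e3 e4
    have i0 : g⁻¹ a = x := by rw [← e0]; simp
    have i1 : g⁻¹ b = y := by rw [← e1]; simp
    have i2 : g⁻¹ c = z := by rw [← e2]; simp
    have i3 : g⁻¹ d = u := by rw [← e3]; simp
    have i4 : g⁻¹ e = v := by rw [← e4]; simp
    have := hg g
    rw [Module.End.mul_apply] at this
    rw [kap_eval _ _ (Equiv.swap_mul_self _ _) (Equiv.swap_mul_self _ _)] at this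
    simp only [R, LinearMap.sub_apply, Module.End.one_apply, Pi.sub_apply, fnRep_apply,
      Prod.smul_mk, Equiv.Perm.smul_def, Equiv.swap_apply_left, Equiv.swap_inv,
      Equiv.swap_apply_right, Equiv.swap_apply_of_ne_of_ne hab.symm hbc,
      Equiv.swap_apply_of_ne_of_ne hac.symm hbc.symm,
      Equiv.swap_apply_of_ne_of_ne had.symm hbd.symm, Equiv.swap_apply_of_ne_of_ne had.symm hcd.symm,
      Equiv.swap_apply_of_ne_of_ne had hae, Equiv.swap_apply_of_ne_of_ne hbd hbe,
      Equiv.swap_apply_of_ne_of_ne hcd hce,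
      i0, i1, i2, i3, i4] at this
    linear_combination this

end PartD2


section AutPart

open Equiv Equiv.Perm

variable {n : ℕ}

/-- The three-cycle sending a to b to c to a. -/
def cyc (a b c : Fin n) : Perm (Fin n) := swap a b * swap b c

theorem cyc_apply (a b c x : Fin n) : cyc a b c x = swap a b (swap b c x) := rfl

theorem cyc_three {a b c : Fin n} (hab : a ≠ b) (hac : a ≠ c) (hbc : b ≠ c) :
    IsThreeCycle (cyc a b c) := by
  have := isThreeCycle_swap_mul_swap_same hab.symm hbc hac
  rwa [swap_comm b a] at this

theorem tc_cube {v : Perm (Fin n)} (h : IsThreeCycle v) (x : Fin n) : v (v (v x)) = x := by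
  have := pow_orderOf_eq_one v
  rw [h.orderOf] at this
  have := Equiv.congr_fun this x
  simpa [pow_succ] using this

theorem tc_eq {v : Perm (Fin n)} (h : IsThreeCycle v) {x : Fin n} (hx : v x ≠ x) :
    v = cyc x (v x) (v (v x)) :=
  h.eq_swap_mul_swap_iff_mem_support.2 (by simpa using hx)

theorem tc_supp {v : Perm (Fin n)} (h : IsThreeCycle v) {x y : Fin n} (hx : v x ≠ x)
    (hy : v y ≠ y) : y = x ∨ y = v x ∨ y = v (v x) := by
  by_contra! hc
  apply hy
  rw [tc_eq h hx, cyc_apply, swap_apply_of_ne_of_ne hc.2.1 hc.2.2,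
    swap_apply_of_ne_of_ne hc.1 hc.2.1]

theorem tc_nonfix {v : Perm (Fin n)} (h : IsThreeCycle v) : ∃ x, v x ≠ x := by
  obtain ⟨x, hx⟩ := h.isCycle.nonempty_support
  exact ⟨x, by simpa using hx⟩

theorem cyc_conj (σ : Perm (Fin n)) (a b c : Fin n) :
    σ * cyc a b c * σ⁻¹ = cyc (σ a) (σ b) (σ c) := by
  simp only [cyc, swap_apply_apply]
  group

/-- Two three-cycles whose product is an involution share an edge. -/
theorem tc_share {v w : Perm (Fin n)} (hv : IsThreeCycle v) (hw : IsThreeCycle w)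
    (h2 : (v * w) * (v * w) = 1) (h1 : v * w ≠ 1) : ∃ a, v a = w a ∧ v a ≠ a := by
  by_contra! hc
  have hi : ∀ x, v (w (v (w x))) = x := fun x => by
    have := Equiv.congr_fun h2 x
    simpa using this
  have c3 := tc_cube hv
  have d3 := tc_cube hw
  have hinj : ∀ x y, v x = v y → x = y := fun x y h => v.injective h
  have hne2 : ∀ x, v x ≠ x → v (v x) ≠ v x := fun x hx h => hx (v.injective h)
  -- support of v inside support of w
  have key : ∀ x, v x ≠ x → w x ≠ x := by
    intro x hx hwx
    have e := hi x
    rw [hwx] at e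
    have e2 : w (v x) = v (v x) := by
      apply v.injective
      rw [e, c3]
    exact hne2 x hx (hc (v x) e2.symm)
  obtain ⟨x, hx⟩ := tc_nonfix hv
  have g : ∀ x, v x ≠ x → w x = v (v x) := by
    intro x hx
    have hwx := key x hx
    have hvx := key (v x) (hne2 x hx)
    have hvvx := key (v (v x)) (hne2 _ (hne2 x hx))
    have hwwx : w (w x) ≠ x := fun h => by
      have := d3 x
      rw [h] at this
      exact hwx this
    have hcx := hc x
    rcases tc_supp hw hwx hvx with h | h | h
    · exact absurd h hx
    · exact absurd (hc x h) hx
    · rcases tc_supp hw hwx hvvx with h' | h' | h'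
      · exfalso
        have e := c3 x
        rw [h'] at e
        exact hx e
      · exact h'.symm
      · exact absurd (h'.trans h.symm) (hne2 x hx)
  apply h1
  ext y
  congr 1
  change v (w y) = y
  by_cases hy : v y = y
  · have : w y = y := by
      by_contra hwy
      have hwx := key x hx
      have e1 := g x hx
      rcases tc_supp hw hwx hwy with h | h | h
      · exact hx (h ▸ hy)
      · rw [h, e1, c3] at hy
        have e := c3 x
        rw [← hy] at e
        exact hx e
      · have e2 : w (w x) = v x := by
          rw [e1, g _ (hne2 _ (hne2 x hx)), c3]
        rw [h, e2] at hy
        exact hne2 x hx hy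
    rw [this, hy]
  · rw [g y hy, c3]

theorem tc_share_all {u v w : Perm (Fin n)} (hu : IsThreeCycle u) (hv : IsThreeCycle v)
    (hw : IsThreeCycle w) (huv : u ≠ v) (a : Fin n) (ha : u a = v a) (ha' : u a ≠ a)
    (h1 : ∃ x, u x = w x ∧ u x ≠ x) (h2 : ∃ x, v x = w x ∧ v x ≠ x) : w a = u a := by
  obtain ⟨x, hx, hx'⟩ := h1
  obtain ⟨y, hy, hy'⟩ := h2
  have hva : v a ≠ a := ha ▸ ha'
  have hne : u (u a) ≠ v (v a) := by
    intro h
    apply huv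
    rw [tc_eq hu ha', tc_eq hv hva, h, ha]
  have cu := tc_cube hu
  have cv := tc_cube hv
  have cw := tc_cube hw
  have hwx : w x ≠ x := hx ▸ hx'
  have hwy : w y ≠ y := hy ▸ hy'
  have s := tc_supp hw hwx hwy
  have cua := cu a
  have cva := cv a
  have cwx := cw x
  have iu : ∀ x y, u x = u y → x = y := fun x y h => u.injective h
  have iv : ∀ x y, v x = v y → x = y := fun x y h => v.injective h
  have iw : ∀ x y, w x = w y → x = y := fun x y h => w.injective h
  have := iu a (u a)
  have := iu (u (u a)) a
  have := iv a (v a)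
  have := iv (v (v a)) a
  have := iw x y
  rcases tc_supp hu ha' hx' with h | h | h <;> rcases tc_supp hv hva hy' with h' | h' | h' <;>
    grind

end AutPart


section AutPart2

open Equiv Equiv.Perm

variable {n : ℕ}

theorem cyc_prod {z o i j : Fin n} (hzo : z ≠ o) (hiz : i ≠ z) (hio : i ≠ o) (hjz : j ≠ z)
    (hjo : j ≠ o) (hij : i ≠ j) : cyc z o i * cyc z o j = swap z i * swap o j := by
  ext x
  congr 1
  simp only [cyc, Perm.mul_apply, swap_apply_def]
  split_ifs <;> simp_all

theorem sym_gen {X : Type} (T : X → X → X → Prop) (z o : X)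
    (R : ∀ a b c, T a b c → T b c a) (I : ∀ a b c, T a b c → T b a c)
    (m1 : ∀ i, i ≠ z → i ≠ o → T z o i)
    (m2 : ∀ i j, i ≠ z → i ≠ o → j ≠ z → j ≠ o → i ≠ j → T o j i)
    (m3 : ∀ i j, i ≠ z → i ≠ o → j ≠ z → j ≠ o → i ≠ j → T j z i)
    (m4 : ∀ i j k, i ≠ z → i ≠ o → j ≠ z → j ≠ o → k ≠ z → k ≠ o → i ≠ j → i ≠ k → j ≠ k →
      T k j i) (a b c : X) (hab : a ≠ b) (hac : a ≠ c) (hbc : b ≠ c) : T a b c := by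
  have M : ∀ b c, b ≠ z → c ≠ z → b ≠ c → T z b c := by
    intro b c hb hc hbc
    by_cases h1 : b = o
    · subst h1; exact m1 c hc hbc.symm
    by_cases h2 : c = o
    · subst h2; exact I _ _ _ (R _ _ _ (R _ _ _ (m1 b hb h1)))
    exact I _ _ _ (m3 c b hc h2 hb h1 hbc.symm)
  have N : ∀ b c, b ≠ o → c ≠ o → b ≠ c → T o b c := by
    intro b c hb hc hbc
    by_cases h1 : b = z
    · subst h1; exact I _ _ _ (m1 c hbc.symm hc)
    by_cases h2 : c = z
    · subst h2; exact (R _ _ _ (m1 b h1 hb))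
    exact m2 c b h2 hc h1 hb hbc.symm
  by_cases h1 : a = z
  · subst h1; exact M b c hab.symm hac.symm hbc
  by_cases h2 : b = z
  · subst h2; exact I _ _ _ (M a c hab hbc.symm hac)
  by_cases h3 : c = z
  · subst h3; exact R _ _ _ (M a b hac hbc hab)
  by_cases h4 : a = o
  · subst h4; exact N b c hab.symm hac.symm hbc
  by_cases h5 : b = o
  · subst h5; exact I _ _ _ (N a c hab hbc.symm hac)
  by_cases h6 : c = o
  · subst h6; exact R _ _ _ (N a b hac hbc hab)
  exact m4 c b a h3 h6 h2 h5 h1 h4 hbc.symm hac.symm hab.symm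

theorem cyc_rot {a b c : Fin n} (hab : a ≠ b) (hac : a ≠ c) (hbc : b ≠ c) :
    cyc b c a = cyc a b c := by
  ext x
  congr 1
  simp only [cyc, Perm.mul_apply, swap_apply_def]
  split_ifs <;> simp_all

theorem cyc_ev {a b c : Fin n} (hab : a ≠ b) (hac : a ≠ c) (hbc : b ≠ c) :
    cyc a b c a = b ∧ cyc a b c b = c ∧ cyc a b c c = a := by
  refine ⟨?_, ?_, ?_⟩
  · rw [cyc_apply, swap_apply_of_ne_of_ne hab hac, swap_apply_left]
  · rw [cyc_apply, swap_apply_left, swap_apply_of_ne_of_ne hac.symm hbc.symm]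
  · rw [cyc_apply, swap_apply_right, swap_apply_right]

theorem cyc_fix {a b c x : Fin n} (h1 : x ≠ a) (h2 : x ≠ b) (h3 : x ≠ c) :
    cyc a b c x = x := by
  rw [cyc_apply, swap_apply_of_ne_of_ne h2 h3, swap_apply_of_ne_of_ne h1 h2]

theorem cyc_inv {a b c : Fin n} (hab : a ≠ b) (hac : a ≠ c) (hbc : b ≠ c) :
    (cyc a b c)⁻¹ = cyc b a c := by
  rw [← cyc_rot hab.symm hbc hac, ← cyc_rot hac hab hbc.symm]
  rw [cyc, cyc, mul_inv_rev, swap_inv, swap_inv, swap_comm b c, swap_comm a b]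

/-- Closure property: all three-cycles lie in a subgroup containing those on a common edge. -/
theorem cyc_gen (K : Subgroup (Perm (Fin n))) {z o : Fin n} (hzo : z ≠ o)
    (h : ∀ i, i ≠ z → i ≠ o → cyc z o i ∈ K) (a b c : Fin n) (hab : a ≠ b) (hac : a ≠ c)
    (hbc : b ≠ c) : cyc a b c ∈ K := by
  have conj : ∀ s t, s ∈ K → t ∈ K → s * t * s⁻¹ ∈ K := fun s t hs ht =>
    K.mul_mem (K.mul_mem hs ht) (K.inv_mem hs)
  have m2 : ∀ i j, i ≠ z → i ≠ o → j ≠ z → j ≠ o → i ≠ j → cyc o j i ∈ K := by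
    intro i j h1 h2 h3 h4 h5
    have := conj _ _ (h j h3 h4) (h i h1 h2)
    rwa [cyc_conj, (cyc_ev hzo h3.symm h4.symm).1, (cyc_ev hzo h3.symm h4.symm).2.1,
      cyc_fix h1 h2 h5] at this
  have m3 : ∀ i j, i ≠ z → i ≠ o → j ≠ z → j ≠ o → i ≠ j → cyc j z i ∈ K := by
    intro i j h1 h2 h3 h4 h5
    have := conj _ _ (h j h3 h4) (m2 i j h1 h2 h3 h4 h5)
    rwa [cyc_conj, (cyc_ev hzo h3.symm h4.symm).2.1, (cyc_ev hzo h3.symm h4.symm).2.2,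
      cyc_fix h1 h2 h5] at this
  have m4 : ∀ i j k, i ≠ z → i ≠ o → j ≠ z → j ≠ o → k ≠ z → k ≠ o → i ≠ j → i ≠ k → j ≠ k →
      cyc k j i ∈ K := by
    intro i j k h1 h2 h3 h4 h5 h6 h7 h8 h9
    have := conj _ _ (h k h5 h6) (m2 i j h1 h2 h3 h4 h7)
    rwa [cyc_conj, (cyc_ev hzo h5.symm h6.symm).2.1, cyc_fix h1 h2 h8,
      cyc_fix h3 h4 h9] at this
  refine sym_gen (fun a b c => a ≠ b → a ≠ c → b ≠ c → cyc a b c ∈ K) z o ?_ ?_ ?_ ?_ ?_ ?_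
    a b c hab hac hbc hab hac hbc
  · intro a b c t h1 h2 h3
    rw [cyc_rot h2.symm h3.symm h1]
    exact t h2.symm h3.symm h1
  · intro a b c t h1 h2 h3
    rw [← cyc_inv h1.symm h3 h2]
    exact K.inv_mem (t h1.symm h3 h2)
  · intro i h1 h2 _ _ _; exact h i h1 h2
  · intro i j h1 h2 h3 h4 h5 _ _ _; exact m2 i j h1 h2 h3 h4 h5
  · intro i j h1 h2 h3 h4 h5 _ _ _; exact m3 i j h1 h2 h3 h4 h5
  · intro i j k h1 h2 h3 h4 h5 h6 h7 h8 h9 _ _ _; exact m4 i j k h1 h2 h3 h4 h5 h6 h7 h8 h9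

/-- Three-cycle as an element of the alternating group. -/
def cycA {a b c : Fin n} (hab : a ≠ b) (hac : a ≠ c) (hbc : b ≠ c) : alternatingGroup (Fin n) :=
  ⟨cyc a b c, (cyc_three hab hac hbc).mem_alternatingGroup⟩

theorem conj_of_three (hn : 5 ≤ n) (φ : MulAut (alternatingGroup (Fin n)))
    (hφ : ∀ g : alternatingGroup (Fin n), IsThreeCycle (g : Perm (Fin n)) →
      IsThreeCycle (φ g : Perm (Fin n))) :
    ∃ σ : Perm (Fin n), φ = MulAut.conjNormal σ := by
  let z : Fin n := ⟨0, by omega⟩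
  let o : Fin n := ⟨1, by omega⟩
  let t : Fin n := ⟨2, by omega⟩
  let r : Fin n := ⟨3, by omega⟩
  have hzo : z ≠ o := by simp [z, o]
  have htz : t ≠ z := by simp [z, t]
  have hto : t ≠ o := by simp [o, t]
  have hrz : r ≠ z := by simp [z, r]
  have hro : r ≠ o := by simp [o, r]
  have htr : t ≠ r := by simp [t, r]
  let v : Fin n → Perm (Fin n) := fun i =>
    if h : i ≠ z ∧ i ≠ o then (φ (cycA hzo h.1.symm h.2.symm) : Perm (Fin n)) else 1
  have hv : ∀ i (h1 : i ≠ z) (h2 : i ≠ o), v i = (φ (cycA hzo h1.symm h2.symm) : Perm (Fin n)) := by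
    intro i h1 h2
    simp only [v]
    rw [dif_pos ⟨h1, h2⟩]
  have v3 : ∀ i, i ≠ z → i ≠ o → IsThreeCycle (v i) := by
    intro i h1 h2
    rw [hv i h1 h2]
    exact hφ _ (cyc_three hzo h1.symm h2.symm)
  have vne : ∀ i j, i ≠ z → i ≠ o → j ≠ z → j ≠ o → i ≠ j → v i ≠ v j := by
    intro i j h1 h2 h3 h4 h5 h
    rw [hv i h1 h2, hv j h3 h4] at h
    have := congrArg (Subtype.val) (φ.injective (Subtype.ext h))
    have e : cyc z o i = cyc z o j := this
    have := congrArg (fun f : Perm (Fin n) => f o) e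
    simp only [(cyc_ev hzo h3.symm h4.symm).2.1, (cyc_ev hzo h1.symm h2.symm).2.1] at this
    exact h5 this
  have vsh : ∀ i j, i ≠ z → i ≠ o → j ≠ z → j ≠ o → i ≠ j → ∃ a, v i a = v j a ∧ v i a ≠ a := by
    intro i j h1 h2 h3 h4 h5
    have e := cyc_prod hzo h1 h2 h3 h4 h5
    have sq : (swap z i * swap o j) * (swap z i * swap o j) = 1 := by
      have : swap z i * swap o j = swap o j * swap z i := by
        apply Perm.Disjoint.commute
        apply disjoint_swap_swap
        simp [hzo, h2, h3.symm, h4.symm, h5, h1.symm]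
      nth_rewrite 1 [this]
      simp [mul_assoc]
    have ne1 : swap z i * swap o j ≠ 1 := by
      intro h
      have := Equiv.congr_fun h z
      simp [swap_apply_of_ne_of_ne hzo h3.symm, h1] at this
    refine tc_share (v3 i h1 h2) (v3 j h3 h4) ?_ ?_
    · rw [hv i h1 h2, hv j h3 h4]
      have : ((cycA hzo h1.symm h2.symm * cycA hzo h3.symm h4.symm) *
        (cycA hzo h1.symm h2.symm * cycA hzo h3.symm h4.symm)) = 1 := by
        apply Subtype.ext
        change (cyc z o i * cyc z o j) * (cyc z o i * cyc z o j) = 1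
        rw [e, sq]
      have := congrArg (fun g => (φ g : Perm (Fin n))) this
      simpa using this
    · rw [hv i h1 h2, hv j h3 h4]
      intro h
      have h' : φ (cycA hzo h1.symm h2.symm * cycA hzo h3.symm h4.symm) = φ 1 := by
        rw [map_mul, map_one]
        exact Subtype.ext h
      have := congrArg Subtype.val (φ.injective h')
      exact ne1 (e ▸ this)
  obtain ⟨a, ha, ha'⟩ := vsh t r htz hto hrz hro htr
  have com : ∀ i, i ≠ z → i ≠ o → v i a = v t a := by
    intro i h1 h2
    by_cases hit : i = t
    · rw [hit]
    by_cases hir : i = r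
    · rw [hir, ha]
    exact tc_share_all (v3 t htz hto) (v3 r hrz hro) (v3 i h1 h2)
      (vne t r htz hto hrz hro htr) a ha ha' (vsh t i htz hto h1 h2 (Ne.symm hit))
      (vsh r i hrz hro h1 h2 (Ne.symm hir))
  set b := v t a with hb
  let f : Fin n → Fin n := fun i => if i = z then a else if i = o then b else v i b
  have fz : f z = a := by simp [f]
  have fo : f o = b := by simp [f, hzo.symm]
  have fi : ∀ i, i ≠ z → i ≠ o → f i = v i b := fun i h1 h2 => by simp [f, h1, h2]
  have nb : ∀ i, i ≠ z → i ≠ o → v i b ≠ b := by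
    intro i h1 h2 h
    rw [← com i h1 h2] at h
    have := (v i).injective h
    rw [com i h1 h2] at this
    exact ha' this
  have na : ∀ i, i ≠ z → i ≠ o → v i b ≠ a := by
    intro i h1 h2 h
    have := tc_cube (v3 i h1 h2) a
    rw [com i h1 h2, h, com i h1 h2] at this
    exact ha' this
  have vcyc : ∀ i, i ≠ z → i ≠ o → v i = cyc a b (v i b) := by
    intro i h1 h2
    have h := tc_eq (v3 i h1 h2) (x := a) (by rw [com i h1 h2]; exact ha')
    rwa [com i h1 h2] at h
  have finj : Function.Injective f := by
    intro i j hij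
    by_contra hne
    by_cases h1 : i = z
    · subst h1
      rw [fz] at hij
      by_cases h2 : j = o
      · subst h2; rw [fo] at hij; exact ha' hij.symm
      · rw [fi j (Ne.symm hne) h2] at hij; exact na j (Ne.symm hne) h2 hij.symm
    by_cases h2 : i = o
    · subst h2
      rw [fo] at hij
      by_cases h3 : j = z
      · subst h3; rw [fz] at hij; exact ha' hij
      · rw [fi j h3 (Ne.symm hne)] at hij; exact nb j h3 (Ne.symm hne) hij.symm
    rw [fi i h1 h2] at hij
    by_cases h3 : j = z
    · subst h3; rw [fz] at hij; exact na i h1 h2 hij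
    by_cases h4 : j = o
    · subst h4; rw [fo] at hij; exact nb i h1 h2 hij
    rw [fi j h3 h4] at hij
    apply vne i j h1 h2 h3 h4 hne
    rw [vcyc i h1 h2, vcyc j h3 h4, hij]
  let σ : Perm (Fin n) := Equiv.ofBijective f (Finite.injective_iff_bijective.1 finj)
  have hσ : ∀ i, σ i = f i := fun i => rfl
  refine ⟨σ, ?_⟩
  let E : Subgroup (alternatingGroup (Fin n)) :=
    MonoidHom.eqLocus φ.toMonoidHom (MulAut.conjNormal σ : MulAut (alternatingGroup (Fin n))).toMonoidHom
  have hE : ∀ g, g ∈ E ↔ φ g = MulAut.conjNormal σ g := fun g => Iff.rfl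
  have hK := cyc_gen (E.map (alternatingGroup (Fin n)).subtype) hzo (by
    intro i h1 h2
    refine ⟨cycA hzo h1.symm h2.symm, ?_, rfl⟩
    change _ ∈ E
    rw [hE]
    apply Subtype.ext
    rw [← hv i h1 h2, MulAut.conjNormal_apply]
    change v i = σ * cyc z o i * σ⁻¹
    rw [cyc_conj, hσ, hσ, hσ, fz, fo, fi i h1 h2]
    exact vcyc i h1 h2)
  have top : E = ⊤ := by
    rw [eq_top_iff, ← alternatingGroup.closure_isThreeCycles_eq_top, Subgroup.closure_le]
    intro g hg
    obtain ⟨x, hx⟩ := tc_nonfix hg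
    have h1 : (g : Perm (Fin n)) x ≠ (g : Perm (Fin n)) ((g : Perm (Fin n)) x) := fun h => hx ((g : Perm (Fin n)).injective h.symm)
    have h2 : x ≠ (g : Perm (Fin n)) ((g : Perm (Fin n)) x) := by
      intro h
      have := tc_cube hg x
      rw [← h] at this
      exact hx this
    obtain ⟨g', hg', e⟩ := hK _ _ _ hx.symm h2 h1
    rw [← tc_eq hg hx] at e
    have : g' = g := Subtype.ext e
    rwa [this] at hg'
  ext1 g
  exact (hE g).1 (top ▸ Subgroup.mem_top g)

end AutPart2


section AutPart3

open Equiv Equiv.Perm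

variable {n : ℕ}

theorem orb_self {x : Perm (Fin n)} (hx : ∀ i, x (x (x i)) = i) {p : Fin n} (hp : x p ≠ p) :
    p ≠ x p ∧ p ≠ x (x p) ∧ x p ≠ x (x p) := by
  refine ⟨hp.symm, fun h => ?_, fun h => hp (x.injective h).symm⟩
  have := hx p
  rw [← h] at this
  exact hp this

theorem orb_ne {x : Perm (Fin n)} (hx : ∀ i, x (x (x i)) = i) {p q : Fin n}
    (h0 : q ≠ p) (h1 : q ≠ x p) (h2 : q ≠ x (x p)) :
    (p ≠ q ∧ p ≠ x q ∧ p ≠ x (x q)) ∧ (x p ≠ q ∧ x p ≠ x q ∧ x p ≠ x (x q)) ∧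
    (x (x p) ≠ q ∧ x (x p) ≠ x q ∧ x (x p) ≠ x (x q)) := by
  have i := x.injective
  have a := hx p
  have b := hx q
  refine ⟨⟨h0.symm, fun h => h2 ?_, fun h => h1 ?_⟩, ⟨h1.symm, fun h => h0 (i h).symm, fun h => h2 ?_⟩,
    h2.symm, fun h => h1 (i h).symm, fun h => h0 (i (i h)).symm⟩
  · rw [h, b]
  · rw [h, b]
  · have := i h
    rw [this, b]

theorem six_pts {x : Perm (Fin n)} (hx : ∀ i, x (x (x i)) = i) (h1 : x ≠ 1)
    (h3 : ¬ IsThreeCycle x) : ∃ p q : Fin n, x p ≠ p ∧ x q ≠ q ∧ q ≠ p ∧ q ≠ x p ∧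
      q ≠ x (x p) := by
  obtain ⟨p, hp⟩ : ∃ p, x p ≠ p := by
    by_contra! h
    exact h1 (Equiv.ext h)
  by_contra! hc
  apply h3
  obtain ⟨a1, a2, a3⟩ := orb_self hx hp
  have : x = cyc p (x p) (x (x p)) := by
    ext i
    congr 1
    obtain ⟨e1, e2, e3⟩ := cyc_ev a1 a2 a3
    by_cases i0 : i = p
    · rw [i0, e1]
    by_cases i1 : i = x p
    · rw [i1, e2]
    by_cases i2 : i = x (x p)
    · rw [i2, e3, hx]
    rw [cyc_fix i0 i1 i2]
    by_contra hi
    exact i2 (hc p i hp hi i0 i1)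
  rw [this]
  exact cyc_three a1 a2 a3

theorem semi_mul {m : ℕ} {e : Fin m → Fin n} {s t : Perm (Fin n)} {s' t' : Perm (Fin m)}
    (hs : ∀ i, s (e i) = e (s' i)) (ht : ∀ i, t (e i) = e (t' i)) (i : Fin m) :
    (s * t) (e i) = e ((s' * t') i) := by
  rw [Perm.mul_apply, ht, hs, Perm.mul_apply]

theorem semi_pow {m : ℕ} {e : Fin m → Fin n} {s : Perm (Fin n)} {s' : Perm (Fin m)}
    (hs : ∀ i, s (e i) = e (s' i)) (k : ℕ) (i : Fin m) :
    (s ^ k) (e i) = e ((s' ^ k) i) := by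
  induction k with
  | zero => rfl
  | succ k ih =>
    have := hs ((s' ^ k) i)
    rw [pow_succ', pow_succ', Perm.mul_apply, ih, this, Perm.mul_apply]

theorem semi_inv {m : ℕ} {e : Fin m → Fin n} {s : Perm (Fin n)} {s' : Perm (Fin m)}
    (hs : ∀ i, s (e i) = e (s' i)) (i : Fin m) :
    s⁻¹ (e i) = e (s'⁻¹ i) := by
  rw [Perm.inv_eq_iff_eq, hs]; simp

theorem semi_swap {m : ℕ} {e : Fin m → Fin n} (he : Function.Injective e) (a b i : Fin m) :
    swap (e a) (e b) (e i) = e (swap a b i) := he.swap_apply a b i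

/-- A property distinguishing three-cycles. -/
def P30 (x : alternatingGroup (Fin n)) : Prop :=
  ∀ g : alternatingGroup (Fin n), (x * (g * x * g⁻¹)) ^ 30 = 1

theorem P30_map (φ : MulAut (alternatingGroup (Fin n))) {x : alternatingGroup (Fin n)}
    (h : P30 x) : P30 (φ x) := by
  intro g
  have := congrArg φ (h (φ.symm g))
  simpa using this

theorem not_P30 {m : ℕ} (e : Fin m → Fin n) (he : Function.Injective e)
    (x : alternatingGroup (Fin n)) (x' : Perm (Fin m))
    (hs : ∀ i, (x : Perm (Fin n)) (e i) = e (x' i)) (a b c d i : Fin m) (hab : a ≠ b) (hcd : c ≠ d)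
    (hi : ((x' * ((swap a b * swap c d) * x' * (swap a b * swap c d)⁻¹)) ^ 30) i ≠ i) :
    ¬ P30 x := by
  intro h
  have hab' : e a ≠ e b := fun h => hab (he h)
  have hcd' : e c ≠ e d := fun h => hcd (he h)
  have := h ⟨swap (e a) (e b) * swap (e c) (e d), by
    rw [mem_alternatingGroup, map_mul, sign_swap hab', sign_swap hcd']; rfl⟩
  have h2 := congrArg (fun g : alternatingGroup (Fin n) => (g : Perm (Fin n)) (e i)) this
  have sg := semi_mul (semi_swap he a b) (semi_swap he c d)
  have sy := semi_pow (semi_mul hs (semi_mul (semi_mul sg hs) (semi_inv sg))) 30 i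
  exact hi (he (sy.symm.trans h2))

theorem not_P30_of (hn : 7 ≤ n) (x : alternatingGroup (Fin n))
    (hx : ∀ i, (x : Perm (Fin n)) ((x : Perm (Fin n)) ((x : Perm (Fin n)) i)) = i) (h1 : (x : Perm (Fin n)) ≠ 1)
    (h3 : ¬ IsThreeCycle (x : Perm (Fin n))) : ¬ P30 x := by
  obtain ⟨p, q, hp, hq, q0, q1, q2⟩ := six_pts hx h1 h3
  set y : Perm (Fin n) := (x : Perm (Fin n)) with hy
  obtain ⟨a1, a2, a3⟩ := orb_self hx hp
  obtain ⟨b1, b2, b3⟩ := orb_self hx hq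
  obtain ⟨⟨c1, c2, c3⟩, ⟨c4, c5, c6⟩, c7, c8, c9⟩ := orb_ne hx q0 q1 q2
  have hc : ∃ c, c ∉ ({p, y p, y (y p), q, y q, y (y q)} : Finset (Fin n)) := by
    by_contra! h
    have h6 : ({p, y p, y (y p), q, y q, y (y q)} : Finset (Fin n)).card ≤ 6 := Finset.card_le_six
    have : ({p, y p, y (y p), q, y q, y (y q)} : Finset (Fin n)) = Finset.univ := by
      ext i; simp only [Finset.mem_univ, iff_true]; exact h i
    rw [this, Finset.card_univ, Fintype.card_fin] at h6
    omega
  obtain ⟨c, hc⟩ := hc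
  simp only [Finset.mem_insert, Finset.mem_singleton, not_or] at hc
  obtain ⟨d1, d2, d3, d4, d5, d6⟩ := hc
  by_cases hf : y c = c
  · have he : Function.Injective ![p, y p, y (y p), q, y q, y (y q), c] := by
      rw [← List.nodup_ofFn]
      simp [List.ofFn_succ, a1, a2, a3, b1, b2, b3, c1, c2, c3, c4, c5, c6, c7, c8, c9,
        Ne.symm d1, Ne.symm d2, Ne.symm d3, Ne.symm d4, Ne.symm d5, Ne.symm d6]
    refine not_P30 _ he x (cyc 0 1 2 * cyc 3 4 5) ?_ 0 3 1 6 0 (by decide) (by decide)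
      (by decide +kernel)
    intro i
    fin_cases i
    · rfl
    · rfl
    · exact hx p
    · rfl
    · rfl
    · exact hx q
    · exact hf
  · obtain ⟨e1, e2, e3⟩ := orb_self hx hf
    obtain ⟨⟨f1, f2, f3⟩, ⟨f4, f5, f6⟩, f7, f8, f9⟩ := orb_ne hx d1 d2 d3
    obtain ⟨⟨g1, g2, g3⟩, ⟨g4, g5, g6⟩, g7, g8, g9⟩ := orb_ne hx d4 d5 d6
    have he : Function.Injective ![p, y p, y (y p), q, y q, y (y q), c, y c, y (y c)] := by
      rw [← List.nodup_ofFn]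
      simp [List.ofFn_succ, a1, a2, a3, b1, b2, b3, c1, c2, c3, c4, c5, c6, c7, c8, c9,
        e1, e2, e3, f1, f2, f3, f4, f5, f6, f7, f8, f9, g1, g2, g3, g4, g5, g6, g7, g8, g9]
    refine not_P30 _ he x (cyc 0 1 2 * cyc 3 4 5 * cyc 6 7 8) ?_ 0 3 1 6 0 (by decide) (by decide)
      (by decide +kernel)
    intro i
    fin_cases i
    · rfl
    · rfl
    · exact hx p
    · rfl
    · rfl
    · exact hx q
    · rfl
    · rfl
    · exact hx c

theorem P30_of (x : alternatingGroup (Fin n)) (h : IsThreeCycle (x : Perm (Fin n))) : P30 x := by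
  intro g
  apply Subtype.ext
  have hy : IsThreeCycle ((g : Perm (Fin n)) * (x : Perm (Fin n)) * (g : Perm (Fin n))⁻¹) := by
    rw [IsThreeCycle, cycleType_conj]; exact h
  change ((x : Perm (Fin n)) * ((g : Perm (Fin n)) * (x : Perm (Fin n)) * (g : Perm (Fin n))⁻¹)) ^ 30 = 1
  set y : Perm (Fin n) := (g : Perm (Fin n)) * (x : Perm (Fin n)) * (g : Perm (Fin n))⁻¹ with hy'
  have hev : sign ((x : Perm (Fin n)) * y) = 1 := by rw [map_mul, h.sign, hy.sign]; rfl
  generalize (x : Perm (Fin n)) = x at *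
  by_cases hd : Disjoint x.support y.support
  · have hc : Commute x y := (disjoint_iff_disjoint_support.2 hd).commute
    rw [hc.mul_pow]
    have e1 : x ^ 3 = 1 := by rw [← h.orderOf]; exact pow_orderOf_eq_one x
    have e2 : y ^ 3 = 1 := by rw [← hy.orderOf]; exact pow_orderOf_eq_one y
    rw [show 30 = 3 * 10 by rfl, pow_mul, pow_mul, e1, e2]; simp
  · have hcard : (x * y).support.card ≤ 5 := by
      have h1 := Finset.card_le_card (support_mul_le x y)
      have h2 := Finset.card_union_add_card_inter x.support y.support
      rw [h.card_support, hy.card_support] at h2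
      have h3 : 0 < (x.support ∩ y.support).card := by
        rw [Finset.card_pos]
        rwa [Finset.disjoint_iff_inter_eq_empty, ← ne_eq, ← Finset.nonempty_iff_ne_empty] at hd
      have : (x * y).support.card ≤ (x.support ∪ y.support).card := h1
      omega
    generalize x * y = u at *
    rw [← orderOf_dvd_iff_pow_eq_one, ← lcm_cycleType, Multiset.lcm_dvd]
    intro k hk
    have k2 := two_le_of_mem_cycleType hk
    have hs := sum_cycleType u
    have hsg := sign_of_cycleType u
    have hall : ∀ j ∈ u.cycleType, 2 ≤ j := fun j hj => two_le_of_mem_cycleType hj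
    obtain ⟨s, hs'⟩ := Multiset.exists_cons_of_mem hk
    rw [hs'] at hs hsg hall
    simp only [Multiset.sum_cons, Multiset.card_cons] at hs hsg
    have : k ≤ 5 := by omega
    interval_cases k
    · norm_num
    · norm_num
    · exfalso
      have : s = 0 := by
        rw [Multiset.eq_zero_iff_forall_notMem]
        intro j hj
        have := hall j (Multiset.mem_cons_of_mem hj)
        have := Multiset.le_sum_of_mem hj
        omega
      rw [this, hev] at hsg
      revert hsg
      decide
    · norm_num

theorem preserve (hn : 5 ≤ n) (h6 : n ≠ 6) (φ : MulAut (alternatingGroup (Fin n)))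
    (g : alternatingGroup (Fin n)) (hg : IsThreeCycle (g : Perm (Fin n))) :
    IsThreeCycle (φ g : Perm (Fin n)) := by
  by_contra hc
  have hx : ∀ i, (φ g : Perm (Fin n)) ((φ g : Perm (Fin n)) ((φ g : Perm (Fin n)) i)) = i := by
    intro i
    have e : g ^ 3 = 1 := by
      apply Subtype.ext
      change (g : Perm (Fin n)) ^ 3 = 1
      rw [← hg.orderOf]; exact pow_orderOf_eq_one _
    have := congrArg (fun u => (φ u : Perm (Fin n)) i) e
    simpa [pow_succ] using this
  have h1 : (φ g : Perm (Fin n)) ≠ 1 := by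
    intro h
    have h' : φ g = φ 1 := by rw [map_one]; exact Subtype.ext h
    have := φ.injective h'
    rw [this] at hg
    exact absurd hg.isCycle.ne_one (by simp)
  rcases Nat.lt_or_ge n 7 with h7 | h7
  · obtain ⟨p, q, hp, hq, q0, q1, q2⟩ := six_pts hx h1 hc
    generalize (φ g : Perm (Fin n)) = y at *
    obtain ⟨a1, a2, a3⟩ := orb_self hx hp
    obtain ⟨b1, b2, b3⟩ := orb_self hx hq
    obtain ⟨⟨c1, c2, c3⟩, ⟨c4, c5, c6⟩, c7, c8, c9⟩ := orb_ne hx q0 q1 q2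
    have he : Function.Injective ![p, y p, y (y p), q, y q, y (y q)] := by
      rw [← List.nodup_ofFn]
      simp [List.ofFn_succ, a1, a2, a3, b1, b2, b3, c1, c2, c3, c4, c5, c6, c7, c8, c9]
    have := Fintype.card_le_of_injective _ he
    simp at this
    omega
  · exact not_P30_of h7 _ hx h1 hc (P30_map φ (P30_of g hg))

end AutPart3


section AutPart4

open Equiv Equiv.Perm

variable {n : ℕ}

theorem conjNormal_inj (hn : 5 ≤ n) : Function.Injective
    (MulAut.conjNormal : Perm (Fin n) →* MulAut (alternatingGroup (Fin n))) := by
  rw [injective_iff_map_eq_one]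
  intro τ h
  ext1 a
  by_contra ha
  change τ a ≠ a at ha
  have h2 : 1 < (({a, τ a} : Finset (Fin n))ᶜ).card := by
    rw [Finset.card_compl, Fintype.card_fin]
    have : ({a, τ a} : Finset (Fin n)).card ≤ 2 := Finset.card_le_two
    omega
  obtain ⟨b, hb, c, hc, hbc⟩ := Finset.one_lt_card.1 h2
  simp only [Finset.mem_compl, Finset.mem_insert, Finset.mem_singleton, not_or] at hb hc
  have e := congrArg (fun f : MulAut (alternatingGroup (Fin n)) =>
    (f (cycA (Ne.symm hb.1) (Ne.symm hc.1) hbc) : Perm (Fin n))) h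
  simp only [MulAut.conjNormal_apply] at e
  have e' : τ * cyc a b c * τ⁻¹ = cyc a b c := e
  rw [cyc_conj] at e'
  have e2 := congrArg (fun f : Perm (Fin n) => f (τ a)) e'
  change cyc (τ a) (τ b) (τ c) (τ a) = cyc a b c (τ a) at e2
  rw [cyc_fix ha (Ne.symm hb.2) (Ne.symm hc.2), (cyc_ev (fun h => hb.1 (τ.injective h).symm)
    (fun h => hc.1 (τ.injective h).symm) (fun h => hbc (τ.injective h))).1] at e2
  exact hb.1 (τ.injective e2)

theorem conjNormal_coe (s : alternatingGroup (Fin n)) :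
    (MulAut.conjNormal (s : Perm (Fin n)) : MulAut (alternatingGroup (Fin n))) = MulAut.conj s := by
  ext1 g
  rfl

theorem ext_char (hn : 5 ≤ n) (h6 : n ≠ 6) {V : Type} [AddCommGroup V] [Module ℂ V]
    [FiniteDimensional ℂ V] (ρ : Representation ℂ (Perm (Fin n)) V)
    (α : FDRep ℂ (alternatingGroup (Fin n)))
    (hα : ∀ s : alternatingGroup (Fin n), α.character s = LinearMap.trace ℂ V (ρ (s : Perm (Fin n)))) :
    ∃ A : FDRep ℂ (MulAut (alternatingGroup (Fin n))), ∀ s : alternatingGroup (Fin n),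
        A.character (MulAut.conj s) = α.character s := by
  let E : Perm (Fin n) ≃* MulAut (alternatingGroup (Fin n)) :=
    MulEquiv.ofBijective MulAut.conjNormal ⟨conjNormal_inj hn, fun φ => by
      obtain ⟨σ, hσ⟩ := conj_of_three hn φ (preserve hn h6 φ)
      exact ⟨σ, hσ.symm⟩⟩
  refine ⟨FDRep.of (ρ.comp E.symm.toMonoidHom), fun s => ?_⟩
  rw [hα]
  have : E.symm (MulAut.conj s) = s := by
    rw [MulEquiv.symm_apply_eq, ← conjNormal_coe]
    rfl
  rw [← this]
  rfl

/-- Order-three elements of the alternating group on six letters that are not three-cycles are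
conjugate. -/
theorem dbl_conj (x : alternatingGroup (Fin 6))
    (hx : ∀ i, (x : Perm (Fin 6)) ((x : Perm (Fin 6)) ((x : Perm (Fin 6)) i)) = i)
    (h1 : (x : Perm (Fin 6)) ≠ 1) (h3 : ¬ IsThreeCycle (x : Perm (Fin 6))) :
    ∃ g : alternatingGroup (Fin 6), (g : Perm (Fin 6)) * (cyc 0 1 2 * cyc 3 4 5) * (g : Perm (Fin 6))⁻¹ =
      (x : Perm (Fin 6)) := by
  obtain ⟨p, q, hp, hq, q0, q1, q2⟩ := six_pts hx h1 h3
  generalize (x : Perm (Fin 6)) = y at *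
  obtain ⟨a1, a2, a3⟩ := orb_self hx hp
  obtain ⟨b1, b2, b3⟩ := orb_self hx hq
  obtain ⟨⟨c1, c2, c3⟩, ⟨c4, c5, c6⟩, c7, c8, c9⟩ := orb_ne hx q0 q1 q2
  have he : Function.Injective ![p, y p, y (y p), q, y q, y (y q)] := by
    rw [← List.nodup_ofFn]
    simp [List.ofFn_succ, a1, a2, a3, b1, b2, b3, c1, c2, c3, c4, c5, c6, c7, c8, c9]
  let e : Perm (Fin 6) := Equiv.ofBijective _ (Finite.injective_iff_bijective.1 he)
  have hs : ∀ i, y (e i) = e ((cyc 0 1 2 * cyc 3 4 5 : Perm (Fin 6)) i) := by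
    intro i
    fin_cases i
    · rfl
    · rfl
    · exact hx p
    · rfl
    · rfl
    · exact hx q
  have hs' : e * (cyc 0 1 2 * cyc 3 4 5) * e⁻¹ = y := by
    rw [mul_inv_eq_iff_eq_mul]
    ext1 i
    exact (hs i).symm
  rcases Int.units_eq_one_or (sign e) with h | h
  · exact ⟨⟨e, h⟩, hs'⟩
  · let w : Perm (Fin 6) := swap 0 3 * swap 1 4 * swap 2 5
    have hw : sign w = -1 := by decide +kernel
    have hw' : w * (cyc 0 1 2 * cyc 3 4 5) * w⁻¹ = cyc 0 1 2 * cyc 3 4 5 := by decide +kernel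
    refine ⟨⟨e * w, ?_⟩, ?_⟩
    · rw [mem_alternatingGroup, map_mul, h, hw]; rfl
    · change e * w * _ * (e * w)⁻¹ = y
      rw [← hs']
      nth_rewrite 2 [← hw']
      group

theorem cube_one {n : ℕ} {g : alternatingGroup (Fin n)} (hg : IsThreeCycle (g : Perm (Fin n))) :
    g ^ 3 = 1 := by
  apply Subtype.ext
  change (g : Perm (Fin n)) ^ 3 = 1
  rw [← hg.orderOf]; exact pow_orderOf_eq_one _

theorem cube_pt {g : alternatingGroup (Fin n)} (hg : g ^ 3 = 1) (i : Fin n) :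
    (g : Perm (Fin n)) ((g : Perm (Fin n)) ((g : Perm (Fin n)) i)) = i := by
  have := congrArg (fun u : alternatingGroup (Fin n) => (u : Perm (Fin n)) i) hg
  simpa [pow_succ] using this

theorem sq_preserve (φ : MulAut (alternatingGroup (Fin 6)))
    (g : alternatingGroup (Fin 6)) (hg : IsThreeCycle (g : Perm (Fin 6))) :
    IsThreeCycle ((φ * φ) g : Perm (Fin 6)) := by
  have g1 : g ≠ 1 := by
    rintro rfl
    exact absurd hg.isCycle.ne_one (by simp)
  have g3 := cube_one hg
  have tc_conj : ∀ a b : alternatingGroup (Fin 6), IsConj a b → IsThreeCycle (a : Perm (Fin 6)) →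
      IsThreeCycle (b : Perm (Fin 6)) := by
    intro a b hab ha
    obtain ⟨c, rfl⟩ := isConj_iff.1 hab
    have : IsThreeCycle ((c : Perm (Fin 6)) * (a : Perm (Fin 6)) * (c : Perm (Fin 6))⁻¹) := by
      rw [IsThreeCycle, cycleType_conj]; exact ha
    exact this
  have map_conj : ∀ (f : MulAut (alternatingGroup (Fin 6))) (a b : alternatingGroup (Fin 6)), IsConj a b →
      IsConj (f a) (f b) := fun f a b h => f.toMonoidHom.map_isConj h
  change IsThreeCycle (φ (φ g) : Perm (Fin 6))
  by_cases h : IsThreeCycle (φ g : Perm (Fin 6))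
  · exact tc_conj _ _ (map_conj φ _ _ (alternatingGroup.isThreeCycle_isConj (by simp) hg h)) h
  · by_contra h'
    have f1 : φ g ≠ 1 := by simpa using g1
    have f1' : φ (φ g) ≠ 1 := by simpa using g1
    have f3 : (φ g) ^ 3 = 1 := by rw [← map_pow, g3, map_one]
    have f3' : (φ (φ g)) ^ 3 = 1 := by rw [← map_pow, f3, map_one]
    obtain ⟨a, ha⟩ := dbl_conj (φ g) (cube_pt f3) (fun h => f1 (Subtype.ext h)) h
    obtain ⟨b, hb⟩ := dbl_conj (φ (φ g)) (cube_pt f3') (fun h => f1' (Subtype.ext h)) h'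
    have hc : IsConj (φ g) (φ (φ g)) := by
      rw [isConj_iff]
      refine ⟨b * a⁻¹, Subtype.ext ?_⟩
      rw [← hb]
      change ((b : Perm (Fin 6)) * (a : Perm (Fin 6))⁻¹) * (φ g : Perm (Fin 6)) * ((b : Perm (Fin 6)) * (a : Perm (Fin 6))⁻¹)⁻¹ = _
      rw [← ha]
      group
    have := map_conj φ⁻¹ _ _ hc
    simp only [MulAut.inv_apply_self] at this
    exact h (tc_conj _ _ this hg)

theorem sq_conj (hn : 5 ≤ n) (φ : MulAut (alternatingGroup (Fin n))) :
    ∃ σ : Perm (Fin n), φ * φ = MulAut.conjNormal σ := by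
  apply conj_of_three hn
  by_cases h6 : n = 6
  · subst h6; exact sq_preserve φ
  · exact preserve hn h6 _

theorem odd_inner (hn : 5 ≤ n) {p : ℕ} (hp : p.Prime) (hp3 : 3 < p)
    (β : FDRep ℂ (alternatingGroup (Fin n))) (φ : MulAut (alternatingGroup (Fin n)))
    (hk : ∃ k : ℕ, orderOf φ = p ^ k) (s : alternatingGroup (Fin n)) :
    β.character (φ s) = β.character s := by
  obtain ⟨k, hk⟩ := hk
  obtain ⟨σ, hσ⟩ := sq_conj hn φ
  have hodd : Odd (p ^ k) := (hp.odd_of_ne_two (by omega)).pow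
  generalize p ^ k = q at *
  have hφ : φ ^ q = 1 := by rw [← hk]; exact pow_orderOf_eq_one φ
  have hσ1 : σ ^ q = 1 := by
    apply conjNormal_inj hn
    rw [map_pow, ← hσ, map_one, ← pow_two, ← pow_mul, mul_comm, pow_mul, hφ, one_pow]
  have hsg : sign σ = 1 := by
    rcases Int.units_eq_one_or (sign σ) with h | h
    · exact h
    · have := congrArg sign hσ1
      rw [map_pow, h, hodd.neg_one_pow] at this
      rw [map_one] at this
      exact absurd this (by decide)
  obtain ⟨m, rfl⟩ := hodd
  have e : φ = MulAut.conj ((⟨σ, hsg⟩ : alternatingGroup (Fin n)) ^ (m + 1)) := by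
    rw [map_pow, ← conjNormal_coe]
    change φ = (MulAut.conjNormal σ) ^ (m + 1)
    rw [← hσ, ← pow_two, ← pow_mul, show 2 * (m + 1) = 2 * m + 1 + 1 by ring, pow_succ, hφ, one_mul]
  rw [e, MulAut.conj_apply, FDRep.char_conj]

end AutPart4


section SylowSix

open Equiv Equiv.Perm

set_option maxRecDepth 100000 in
theorem cent_a : ∀ g : Perm (Fin 6), g * cyc 0 1 2 = cyc 0 1 2 * g → sign g = 1 → g ^ 3 = 1 := by
  decide +kernel

set_option maxRecDepth 100000 in
theorem cent_b : ∀ g : Perm (Fin 6), g * (cyc 0 1 2 * cyc 3 4 5) = (cyc 0 1 2 * cyc 3 4 5) * g →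
    sign g = 1 → g ^ 3 = 1 := by
  decide +kernel

theorem cent_cube (x g : alternatingGroup (Fin 6)) (hx : x ^ 3 = 1) (h1 : x ≠ 1)
    (hc : g * x = x * g) : g ^ 3 = 1 := by
  have key : ∃ (c : alternatingGroup (Fin 6)) (y : Perm (Fin 6)),
      (c : Perm (Fin 6)) * y * (c : Perm (Fin 6))⁻¹ = x ∧
      (y = cyc 0 1 2 ∨ y = cyc 0 1 2 * cyc 3 4 5) := by
    by_cases h3 : IsThreeCycle (x : Perm (Fin 6))
    · have h012 : IsThreeCycle ((cycA (a := (0 : Fin 6)) (b := 1) (c := 2) (by decide) (by decide)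
        (by decide) : alternatingGroup (Fin 6)) : Perm (Fin 6)) :=
        cyc_three (by decide) (by decide) (by decide)
      obtain ⟨c, hc⟩ := isConj_iff.1 (alternatingGroup.isThreeCycle_isConj (by simp) h012 h3)
      refine ⟨c, cyc 0 1 2, ?_, Or.inl rfl⟩
      exact congrArg Subtype.val hc
    · obtain ⟨c, hc⟩ := dbl_conj x (cube_pt hx) (fun h => h1 (Subtype.ext h)) h3
      exact ⟨c, _, hc, Or.inr rfl⟩
  obtain ⟨c, y, hy, hy'⟩ := key
  have hc' : (g : Perm (Fin 6)) * x = x * (g : Perm (Fin 6)) := congrArg Subtype.val hc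
  have e : ((c : Perm (Fin 6))⁻¹ * (g : Perm (Fin 6)) * (c : Perm (Fin 6))) * y = y * ((c : Perm (Fin 6))⁻¹ * (g : Perm (Fin 6)) * (c : Perm (Fin 6))) := by
    rw [← hy] at hc'
    have := congrArg (fun u => (c : Perm (Fin 6))⁻¹ * u * (c : Perm (Fin 6))) hc'
    simp only [mul_assoc, inv_mul_cancel_left, inv_mul_cancel, mul_one] at this ⊢
    exact this
  have hs : sign ((c : Perm (Fin 6))⁻¹ * (g : Perm (Fin 6)) * (c : Perm (Fin 6))) = 1 := by
    have h1 : sign (c : Perm (Fin 6)) = 1 := c.2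
    have h2 : sign (g : Perm (Fin 6)) = 1 := g.2
    simp [h1, h2]
  have h3 : ((c : Perm (Fin 6))⁻¹ * (g : Perm (Fin 6)) * (c : Perm (Fin 6))) ^ 3 = 1 := by
    rcases hy' with rfl | rfl
    · exact cent_a _ e hs
    · exact cent_b _ e hs
  apply Subtype.ext
  change (g : Perm (Fin 6)) ^ 3 = 1
  have h4 : ((c : Perm (Fin 6))⁻¹ * (g : Perm (Fin 6)) * (c : Perm (Fin 6))) ^ 3 = (c : Perm (Fin 6))⁻¹ * (g : Perm (Fin 6)) ^ 3 * (c : Perm (Fin 6)) := by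
    simp [pow_succ, mul_assoc]
  rw [h4] at h3
  have := congrArg (fun u => (c : Perm (Fin 6)) * u * (c : Perm (Fin 6))⁻¹) h3
  simpa [mul_assoc] using this

/-- The alternating group on six letters. -/
abbrev A6 := alternatingGroup (Fin 6)

theorem card_A6 : Nat.card A6 = 360 := by
  rw [nat_card_alternatingGroup]
  simp [Nat.factorial]

instance fact3 : Fact (Nat.Prime 3) := ⟨Nat.prime_three⟩

theorem sylow_card (P : Sylow 3 A6) : Nat.card P = 9 := by
  rw [P.card_eq_multiplicity, card_A6, Nat.factorization_def _ Nat.prime_three]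
  have : padicValNat 3 360 = 2 := by
    rw [show 360 = 3 ^ 2 * 40 by norm_num, padicValNat.mul (by norm_num) (by norm_num),
      padicValNat.prime_pow, padicValNat.eq_zero_of_not_dvd (by norm_num)]
  rw [this]; norm_num

theorem sylow_comm (P : Sylow 3 A6) (a b : A6) (ha : a ∈ P) (hb : b ∈ P) : a * b = b * a := by
  have := IsPGroup.isMulCommutative_of_card_eq_prime_sq (p := 3) (G := P) (by rw [sylow_card]; norm_num)
  exact congrArg Subtype.val (this.is_comm.comm (⟨a, ha⟩ : P) ⟨b, hb⟩)

theorem sylow_eq_cent (P : Sylow 3 A6) (x : A6) (hx : x ∈ P) (h1 : x ≠ 1) :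
    (P : Subgroup A6) = Subgroup.centralizer {x} := by
  have hle : (P : Subgroup A6) ≤ Subgroup.centralizer {x} := by
    intro a ha
    rw [Subgroup.mem_centralizer_singleton_iff]
    exact sylow_comm P _ _ ha hx
  have h3 : x ^ 3 = 1 := by
    obtain ⟨k, hk⟩ := P.isPGroup' ⟨x, hx⟩
    have hk' : x ^ 3 ^ k = 1 := congrArg Subtype.val hk
    have hcard : x ^ 9 = 1 := by
      have h9 : Nat.card P = 9 := sylow_card P
      have := pow_card_eq_one' (x := (⟨x, hx⟩ : (P : Subgroup A6)))
      rw [h9] at this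
      exact congrArg Subtype.val this
    by_contra h
    -- x has order nine, x ^ 3 has order three and commutes with x
    have := cent_cube (x ^ 3) x (by rw [← pow_mul]; exact hcard) h (by rw [← pow_succ, ← pow_succ'])
    exact h this
  symm
  apply P.is_maximal' _ hle
  rintro ⟨g, hg⟩
  rw [Subgroup.mem_centralizer_singleton_iff] at hg
  exact ⟨1, Subtype.ext (cent_cube x g h3 h1 (by first | exact hg | exact hg.symm))⟩

theorem sylow_ti (P Q : Sylow 3 A6) (h : P ≠ Q) (x : A6) (hP : x ∈ P) (hQ : x ∈ Q) : x = 1 := by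
  by_contra h1
  apply h
  apply Sylow.ext
  rw [sylow_eq_cent P x hP h1, sylow_eq_cent Q x hQ h1]

/-- The other Sylow subgroups. -/
def others (P : Sylow 3 A6) : SubMulAction P (Sylow 3 A6) where
  carrier := {Q | Q ≠ P}
  smul_mem' g Q hQ h := by
    apply hQ
    have hg : (g : A6) • P = P := Sylow.smul_eq_iff_mem_normalizer.2 (Subgroup.le_normalizer g.2)
    have h' : (g : A6) • Q = (g : A6) • P := by rw [hg]; exact h
    exact smul_left_cancel _ h'

theorem others_stab (P : Sylow 3 A6) (Q : others P) : MulAction.stabilizer P Q = ⊥ := by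
  rw [Subgroup.eq_bot_iff_forall]
  intro g hg
  have hg' : (g : A6) • (Q : Sylow 3 A6) = Q := congrArg Subtype.val hg
  have hn := Sylow.smul_eq_iff_mem_normalizer.1 hg'
  have : (g : A6) ∈ (P : Subgroup A6) ⊓ Subgroup.normalizer (Q : Sylow 3 A6) := ⟨g.2, hn⟩
  rw [P.isPGroup'.inf_normalizer_sylow] at this
  exact Subtype.ext (sylow_ti P Q (Ne.symm Q.2) _ g.2 this.2)

theorem sylow_count (P : Sylow 3 A6) : Nat.card (Sylow 3 A6) = 10 ∧
    Nat.card (Quotient (MulAction.orbitRel P (others P))) = 1 := by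
  classical
  have e := Nat.card_congr (MulAction.selfEquivOrbitsQuotientProd (others_stab P))
  rw [Nat.card_prod, sylow_card] at e
  have hcard : Nat.card (Sylow 3 A6) = Nat.card (others P) + 1 := by
    have : Fintype (Sylow 3 A6) := Fintype.ofFinite _
    have h1 : Nat.card (others P) = (Finset.univ.erase P).card := by
      have h2 : Nat.card (others P) = Nat.card {Q : Sylow 3 A6 // Q ≠ P} := rfl
      rw [h2, Nat.subtype_card]
      intro Q
      simp
    rw [h1, Finset.card_erase_of_mem (Finset.mem_univ _), Finset.card_univ, Nat.card_eq_fintype_card]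
    have : 0 < Fintype.card (Sylow 3 A6) := Fintype.card_pos
    omega
  have hd := P.card_dvd_index
  have hi : (P : Subgroup A6).index = 40 := by
    have := (P : Subgroup A6).card_mul_index
    have h9 : Nat.card (P : Subgroup A6) = 9 := sylow_card P
    rw [card_A6, h9] at this
    omega
  rw [hi, hcard, e] at hd
  rw [hcard, e]
  generalize hm : Nat.card (Quotient (MulAction.orbitRel P (others P))) = m at *
  have hm4 : m ≤ 4 := by
    have := Nat.le_of_dvd (by norm_num) hd
    omega
  have hm0 : m ≠ 0 := by
    rintro rfl
    rw [e] at hcard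
    have hs : IsSimpleGroup A6 := alternatingGroup.isSimpleGroup (by simp)
    have : Subsingleton (Sylow 3 A6) := (Nat.card_eq_one_iff_unique.1 (by simpa using hcard)).1
    have hN : (P : Subgroup A6).Normal := P.normal_of_subsingleton
    have h9 : Nat.card (P : Subgroup A6) = 9 := sylow_card P
    rcases hN.eq_bot_or_eq_top with h | h
    · rw [h] at h9; simp at h9
    · rw [h, Subgroup.card_top, card_A6] at h9; omega
  interval_cases m <;> simp_all

theorem sylow_two_trans (P Q R : Sylow 3 A6) (hQ : Q ≠ P) (hR : R ≠ P) :
    ∃ g : A6, g • P = P ∧ g • Q = R := by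
  have hs := (Nat.card_eq_one_iff_unique.1 (sylow_count P).2).1
  have := Quotient.exact (hs.elim (Quotient.mk (MulAction.orbitRel P (others P)) (⟨R, hR⟩ : others P))
    (Quotient.mk (MulAction.orbitRel P (others P)) (⟨Q, hQ⟩ : others P)))
  obtain ⟨g, hg⟩ := this
  exact ⟨g, Sylow.smul_eq_iff_mem_normalizer.2 (Subgroup.le_normalizer g.2), congrArg Subtype.val hg⟩

end SylowSix


section Final

open Equiv Equiv.Perm

theorem beta_of {n : ℕ} (hn : 5 ≤ n) (I : Type) [Fintype I] [MulAction (Perm (Fin n)) I]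
    (W : Submodule ℂ (I → ℂ)) (hs : Stab (fnRep (Perm (Fin n)) I) W)
    (hi : Irr (fnRep (Perm (Fin n)) I) W) :
    ∃ β : FDRep ℂ (alternatingGroup (Fin n)), Simple β ∧
      (Module.finrank ℂ β = Module.finrank ℂ W ∨ 2 * Module.finrank ℂ β = Module.finrank ℂ W) := by
  let t : Perm (Fin n) := swap ⟨0, by omega⟩ ⟨1, by omega⟩
  have hts : sign t = -1 := sign_swap (by simp)
  have ht : ∀ g, g ∈ alternatingGroup (Fin n) ∨ ∃ m ∈ alternatingGroup (Fin n), g = t * m := by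
    intro g
    rcases Int.units_eq_one_or (sign g) with h | h
    · exact Or.inl h
    · right
      refine ⟨t⁻¹ * g, ?_, by simp⟩
      rw [mem_alternatingGroup]
      simp [hts, h]
  obtain ⟨U, hU, hUi, hd⟩ := descent _ (alternatingGroup (Fin n)) t ht W hs hi
  exact ⟨_, simple_of_irr _ U hU hUi, hd⟩

theorem dim_WB_one (m : ℕ) : 2 * Module.finrank ℂ (WB (m + 5) 1) = (m + 5) * (m + 2) := by
  have h := finrank_WB_one (n := m + 5) (by omega)
  have : (2 * Module.finrank ℂ (WB (m + 5) 1) : ℂ) = (m + 5) * (m + 2) := by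
    rw [h]; push_cast; ring
  exact_mod_cast this

theorem dim_WB_neg (m : ℕ) : 2 * Module.finrank ℂ (WB (m + 5) (-1)) = (m + 4) * (m + 3) := by
  have h := finrank_WB_neg (n := m + 5) (by omega)
  have : (2 * Module.finrank ℂ (WB (m + 5) (-1)) : ℂ) = (m + 4) * (m + 3) := by
    rw [h]; push_cast; ring
  exact_mod_cast this

theorem dim_WD (m : ℕ) : 3 * Module.finrank ℂ (WD (m + 5)) = (m + 5) * (m + 3) * (m + 1) := by
  have h := finrank_WD (n := m + 5) (by omega)
  have : (3 * Module.finrank ℂ (WD (m + 5)) : ℂ) = (m + 5) * (m + 3) * (m + 1) := by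
    rw [h]; push_cast; ring
  exact_mod_cast this

theorem not_dvd_add {p a k : ℕ} (hp3 : 3 < p) (hk : 0 < k) (hk3 : k ≤ 3) (h : p ∣ a) :
    ¬ p ∣ a + k := by
  intro h'
  have := Nat.le_of_dvd hk ((Nat.dvd_add_right h).1 h')
  omega

theorem not_dvd_add' {p a k : ℕ} (hp3 : 3 < p) (hk : 0 < k) (hk3 : k ≤ 3) (h : p ∣ a + k) :
    ¬ p ∣ a := fun h' => not_dvd_add hp3 hk hk3 h' h

theorem alpha_std {n : ℕ} (hn : 5 ≤ n) (h6 : n ≠ 6) :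
    ∃ α : FDRep ℂ (alternatingGroup (Fin n)), Simple α ∧ Module.finrank ℂ α + 1 = n ∧
      ∃ A : FDRep ℂ (MulAut (alternatingGroup (Fin n))), ∀ s : alternatingGroup (Fin n),
        A.character (MulAut.conj s) = α.character s := by
  have hne : Nonempty (Fin n) := ⟨⟨0, by omega⟩⟩
  have hst := sumZero_stab (alternatingGroup (Fin n)) (Fin n)
  have hirr : Irr (fnRep (alternatingGroup (Fin n)) (Fin n)) (sumZero (Fin n)) := by
    apply sumZero_irr
    · simp; omega
    · intro o x y hx hy
      obtain ⟨g, hg⟩ := alt_trans (k := 2) (by omega) ![o, x] ![o, y]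
        (by intro i j; fin_cases i <;> fin_cases j <;> simp [hx, Ne.symm hx])
        (by intro i j; fin_cases i <;> fin_cases j <;> simp [hy, Ne.symm hy])
      exact ⟨g, hg 0, hg 1⟩
    · intro x y
      obtain ⟨g, hg⟩ := alt_trans (k := 1) (by omega) ![x] ![y]
        (Function.injective_of_subsingleton _) (Function.injective_of_subsingleton _)
      exact ⟨g, hg 0⟩
  refine ⟨_, simple_of_irr _ _ hst hirr, ?_, ?_⟩
  · rw [finrank_of, finrank_sumZero]; simp
  · exact ext_char hn h6 (subRep (fnRep (Perm (Fin n)) (Fin n)) (sumZero (Fin n))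
      (sumZero_stab _ _)) _ (fun s => rfl)

theorem alpha_two {n : ℕ} (hn : 6 ≤ n) :
    ∃ α : FDRep ℂ (alternatingGroup (Fin n)), Simple α ∧
      Module.finrank ℂ α = Module.finrank ℂ (WB n 1) ∧ (n ≠ 6 →
      ∃ A : FDRep ℂ (MulAut (alternatingGroup (Fin n))), ∀ s : alternatingGroup (Fin n),
        A.character (MulAut.conj s) = α.character s) := by
  refine ⟨_, simple_of_irr _ _ (WB_stab (alternatingGroup (Fin n)) 1) (WB_one_irr hn),
    finrank_of _ _ _, fun h6 => ?_⟩
  exact ext_char (by omega) h6 (subRep (fnRep (Perm (Fin n)) (Fin n × Fin n)) (WB n 1)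
      (WB_stab _ _)) _ (fun s => rfl)

theorem alpha_six :
    ∃ α : FDRep ℂ (alternatingGroup (Fin 6)), Simple α ∧ Module.finrank ℂ α = 9 ∧
      ∃ A : FDRep ℂ (MulAut (alternatingGroup (Fin 6))), ∀ s : alternatingGroup (Fin 6),
        A.character (MulAut.conj s) = α.character s := by
  have hfin : Fintype (Sylow 3 A6) := Fintype.ofFinite _
  obtain ⟨P⟩ : Nonempty (Sylow 3 A6) := inferInstance
  have hc : Fintype.card (Sylow 3 A6) = 10 := by
    rw [← Nat.card_eq_fintype_card]; exact (sylow_count P).1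
  have hst := sumZero_stab A6 (Sylow 3 A6)
  have hirr : Irr (fnRep A6 (Sylow 3 A6)) (sumZero (Sylow 3 A6)) := by
    apply sumZero_irr
    · omega
    · intro o x y hx hy
      exact sylow_two_trans o x y hx hy
    · intro x y
      exact MulAction.exists_smul_eq A6 x y
  refine ⟨_, simple_of_irr _ _ hst hirr, ?_, ?_⟩
  · have := finrank_sumZero (Sylow 3 A6)
    rw [finrank_of]; omega
  · exact ⟨FDRep.of (subRep (fnRep (MulAut A6) (Sylow 3 A6)) (sumZero (Sylow 3 A6))
      (sumZero_stab _ _)), fun s => rfl⟩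

end Final

theorem stmt3 (n : ℕ) (hn : 5 ≤ n) (p : ℕ) (hp : p.Prime) (hp3 : 3 < p) :
    ∃ α β : FDRep ℂ (alternatingGroup (Fin n)), Simple α ∧ Simple β ∧
      1 < Module.finrank ℂ α ∧ 1 < Module.finrank ℂ β ∧
      ¬ p ∣ Module.finrank ℂ α ∧ ¬ p ∣ Module.finrank ℂ β ∧
      ¬ (Module.finrank ℂ β ∣ Module.finrank ℂ α) ∧
      (∃ A : FDRep ℂ (MulAut (alternatingGroup (Fin n))), ∀ s : alternatingGroup (Fin n),
        A.character (MulAut.conj s) = α.character s) ∧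
      (∀ φ : MulAut (alternatingGroup (Fin n)), (∃ k : ℕ, orderOf φ = p ^ k) →
        ∀ s : alternatingGroup (Fin n), β.character (φ s) = β.character s) := by
  by_cases h6 : n = 6
  · subst h6
    obtain ⟨α, hα, hda, hA⟩ := alpha_six
    obtain ⟨β, hβ, hdb⟩ := beta_of hn _ _ (WD_stab _) (WD_irr hn)
    have hW' : Module.finrank ℂ (WD 6) = 16 := by
      have h48 : 3 * Module.finrank ℂ (WD 6) = 48 := dim_WD 1
      omega
    rw [hW'] at hdb
    have hb : Module.finrank ℂ β = 16 ∨ Module.finrank ℂ β = 8 := by omega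
    have hp2 : ∀ k : ℕ, ¬ p ∣ 2 ^ k := by
      intro k h
      have := Nat.le_of_dvd (by norm_num) (hp.dvd_of_dvd_pow h)
      omega
    refine ⟨α, β, hα, hβ, by rw [hda]; norm_num, ?_, ?_, ?_, ?_, hA, odd_inner hn hp hp3 β⟩
    · rcases hb with h | h <;> rw [h] <;> norm_num
    · rw [hda]
      intro h
      have := Nat.le_of_dvd (by norm_num) (hp.dvd_of_dvd_pow (show p ∣ 3 ^ 2 from h))
      omega
    · rcases hb with h | h <;> rw [h]
      · exact hp2 4
      · exact hp2 3
    · rw [hda]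
      rcases hb with h | h <;> rw [h] <;> norm_num
  obtain ⟨m, rfl⟩ : ∃ m, n = m + 5 := ⟨n - 5, by omega⟩
  have hW1 := dim_WB_one m
  have hWn := dim_WB_neg m
  have hWD := dim_WD m
  by_cases h1 : p ∣ m + 4
  · have hm : 3 ≤ m := by
      by_contra hlt
      have : m = 0 ∨ m = 2 := by omega
      have := Nat.le_of_dvd (by omega) h1
      have h5 : p ≠ 4 := by rintro rfl; revert hp; norm_num
      have h5 : p ≠ 6 := by rintro rfl; revert hp; norm_num
      rcases ‹m = 0 ∨ m = 2› with rfl | rfl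
      · omega
      · have : p = 5 := by omega
        subst this
        omega
    obtain ⟨α, hα, hda, hA⟩ := alpha_two (n := m + 5) (by omega)
    obtain ⟨β, hβ, hdb⟩ := beta_of hn _ _ (WD_stab _) (WD_irr hn)
    rw [← hda] at hW1
    have h5 : ¬ p ∣ m + 5 := not_dvd_add (a := m + 4) (k := 1) hp3 (by omega) (by omega) h1
    have h3 : ¬ p ∣ m + 3 := not_dvd_add' (k := 1) hp3 (by omega) (by omega) h1
    have h2 : ¬ p ∣ m + 2 := not_dvd_add' (k := 2) hp3 (by omega) (by omega) h1
    have h0 : ¬ p ∣ m + 1 := not_dvd_add' (k := 3) hp3 (by omega) (by omega) h1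
    have hla : 1 < Module.finrank ℂ α := by nlinarith
    have hlt : Module.finrank ℂ α < Module.finrank ℂ β := by
      have e1 : 3 * Module.finrank ℂ (WD (m + 5)) ≤ 6 * Module.finrank ℂ β := by omega
      rw [hWD] at e1
      have e2 : 3 * (m + 2) < (m + 3) * (m + 1) := by nlinarith
      have e3 := Nat.mul_lt_mul_of_pos_left e2 (show 0 < m + 5 by omega)
      have e4 : (m + 5) * (3 * (m + 2)) = 6 * Module.finrank ℂ α := by
        calc _ = 3 * ((m + 5) * (m + 2)) := by ring
          _ = _ := by rw [← hW1]; ring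
      have e5 : (m + 5) * ((m + 3) * (m + 1)) = (m + 5) * (m + 3) * (m + 1) := by ring
      omega
    refine ⟨α, β, hα, hβ, hla, by omega, ?_, ?_, ?_, hA h6, odd_inner hn hp hp3 β⟩
    · intro h
      have := h.mul_left 2
      rw [hW1, hp.dvd_mul] at this
      tauto
    · intro h
      have h' : p ∣ Module.finrank ℂ (WD (m + 5)) := by
        rcases hdb with e | e
        · rwa [← e]
        · rw [← e]; exact h.mul_left 2
      have := h'.mul_left 3
      rw [hWD, hp.dvd_mul, hp.dvd_mul] at this
      tauto
    · intro h
      have := Nat.le_of_dvd (by omega) h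
      omega
  obtain ⟨α, hα, hda, hA⟩ := alpha_std hn h6
  have hda' : Module.finrank ℂ α = m + 4 := by omega
  by_cases h2 : p ∣ m + 3
  · have hm : 2 ≤ m := by
      by_contra hlt
      have := Nat.le_of_dvd (by omega) h2
      omega
    obtain ⟨β, hβ, hdb, -⟩ := alpha_two (n := m + 5) (by omega)
    rw [← hdb] at hW1
    have hlt : m + 4 < Module.finrank ℂ β := by nlinarith
    refine ⟨α, β, hα, hβ, by omega, by omega, by rwa [hda'], ?_, ?_, hA, odd_inner hn hp hp3 β⟩
    · intro h
      have h5 : ¬ p ∣ m + 5 := not_dvd_add (a := m + 3) (k := 2) hp3 (by omega) (by omega) h2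
      have h0 : ¬ p ∣ m + 2 := not_dvd_add' (k := 1) hp3 (by omega) (by omega) h2
      have := h.mul_left 2
      rw [hW1, hp.dvd_mul] at this
      tauto
    · intro h
      have := Nat.le_of_dvd (by omega) h
      omega
  · obtain ⟨β, hβ, hdb⟩ := beta_of hn _ _ (WB_stab _ _) (WB_neg_irr hn)
    have hlb : (m + 4) * (m + 3) ≤ 4 * Module.finrank ℂ β := by omega
    refine ⟨α, β, hα, hβ, by omega, by nlinarith, by rwa [hda'], ?_, ?_, hA,
      odd_inner hn hp hp3 β⟩
    · intro h
      have h' : p ∣ Module.finrank ℂ (WB (m + 5) (-1)) := by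
        rcases hdb with e | e
        · rwa [← e]
        · rw [← e]; exact h.mul_left 2
      have := h'.mul_left 2
      rw [hWn, hp.dvd_mul] at this
      tauto
    · rw [hda']
      rcases Nat.eq_zero_or_pos m with rfl | hm
      · norm_num at hWn
        have : Module.finrank ℂ β = 6 ∨ Module.finrank ℂ β = 3 := by omega
        rcases this with h | h <;> rw [h] <;> norm_num
      · intro h
        have := Nat.le_of_dvd (by omega) h
        nlinarith [show 2 ≤ m by omega]
end

section
/- Let n ≥ 1 be a natural number and p a prime. Then the number of elements of cd^{ext}_{p'}(A_n) is at least ⌊ N/2 ⌋, where N is the number of integers x with 0 ≤ x ≤ n−1 such that p does not divide the binomial coefficient C(n−1, x). -/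
open CategoryTheory

/-- `cd^{ext}_{p'}(A_n)`: the set of degrees `d` not divisible by `p` of irreducible complex
characters of the alternating group `A_n` that extend to (i.e. are restrictions of characters
of) the symmetric group `S_n`. -/
def cdExtp' (n p : ℕ) : Set ℕ :=
  {d : ℕ | ¬ p ∣ d ∧ ∃ V : FDRep ℂ (alternatingGroup (Fin n)), Simple V ∧
    Module.finrank ℂ V = d ∧
    ∃ W : FDRep ℂ (Equiv.Perm (Fin n)),
      ∀ g : alternatingGroup (Fin n), W.character (g : Equiv.Perm (Fin n)) = V.character g}
lemma aux_range {n k : ℕ} (x y : Fin k → Fin n) (hx : Function.Injective x)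
    (hy : Function.Injective y) (h : ∀ i, ∃ j, x j = y i) :
    ∃ σ : Equiv.Perm (Fin k), y = x ∘ σ := by
  choose s hs using h
  have hinj : Function.Injective s := fun a b hab => hy (by rw [← hs a, ← hs b, hab])
  exact ⟨Equiv.ofBijective s (Finite.injective_iff_bijective.mp hinj), by ext i; simp [hs]⟩

lemma aux_trans {n m : ℕ} (hm : m + 2 ≤ n) (x z : Fin m → Fin n) (hx : Function.Injective x)
    (hz : Function.Injective z) :
    ∃ g : Equiv.Perm (Fin n), Equiv.Perm.sign g = 1 ∧ g ∘ x = z := by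
  have h1 := alternatingGroup.isMultiplyPretransitive (Fin n)
  have h2 : MulAction.IsMultiplyPretransitive (alternatingGroup (Fin n)) (Fin n) m := by
    refine MulAction.isMultiplyPretransitive_of_le (n := Nat.card (Fin n) - 2) ?_ ?_
    · simp; omega
    · simp 
  obtain ⟨g, hg⟩ := h2.exists_smul_eq ⟨x, hx⟩ ⟨z, hz⟩
  refine ⟨g, Equiv.Perm.mem_alternatingGroup.mp g.2, ?_⟩
  ext i
  have := DFunLike.congr_fun hg i
  exact congrArg Fin.val this

lemma aux_core {n k : ℕ} (hk : 1 ≤ k) (h : 2 * k + 2 ≤ n)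
    (B : (Fin k → Fin n) → (Fin k → Fin n) → ℂ)
    (hL : ∀ y x (σ : Equiv.Perm (Fin k)), B (y ∘ σ) x = Equiv.Perm.sign σ • B y x)
    (hR : ∀ y x (σ : Equiv.Perm (Fin k)), B y (x ∘ σ) = Equiv.Perm.sign σ • B y x)
    (hG : ∀ y x (g : Equiv.Perm (Fin n)), Equiv.Perm.sign g = 1 → B (g ∘ y) (g ∘ x) = B y x)
    (x0 : Fin k → Fin n) (hx0 : Function.Injective x0) (c0 : Fin n) (hc0 : ∀ i, x0 i ≠ c0)
    (i0 : Fin k) (h0 : B x0 x0 = 0) (h1 : B (Function.update x0 i0 c0) x0 = 0)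
    (x y : Fin k → Fin n) (hx : Function.Injective x) (hy : Function.Injective y) :
    B y x = 0 := by
  classical
  set X := Finset.univ.image x with hX
  set Y := Finset.univ.image y with hY
  have cX : X.card = k := by simp [hX, Finset.card_image_of_injective _ hx]
  have cY : Y.card = k := by simp [hY, Finset.card_image_of_injective _ hy]
  rcases lt_or_ge 1 (X \ Y).card with h2 | h2
  · obtain ⟨a, ha, b, hb, hab⟩ := Finset.one_lt_card.mp h2
    have h3 : 1 < ((X ∪ Y)ᶜ).card := by
      rw [Finset.card_compl, Fintype.card_fin]
      have := Finset.card_union_le X Y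
      omega
    obtain ⟨c, hc, d, hd, hcd⟩ := Finset.one_lt_card.mp h3
    simp only [hX, hY, Finset.mem_sdiff, Finset.mem_image, Finset.mem_univ, true_and, not_exists,
      Finset.mem_compl, Finset.mem_union, not_or] at ha hb hc hd
    obtain ⟨⟨i, rfl⟩, ha⟩ := ha
    obtain ⟨⟨j, rfl⟩, hb⟩ := hb
    have hij : i ≠ j := fun e => hab (by rw [e])
    have key := hG y x (Equiv.swap (x i) (x j) * Equiv.swap c d)
      (by simp [Equiv.Perm.sign_swap hab, Equiv.Perm.sign_swap hcd])
    have e1 : (Equiv.swap (x i) (x j) * Equiv.swap c d) ∘ y = y := by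
      funext l
      simp only [Function.comp, Equiv.Perm.mul_apply]
      rw [Equiv.swap_apply_of_ne_of_ne (hc.2 l) (hd.2 l),
        Equiv.swap_apply_of_ne_of_ne (ha l) (hb l)]
    have e2 : (Equiv.swap (x i) (x j) * Equiv.swap c d) ∘ x = x ∘ Equiv.swap i j := by
      funext l
      simp only [Function.comp, Equiv.Perm.mul_apply]
      rw [Equiv.swap_apply_of_ne_of_ne (hc.1 l) (hd.1 l), hx.swap_apply]
    rw [e1, e2, hR, Equiv.Perm.sign_swap hij] at key
    simp only [Units.neg_smul, one_smul] at key
    exact self_eq_neg.mp key.symm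
  rcases Nat.lt_or_ge (X \ Y).card 1 with h3 | h3
  · have h4 : X \ Y = ∅ := Finset.card_eq_zero.mp (by omega)
    have h5 : X = Y := Finset.eq_of_subset_of_card_le (Finset.sdiff_eq_empty_iff_subset.mp h4)
      (by omega)
    obtain ⟨σ, rfl⟩ := aux_range x y hx hy (fun i => by
      have : y i ∈ X := by rw [h5, hY]; simp
      simpa [hX] using this)
    obtain ⟨g, hg, rfl⟩ := aux_trans (by omega) x x0 hx hx0
    rw [hL, ← hG x x g hg, h0, smul_zero]
  · have h4 : (Y \ X).card = 1 := by
      have := Finset.card_sdiff_add_card_inter X Y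
      have := Finset.card_sdiff_add_card_inter Y X
      rw [Finset.inter_comm] at this
      omega
    obtain ⟨a, ha⟩ := Finset.card_eq_one.mp (le_antisymm h2 h3)
    obtain ⟨c, hc⟩ := Finset.card_eq_one.mp h4
    have ha' : a ∈ X \ Y := by rw [ha]; simp
    have hc' : c ∈ Y \ X := by rw [hc]; simp
    simp only [hX, hY, Finset.mem_sdiff, Finset.mem_image, Finset.mem_univ, true_and,
      not_exists] at ha' hc'
    obtain ⟨⟨i, rfl⟩, ha2⟩ := ha'
    obtain ⟨hc1, hc2⟩ := hc'
    -- reorder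
    set x' := x ∘ Equiv.swap i i0 with hx'
    have hx'i : Function.Injective x' := hx.comp (Equiv.injective _)
    have hcx' : ∀ l, x' l ≠ c := fun l => hc2 _
    have hx'0 : x' i0 = x i := by simp [hx']
    have hui : ∀ (z : Fin k → Fin n) (e : Fin n), Function.Injective z → (∀ l, z l ≠ e) →
        Function.Injective (Function.update z i0 e) := by
      intro z e hz he l m hlm
      by_cases hl : l = i0 <;> by_cases hm : m = i0
      · rw [hl, hm]
      · subst hl; simp [Function.update_of_ne hm] at hlm; exact absurd hlm.symm (he m)
      · subst hm; simp [Function.update_of_ne hl] at hlm; exact absurd hlm (he l)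
      · rw [Function.update_of_ne hl, Function.update_of_ne hm] at hlm; exact hz hlm
    obtain ⟨σ, hσ⟩ := aux_range (Function.update x' i0 c) y (hui x' c hx'i hcx') hy (fun l => by
      by_cases hl : y l = c
      · exact ⟨i0, by simp [hl]⟩
      · have : y l ∈ X := by
          by_contra hcon
          have : y l ∈ Y \ X := by
            rw [Finset.mem_sdiff]; exact ⟨by simp [hY], hcon⟩
          rw [hc] at this
          exact hl (by simpa using this)
        simp only [hX, Finset.mem_image, Finset.mem_univ, true_and] at this
        obtain ⟨m, hm⟩ := this
        have hmi : m ≠ i := fun e => ha2 l (by rw [← hm, e])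
        refine ⟨Equiv.swap i i0 m, ?_⟩
        rw [Function.update_of_ne, hx']
        · simp [hm]
        · intro e
          rw [Equiv.swap_apply_eq_iff] at e
          simp at e
          exact hmi e)
    have hfin : B (Function.update x' i0 c) x' = 0 := by
      obtain ⟨g, hg, hgx⟩ := aux_trans (by omega) (Fin.cons c x' : Fin (k+1) → Fin n)
        (Fin.cons c0 x0 : Fin (k+1) → Fin n)
        (Fin.cons_injective_iff.mpr ⟨by rintro ⟨l, hl⟩; exact hcx' l hl, hx'i⟩)
        (Fin.cons_injective_iff.mpr ⟨by rintro ⟨l, hl⟩; exact hc0 l hl, hx0⟩)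
      have g0 : g c = c0 := by simpa using congrFun hgx 0
      have g1 : g ∘ x' = x0 := by
        funext l
        simpa using congrFun hgx l.succ
      rw [← hG _ _ g hg, Function.comp_update, g0, g1, h1]
    have : x = x' ∘ Equiv.swap i i0 := by
      funext l; simp [hx']
    rw [hσ, hL, this, hR, hfin]
    simp

noncomputable def permA (n : ℕ) : Equiv.Perm (Fin n) →* ((Fin n → ℂ) →ₗ[ℂ] (Fin n → ℂ)) where
  toFun g := LinearMap.funLeft ℂ ℂ (g⁻¹ : Equiv.Perm (Fin n))
  map_one' := by ext; simp [LinearMap.funLeft_apply]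
  map_mul' a b := by
    apply LinearMap.ext; intro v; funext i
    simp [LinearMap.funLeft_apply]

lemma permA_apply {n : ℕ} (g : Equiv.Perm (Fin n)) (v : Fin n → ℂ) (i : Fin n) :
    permA n g v i = v (g⁻¹ i) := rfl

lemma permA_single {n : ℕ} (g : Equiv.Perm (Fin n)) (i : Fin n) :
    permA n g (Pi.basisFun ℂ (Fin n) i) = Pi.basisFun ℂ (Fin n) (g i) := by
  funext j
  simp only [permA_apply, Pi.basisFun_apply, Pi.single_apply]
  congr 1
  rw [Equiv.Perm.inv_eq_iff_eq, eq_comm]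

noncomputable def dualE (n k : ℕ) (y : Fin k → Fin n) : Module.Dual ℂ (⋀[ℂ]^k (Fin n → ℂ)) :=
  exteriorPower.alternatingMapToDual ℂ (Fin n → ℂ) k (fun i => (Pi.basisFun ℂ (Fin n)).coord (y i))

noncomputable def vecE (n k : ℕ) (x : Fin k → Fin n) : ⋀[ℂ]^k (Fin n → ℂ) :=
  exteriorPower.ιMulti ℂ k (fun i => Pi.basisFun ℂ (Fin n) (x i))

lemma dualE_perm {n k : ℕ} (y : Fin k → Fin n) (σ : Equiv.Perm (Fin k)) :
    dualE n k (y ∘ σ) = Equiv.Perm.sign σ • dualE n k y :=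
  AlternatingMap.map_perm _ (fun i => (Pi.basisFun ℂ (Fin n)).coord (y i)) σ

lemma vecE_perm {n k : ℕ} (x : Fin k → Fin n) (σ : Equiv.Perm (Fin k)) :
    vecE n k (x ∘ σ) = Equiv.Perm.sign σ • vecE n k x :=
  AlternatingMap.map_perm _ (fun i => Pi.basisFun ℂ (Fin n) (x i)) σ

lemma vecE_map {n k : ℕ} (x : Fin k → Fin n) (g : Equiv.Perm (Fin n)) :
    exteriorPower.map k (permA n g) (vecE n k x) = vecE n k (g ∘ x) := by
  rw [vecE, vecE, exteriorPower.map_apply_ιMulti]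
  congr 1
  funext i
  exact permA_single g (x i)

lemma dualE_map {n k : ℕ} (y : Fin k → Fin n) (g : Equiv.Perm (Fin n))
    (w : ⋀[ℂ]^k (Fin n → ℂ)) :
    dualE n k (g ∘ y) (exteriorPower.map k (permA n g) w) = dualE n k y w := by
  have : dualE n k (g ∘ y) ∘ₗ exteriorPower.map k (permA n g) = dualE n k y := by
    apply exteriorPower.linearMap_ext
    ext v
    simp [dualE, exteriorPower.map_apply_ιMulti, permA_apply]
  exact LinearMap.congr_fun this w

lemma comm_zero {n k : ℕ} (hk : 1 ≤ k) (h : 2 * k + 2 ≤ n)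
    (x0 : Fin k → Fin n) (hx0 : Function.Injective x0) (c0 : Fin n) (hc0 : ∀ i, x0 i ≠ c0)
    (i0 : Fin k)
    (ψ : ⋀[ℂ]^k (Fin n → ℂ) →ₗ[ℂ] ⋀[ℂ]^k (Fin n → ℂ))
    (hψ : ∀ g : Equiv.Perm (Fin n), Equiv.Perm.sign g = 1 → ∀ w,
      ψ (exteriorPower.map k (permA n g) w) = exteriorPower.map k (permA n g) (ψ w))
    (h0 : dualE n k x0 (ψ (vecE n k x0)) = 0)
    (h1 : dualE n k (Function.update x0 i0 c0) (ψ (vecE n k x0)) = 0) : ψ = 0 := by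
  have key := aux_core hk h (fun y x => dualE n k y (ψ (vecE n k x)))
    (fun y x σ => by simp [dualE_perm]) 
    (fun y x σ => by
      rw [vecE_perm]
      rcases Int.units_eq_one_or (Equiv.Perm.sign σ) with e | e <;> simp [e])
    (fun y x g hg => by
      rw [← vecE_map, hψ g hg, dualE_map]) x0 hx0 c0 hc0 i0 h0 h1
  let b := (Pi.basisFun ℂ (Fin n)).exteriorPower k
  refine b.ext fun s => ?_
  refine b.repr.injective ?_
  ext t
  have e1 : b s = vecE n k (Set.powersetCard.ofFinEmbEquiv.symm s) := by
    simp only [b]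
    rw [exteriorPower.basis_apply]; rfl
  have e2 : ∀ w, b.repr w t = dualE n k (Set.powersetCard.ofFinEmbEquiv.symm t) w := by
    intro w
    simp only [b]
    rw [exteriorPower.basis_repr_apply, exteriorPower.ιMultiDual, exteriorPower.ιMulti_family,
      exteriorPower.pairingDual, exteriorPower.alternatingMapLinearEquiv_apply_ιMulti]
    rfl
  rw [e2, e1, key _ _ (RelEmbedding.injective _) (RelEmbedding.injective _)]
  simp

/-- the standard representation -/
noncomputable def stdSub (n : ℕ) : Submodule ℂ (Fin n → ℂ) :=
  LinearMap.ker (Fintype.linearCombination ℂ (fun _ : Fin n => (1 : ℂ)))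

lemma mem_stdSub {n : ℕ} (v : Fin n → ℂ) : v ∈ stdSub n ↔ ∑ i, v i = 0 := by
  simp [stdSub, Fintype.linearCombination_apply]

lemma permA_mem {n : ℕ} (g : Equiv.Perm (Fin n)) : ∀ v ∈ stdSub n, permA n g v ∈ stdSub n := by
  intro v hv
  rw [mem_stdSub] at hv ⊢
  rw [← hv]
  exact Equiv.sum_comp (g⁻¹) v

noncomputable def stdRep (n : ℕ) : Equiv.Perm (Fin n) →* (stdSub n →ₗ[ℂ] stdSub n) where
  toFun g := (permA n g).restrict (permA_mem g)
  map_one' := by ext; simp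
  map_mul' a b := by ext; simp

noncomputable def stdP (n : ℕ) (hn : 1 ≤ n) : (Fin n → ℂ) →ₗ[ℂ] stdSub n :=
  LinearMap.codRestrict (stdSub n)
    { toFun := fun v i => v i - (∑ j, v j) / n
      map_add' := fun a b => by
        funext i; simp [Finset.sum_add_distrib]; ring
      map_smul' := fun a b => by
        funext i; simp [← Finset.mul_sum]; ring } (fun v => by
      rw [mem_stdSub]
      have : (n : ℂ) ≠ 0 := by exact_mod_cast (by omega : n ≠ 0)
      simp
      field_simp
      simp)

lemma stdP_apply {n : ℕ} (hn : 1 ≤ n) (v : Fin n → ℂ) (i : Fin n) :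
    (stdP n hn v : Fin n → ℂ) i = v i - (∑ j, v j) / n := rfl

lemma stdP_sub {n : ℕ} (hn : 1 ≤ n) : stdP n hn ∘ₗ (stdSub n).subtype = LinearMap.id := by
  apply LinearMap.ext
  intro v
  apply Subtype.ext
  funext i
  have := (mem_stdSub _).mp v.2
  simp [stdP_apply, this]

lemma stdP_perm {n : ℕ} (hn : 1 ≤ n) (g : Equiv.Perm (Fin n)) :
    stdP n hn ∘ₗ permA n g = stdRep n g ∘ₗ stdP n hn := by
  apply LinearMap.ext
  intro v
  apply Subtype.ext
  funext i
  change _ - _ = (stdP n hn v : Fin n → ℂ) (g⁻¹ i)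
  rw [stdP_apply, permA_apply]
  congr 2
  exact Equiv.sum_comp (g⁻¹) v

lemma sub_perm {n : ℕ} (g : Equiv.Perm (Fin n)) :
    (stdSub n).subtype ∘ₗ stdRep n g = permA n g ∘ₗ (stdSub n).subtype := by
  ext; rfl

lemma finrank_std {n : ℕ} (hn : 1 ≤ n) : Module.finrank ℂ (stdSub n) = n - 1 := by
  have h := LinearMap.finrank_range_add_finrank_ker
    (Fintype.linearCombination ℂ (fun _ : Fin n => (1 : ℂ)))
  have hs : LinearMap.range (Fintype.linearCombination ℂ (fun _ : Fin n => (1 : ℂ))) = ⊤ := by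
    rw [LinearMap.range_eq_top]
    intro c
    refine ⟨Pi.single ⟨0, by omega⟩ c, ?_⟩
    simp [Fintype.linearCombination_apply]
  rw [hs, finrank_top] at h
  simp at h
  unfold stdSub
  omega

noncomputable def extRep (n k : ℕ) :
    Equiv.Perm (Fin n) →* (⋀[ℂ]^k (stdSub n) →ₗ[ℂ] ⋀[ℂ]^k (stdSub n)) where
  toFun g := exteriorPower.map k (stdRep n g)
  map_one' := by rw [map_one]; exact exteriorPower.map_id
  map_mul' a b := by rw [map_mul]; exact (exteriorPower.map_comp _ _)

lemma extRep_finrank {n k : ℕ} (hn : 1 ≤ n) :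
    Module.finrank ℂ (⋀[ℂ]^k (stdSub n)) = (n - 1).choose k := by
  rw [exteriorPower.finrank_eq, finrank_std hn]

lemma comm_scalar {n k : ℕ} (h : 2 * k + 2 ≤ n)
    (φ : ⋀[ℂ]^k (stdSub n) →ₗ[ℂ] ⋀[ℂ]^k (stdSub n))
    (hφ : ∀ g : Equiv.Perm (Fin n), Equiv.Perm.sign g = 1 → ∀ w,
      φ (extRep n k g w) = extRep n k g (φ w)) :
    ∃ c : ℂ, ∀ w, φ w = c • w := by
  have hn : 1 ≤ n := by omega
  rcases Nat.eq_zero_or_pos k with rfl | hk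
  · have h1 : Module.finrank ℂ (⋀[ℂ]^0 (stdSub n)) = 1 := by
      rw [extRep_finrank hn]; simp
    obtain ⟨v, hv, hv2⟩ := finrank_eq_one_iff'.mp h1
    obtain ⟨c, hc⟩ := hv2 (φ v)
    refine ⟨c, fun w => ?_⟩
    obtain ⟨d, rfl⟩ := hv2 w
    rw [map_smul, ← hc, smul_comm]
  set I := exteriorPower.map k (stdSub n).subtype with hI
  set P := exteriorPower.map k (stdP n hn) with hP
  have hPI : ∀ w, P (I w) = w := by
    intro w
    have : P ∘ₗ I = LinearMap.id := by
      rw [hP, hI, ← exteriorPower.map_comp, stdP_sub, exteriorPower.map_id]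
    exact LinearMap.congr_fun this w
  have hPg : ∀ g w, P (exteriorPower.map k (permA n g) w) = extRep n k g (P w) := by
    intro g w
    have : P ∘ₗ exteriorPower.map k (permA n g) = extRep n k g ∘ₗ P := by
      change _ = exteriorPower.map k (stdRep n g) ∘ₗ P
      rw [hP, ← exteriorPower.map_comp, stdP_perm, exteriorPower.map_comp]
    exact LinearMap.congr_fun this w
  have hIg : ∀ g w, I (extRep n k g w) = exteriorPower.map k (permA n g) (I w) := by
    intro g w
    have : I ∘ₗ exteriorPower.map k (stdRep n g) = exteriorPower.map k (permA n g) ∘ₗ I := by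
      rw [hI, ← exteriorPower.map_comp, sub_perm, exteriorPower.map_comp]
    exact LinearMap.congr_fun this w
  let x0 : Fin k → Fin n := Fin.castLE (by omega)
  have hx0 : Function.Injective x0 := Fin.castLE_injective _
  let c0 : Fin n := ⟨k, by omega⟩
  have hc0 : ∀ i, x0 i ≠ c0 := by
    intro i e
    have := congrArg Fin.val e
    simp [x0, c0] at this
    omega
  let i0 : Fin k := ⟨0, hk⟩
  let F : Fin 3 → (⋀[ℂ]^k (Fin n → ℂ) →ₗ[ℂ] ⋀[ℂ]^k (Fin n → ℂ)) :=
    ![LinearMap.id, I ∘ₗ P, I ∘ₗ φ ∘ₗ P]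
  have hF : ∀ i, ∀ g : Equiv.Perm (Fin n), Equiv.Perm.sign g = 1 → ∀ w,
      F i (exteriorPower.map k (permA n g) w) = exteriorPower.map k (permA n g) (F i w) := by
    intro i g hg w
    fin_cases i
    · simp [F]
    · simp [F, hPg, hIg]
    · simp [F, hPg, hIg, hφ g hg]
  let L : Fin 3 → (Fin 2 → ℂ) := fun i => ![dualE n k x0 (F i (vecE n k x0)),
    dualE n k (Function.update x0 i0 c0) (F i (vecE n k x0))]
  have hdep : ¬ LinearIndependent ℂ L := by
    intro hli
    have := hli.fintype_card_le_finrank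
    simp at this
  obtain ⟨a, ha, j, hj⟩ := Fintype.not_linearIndependent_iff.mp hdep
  have hz : ∑ i, a i • F i = 0 := by
    refine comm_zero hk h x0 hx0 c0 hc0 i0 _ ?_ ?_ ?_
    · intro g hg w
      simp only [LinearMap.sum_apply, LinearMap.smul_apply, hF _ g hg, map_sum, map_smul]
    · have := congrFun ha 0
      simpa [L, Fin.sum_univ_three] using this
    · have := congrFun ha 1
      simpa [L, Fin.sum_univ_three] using this
  have hz' : ∀ w, a 0 • w + a 1 • I (P w) + a 2 • I (φ (P w)) = 0 := by
    intro w
    have := LinearMap.congr_fun hz w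
    simpa [F, Fin.sum_univ_three] using this
  have hs : ∀ w, (a 0 + a 1) • w + a 2 • φ w = 0 := by
    intro w
    have := congrArg P (hz' (I w))
    simpa [hPI, add_smul] using this
  by_cases h2 : a 2 = 0
  · exfalso
    have hpos : 0 < (n-1).choose k := Nat.choose_pos (by omega)
    have hlt : (n-1).choose k < n.choose k := by
      obtain ⟨m, rfl⟩ : ∃ m, n = m + 1 := ⟨n - 1, by omega⟩
      obtain ⟨l, rfl⟩ : ∃ l, k = l + 1 := ⟨k - 1, by omega⟩
      rw [Nat.choose_succ_succ]
      have : 0 < m.choose l := Nat.choose_pos (by omega)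
      simp
      omega
    have : Nontrivial (⋀[ℂ]^k (stdSub n)) := by
      apply Module.nontrivial_of_finrank_pos (R := ℂ)
      rw [extRep_finrank hn]; exact hpos
    obtain ⟨v, hv⟩ := exists_ne (0 : ⋀[ℂ]^k (stdSub n))
    have h01 : a 0 + a 1 = 0 := by
      have := hs v
      simp [h2] at this
      exact this.resolve_right hv
    by_cases h0 : a 0 = 0
    · have h1 : a 1 = 0 := by simpa [h0] using h01
      apply hj
      fin_cases j <;> simp [h0, h1, h2]
    · have hinj : Function.Injective P := by
        rw [← LinearMap.ker_eq_bot, LinearMap.ker_eq_bot']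
        intro w hw
        have := hz' w
        simp [hw, h0] at this
        exact_mod_cast this
      have := LinearMap.finrank_le_finrank_of_injective hinj
      rw [extRep_finrank hn, exteriorPower.finrank_eq] at this
      simp at this
      omega
  · refine ⟨-(a 2)⁻¹ * (a 0 + a 1), fun w => ?_⟩
    have := hs w
    have h3 : a 2 • φ w = -((a 0 + a 1) • w) := by
      rw [eq_neg_iff_add_eq_zero, add_comm]; exact this
    calc φ w = (a 2)⁻¹ • (a 2 • φ w) := by rw [smul_smul, inv_mul_cancel₀ h2, one_smul]
      _ = _ := by rw [h3, smul_neg, smul_smul, neg_mul]; exact (neg_smul _ w).symm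

lemma choose_lt_succ_aux {m r : ℕ} (h : 2 * r + 2 ≤ m) : m.choose r < m.choose (r + 1) := by
  have h1 := Nat.choose_succ_right_eq m r
  have h2 : 0 < m.choose r := Nat.choose_pos (by omega)
  have h3 : r + 2 ≤ m - r := by omega
  by_contra hcon
  push Not at hcon
  have h4 : m.choose (r + 1) * (r + 1) ≤ m.choose r * (r + 1) := Nat.mul_le_mul_right _ hcon
  have h5 : m.choose r * (r + 2) ≤ m.choose r * (m - r) := Nat.mul_le_mul_left _ h3
  nlinarith

lemma simple_bound {G : Type} [Group G] [Fintype G] (V : FDRep ℂ G) [hV : Simple V] :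
    Module.finrank ℂ V ≤ Fintype.card G := by
  have hnt : Nontrivial V := by
    by_contra hcon
    rw [not_nontrivial_iff_subsingleton] at hcon
    apply id_nonzero V
    ext x
    exact Subsingleton.elim (α := V) _ _
  obtain ⟨v, hv⟩ := exists_ne (0 : V)
  let S : Submodule ℂ V := Submodule.span ℂ (Set.range fun g : G => V.ρ g v)
  have hS : ∀ g : G, ∀ w ∈ S, V.ρ g w ∈ S := by
    intro g w hw
    refine Submodule.span_induction (p := fun w _ => V.ρ g w ∈ S) ?_ ?_ ?_ ?_ hw
    · rintro _ ⟨a, rfl⟩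
      apply Submodule.subset_span
      exact ⟨g * a, by simp⟩
    · simp
    · intro x y _ _ hx hy; rw [map_add]; exact S.add_mem hx hy
    · intro c x _ hx; rw [map_smul]; exact S.smul_mem c hx
  let ρS : Representation ℂ G S :=
    { toFun := fun g => (V.ρ g).restrict (hS g)
      map_one' := by ext; simp
      map_mul' := fun a b => by ext; simp }
  let f : FDRep.of ρS ⟶ V := ⟨InducedCategory.homMk (ModuleCat.ofHom S.subtype), fun g => by
    ext x; rfl⟩
  have hmono : Mono f := by
    apply ConcreteCategory.mono_of_injective
    intro x y hxy
    exact Subtype.ext hxy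
  have hvS : v ∈ S := Submodule.subset_span ⟨1, by simp⟩
  have hne : f ≠ 0 := by
    intro h0
    apply hv
    have : (ConcreteCategory.hom f) (⟨v, hvS⟩ : S) = (ConcreteCategory.hom (0 : FDRep.of ρS ⟶ V)) (⟨v, hvS⟩ : S) := by rw [h0]
    exact this
  have hiso : IsIso f := isIso_of_mono_of_nonzero hne
  have e := (FDRep.isoToLinearEquiv (asIso f)).finrank_eq
  rw [← e]
  exact finrank_range_le_card (R := ℂ) (fun g : G => V.ρ g v)

lemma cd_finite (n p : ℕ) : (cdExtp' n p).Finite := by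
  apply Set.Finite.subset (Set.finite_Iic (Fintype.card (alternatingGroup (Fin n))))
  rintro d ⟨_, V, hV, rfl, _⟩
  exact simple_bound V

lemma choose_mem {n p k : ℕ} (h : 2 * k + 2 ≤ n) (hp : ¬ p ∣ (n - 1).choose k) :
    (n - 1).choose k ∈ cdExtp' n p := by
  have hn : 1 ≤ n := by omega
  refine ⟨hp, FDRep.of ((extRep n k).comp (alternatingGroup (Fin n)).subtype), ?_,
    extRep_finrank hn, FDRep.of (extRep n k), fun g => rfl⟩
  have hpos : 0 < (n-1).choose k := Nat.choose_pos (by omega)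
  have : Nontrivial (⋀[ℂ]^k (stdSub n)) := by
    apply Module.nontrivial_of_finrank_pos (R := ℂ)
    rw [extRep_finrank hn]; exact hpos
  obtain ⟨v, hv⟩ := exists_ne (0 : ⋀[ℂ]^k (stdSub n))
  rw [FDRep.simple_iff_end_is_rank_one, finrank_eq_one_iff']
  refine ⟨𝟙 _, ?_, ?_⟩
  · intro h0
    apply hv
    exact congrArg (fun f : (FDRep.of ((extRep n k).comp (alternatingGroup (Fin n)).subtype) ⟶ _) =>
      (f.hom.hom.hom v : ⋀[ℂ]^k (stdSub n))) h0
  · intro f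
    obtain ⟨c, hc⟩ := comm_scalar h (f.hom.hom.hom) (fun g hg w => by
      have := f.comm ⟨g, Equiv.Perm.mem_alternatingGroup.mpr hg⟩
      exact congrArg (fun q => (q.hom.hom w : ⋀[ℂ]^k (stdSub n))) this)
    refine ⟨c, ?_⟩
    apply Action.Hom.ext
    apply InducedCategory.hom_ext
    apply ModuleCat.hom_ext
    apply LinearMap.ext
    intro w
    exact (hc w).symm

theorem stmt8 (n : ℕ) (hn : 1 ≤ n) (p : ℕ) (hp : p.Prime) :
    ((Finset.range n).filter fun x => ¬ p ∣ Nat.choose (n - 1) x).card / 2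
      ≤ (cdExtp' n p).ncard := by
  set T := (Finset.range n).filter fun x => ¬ p ∣ Nat.choose (n - 1) x with hT
  set S := T.filter fun x => 2 * x + 2 ≤ n with hS
  have h1 : (T.filter fun x => n < 2 * x + 1).card ≤ S.card := by
    apply Finset.card_le_card_of_injOn (fun x => n - 1 - x)
    · intro x hx
      simp only [hS, hT, Finset.coe_filter, Finset.mem_filter, Finset.mem_range,
        Set.mem_ofPred_eq] at hx ⊢
      refine ⟨⟨by omega, ?_⟩, by omega⟩
      rw [Nat.choose_symm (by omega)]
      exact hx.1.2
    · intro x hx y hy hxy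
      simp only [hT, Finset.coe_filter, Finset.mem_filter, Finset.mem_range,
        Set.mem_ofPred_eq] at hx hy hxy
      omega
  have h2 : (T.filter fun x => 2 * x + 1 = n).card ≤ 1 := by
    rw [Finset.card_le_one]
    intro a ha b hb
    simp only [Finset.mem_filter] at ha hb
    omega
  have h3 : T ⊆ S ∪ (T.filter fun x => n < 2 * x + 1) ∪ (T.filter fun x => 2 * x + 1 = n) := by
    intro x hx
    simp only [hS, Finset.mem_union, Finset.mem_filter, hx, true_and]
    omega
  have h4 : T.card / 2 ≤ S.card := by
    have a1 := Finset.card_le_card h3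
    have a2 := Finset.card_union_le (S ∪ (T.filter fun x => n < 2 * x + 1))
      (T.filter fun x => 2 * x + 1 = n)
    have a3 := Finset.card_union_le S (T.filter fun x => n < 2 * x + 1)
    omega
  have hmono : ∀ x y : ℕ, x < y → 2 * y + 2 ≤ n → (n - 1).choose x < (n - 1).choose y := by
    intro x y hxy
    induction y, hxy using Nat.le_induction with
    | base => intro hy; exact choose_lt_succ_aux (by omega)
    | succ y hy ih =>
      intro hy2
      exact (ih (by omega)).trans (choose_lt_succ_aux (by omega))
  have h5 : S.card = (S.image fun x => (n - 1).choose x).card := by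
    rw [Finset.card_image_of_injOn]
    intro x hx y hy hxy
    simp only [hS, Finset.coe_filter, Set.mem_ofPred_eq] at hx hy hxy
    rcases lt_trichotomy x y with hlt | heq | hlt
    · exact absurd hxy (hmono x y hlt hy.2).ne
    · exact heq
    · exact absurd hxy (hmono y x hlt hx.2).ne'
  refine h4.trans ?_
  rw [h5, ← Set.ncard_coe_finset]
  refine Set.ncard_le_ncard ?_ (cd_finite n p)
  intro d hd
  simp only [hS, hT, Finset.coe_image, Finset.coe_filter, Finset.mem_filter, Set.mem_image,
    Set.mem_ofPred_eq] at hd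
  obtain ⟨x, ⟨⟨_, hx1⟩, hx2⟩, rfl⟩ := hd
  exact choose_mem hx2 hx1
end
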